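/- Let U₁ ⊆ ℂ^{n₁} and U₂ ⊆ ℂ^{n₂} be open sets, f_a : U_a → ℂ holomorphic, and x_a ∈ U_a with f_a(x_a) = 0 and with the germ of f_a at x_a nonzero (a = 1,2). Identify ℂ^{n₁} × ℂ^{n₂} with ℂ^{n₁+n₂}, set f := f₁ ∘ pr₁ + f₂ ∘ pr₂ on U₁ × U₂ and x := (x₁, x₂). Then lct(f, x) = min{1, lct(f₁, x₁) + lct(f₂, x₂)}. -/

import Mathlib

open MeasureTheory Filter Topology

noncomputable section

variable {E : Type*} [NormedAddCommGroup E] [NormedSpace ℂ E] [MeasureSpace E]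

/-- `g` is holomorphic on some open neighborhood of `x`. -/
def HolNear (g : E → ℂ) (x : E) : Prop :=
  ∃ W : Set E, IsOpen W ∧ x ∈ W ∧ DifferentiableOn ℂ g W

/-- `g` satisfies the multiplier condition for `(f, α)` at `x`, where `U` is the domain of the
holomorphic function `f`: on some open neighborhood `V ∋ x` contained in the domains of `f` and
`g`, the function `|g|²/|f|^{2α}` is Lebesgue integrable. -/
def MultCond (f : E → ℂ) (U : Set E) (g : E → ℂ) (x : E) (α : ℝ) : Prop :=
  ∃ V : Set E, IsOpen V ∧ x ∈ V ∧ V ⊆ U ∧ DifferentiableOn ℂ g V ∧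
    IntegrableOn (fun y => ‖g y‖ ^ 2 / ‖f y‖ ^ (2 * α)) V volume

/-- `α` is a jumping coefficient of `f` at `x`. -/
def JumpCoeff (f : E → ℂ) (U : Set E) (x : E) (α : ℝ) : Prop :=
  ∃ g : E → ℂ, HolNear g x ∧ (∀ α' : ℝ, α' < α → MultCond f U g x α') ∧ ¬ MultCond f U g x α

/-- the log canonical threshold of `f` at `x`. -/
def Lct (f : E → ℂ) (U : Set E) (x : E) : ℝ :=
  sSup {α : ℝ | 0 ≤ α ∧ MultCond f U (fun _ => 1) x α}

/-- Cauchy estimate for the Fréchet derivative of a bounded holomorphic function. -/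
theorem norm_fderiv_le_of_bounded_ball {X : Type*} [NormedAddCommGroup X] [NormedSpace ℂ X]
    {f : X → ℂ} {p : X} {r M : ℝ} (hr : 0 < r)
    (hf : ∀ y ∈ Metric.ball p (2 * r), DifferentiableAt ℂ f y)
    (hM : ∀ y ∈ Metric.ball p (2 * r), ‖f y‖ ≤ M) :
    ∀ y ∈ Metric.ball p r, ‖fderiv ℂ f y‖ ≤ M / r := by
  intro y hy
  have hM0 : 0 ≤ M := (norm_nonneg _).trans (hM p (Metric.mem_ball_self (by positivity)))
  refine ContinuousLinearMap.opNorm_le_bound _ (by positivity) fun v => ?_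
  rcases eq_or_ne v 0 with rfl | hv
  · simp
  have hv' : 0 < ‖v‖ := norm_pos_iff.2 hv
  have hR : 0 < r / ‖v‖ := by positivity
  have hmem : ∀ ζ ∈ Metric.closedBall (0 : ℂ) (r / ‖v‖), y + ζ • v ∈ Metric.ball p (2 * r) := by
    intro ζ hζ
    rw [mem_closedBall_zero_iff, le_div_iff₀ hv'] at hζ
    rw [Metric.mem_ball, dist_eq_norm] at hy ⊢
    calc ‖y + ζ • v - p‖ = ‖(y - p) + ζ • v‖ := by congr 1; abel
      _ ≤ ‖y - p‖ + ‖ζ‖ * ‖v‖ := (norm_add_le _ _).trans (by rw [norm_smul])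
      _ < 2 * r := by linarith
  have hd : ∀ ζ ∈ Metric.closedBall (0 : ℂ) (r / ‖v‖),
      HasDerivAt (fun ζ : ℂ => f (y + ζ • v)) (fderiv ℂ f (y + ζ • v) v) ζ := by
    intro ζ hζ
    have h1 : HasDerivAt (fun ζ : ℂ => y + ζ • v) v ζ := by
      simpa using ((hasDerivAt_id ζ).smul_const v).const_add y
    exact (hf _ (hmem ζ hζ)).hasFDerivAt.comp_hasDerivAt ζ h1
  have hdc : DiffContOnCl ℂ (fun ζ : ℂ => f (y + ζ • v)) (Metric.ball 0 (r / ‖v‖)) := by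
    apply DifferentiableOn.diffContOnCl
    rw [closure_ball _ hR.ne']
    exact fun ζ hζ => (hd ζ hζ).differentiableAt.differentiableWithinAt
  have := Complex.norm_deriv_le_of_forall_mem_sphere_norm_le hR hdc (C := M)
    fun ζ hζ => hM _ (hmem ζ (Metric.sphere_subset_closedBall hζ))
  rw [(hd 0 (Metric.mem_closedBall_self hR.le)).deriv] at this
  simp only [zero_smul, add_zero] at this
  calc _ ≤ _ := this
    _ = M / r * ‖v‖ := by field_simp

/-- Holomorphic dependence of an integral of a holomorphic function along a family of affine
maps. -/
theorem differentiableAt_integral_affine {n m : ℕ} {f : (Fin n → ℂ) → ℂ} {p : Fin n → ℂ}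
    {R C : ℝ} (hf : ∀ y ∈ Metric.ball p R, DifferentiableAt ℂ f y)
    (hC : ∀ y ∈ Metric.ball p R, ‖fderiv ℂ f y‖ ≤ C)
    {a b : ℝ} (κ : ℝ → ℂ) (hκ : Continuous κ)
    (L : ℝ → (Fin m → ℂ) →L[ℂ] (Fin n → ℂ)) (hL : Continuous L)
    (c : ℝ → (Fin n → ℂ)) (hc : Continuous c)
    {q : Fin m → ℂ} {s : Set (Fin m → ℂ)} (hs : s ∈ 𝓝 q)
    (hmem : ∀ θ ∈ Set.uIcc a b, ∀ y ∈ s, L θ y + c θ ∈ Metric.ball p R) :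
    DifferentiableAt ℂ (fun y => ∫ θ in a..b, κ θ * f (L θ y + c θ)) q := by
  have hfc : ContinuousOn f (Metric.ball p R) := fun y hy => (hf y hy).continuousAt.continuousWithinAt
  have hcont : ∀ y ∈ s, ContinuousOn (fun θ => κ θ * f (L θ y + c θ)) (Set.uIcc a b) := by
    intro y hy
    refine hκ.continuousOn.mul (hfc.comp (f := fun θ => L θ y + c θ) ?_ fun θ hθ => hmem θ hθ y hy)
    exact ((hL.clm_apply continuous_const).add hc).continuousOn
  have hq := mem_of_mem_nhds hs
  have key := intervalIntegral.hasFDerivAt_integral_of_dominated_of_fderiv_le (𝕜 := ℂ) (μ := volume)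
    (a := a) (b := b) (s := s) (x₀ := q) (F := fun y θ => κ θ * f (L θ y + c θ))
    (F' := fun y θ => κ θ • (fderiv ℂ f (L θ y + c θ)).comp (L θ))
    (bound := fun θ => ‖κ θ‖ * (C * ‖L θ‖)) hs ?_ ?_ ?_ ?_ ?_ ?_
  · exact key.differentiableAt
  · filter_upwards [hs] with y hy
    exact ((hcont y hy).mono Set.uIoc_subset_uIcc).aestronglyMeasurable measurableSet_uIoc
  · exact (hcont q hq).intervalIntegrable
  · apply Measurable.aestronglyMeasurable
    have h1 : Measurable fun θ => fderiv ℂ f (L θ q + c θ) :=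
      (measurable_fderiv ℂ f).comp ((hL.clm_apply continuous_const).add hc).measurable
    have h2 : Continuous fun x : ((Fin n → ℂ) →L[ℂ] ℂ) × ((Fin m → ℂ) →L[ℂ] (Fin n → ℂ)) =>
      x.1.comp x.2 := by fun_prop
    exact hκ.measurable.smul (h2.measurable.comp (h1.prodMk hL.measurable))
  · refine Eventually.of_forall fun θ hθ y hy => ?_
    rw [norm_smul]
    have h := hC _ (hmem θ (Set.uIoc_subset_uIcc hθ) y hy)
    gcongr
    exact (ContinuousLinearMap.opNorm_comp_le _ _).trans (by gcongr)
  · apply Continuous.intervalIntegrable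
    fun_prop
  · refine Eventually.of_forall fun θ hθ y hy => ?_
    have h := (hf _ (hmem θ (Set.uIoc_subset_uIcc hθ) y hy)).hasFDerivAt
    have h1 : HasFDerivAt (fun y => L θ y + c θ) (L θ) y := (L θ).hasFDerivAt.add_const _
    exact (h.comp y h1).const_mul (κ θ)

/-- A function holomorphic near a point has, on a small ball, a bounded derivative. -/
theorem exists_ball_fderiv_bounded {X : Type*} [NormedAddCommGroup X] [NormedSpace ℂ X]
    {f : X → ℂ} {p : X} (hf : ∀ᶠ y in 𝓝 p, DifferentiableAt ℂ f y) :
    ∃ r > 0, ∃ C, (∀ y ∈ Metric.ball p r, DifferentiableAt ℂ f y) ∧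
      ∀ y ∈ Metric.ball p r, ‖fderiv ℂ f y‖ ≤ C := by
  have hc : ∀ᶠ y in 𝓝 p, ‖f y‖ < ‖f p‖ + 1 :=
    hf.self_of_nhds.continuousAt.norm.eventually (gt_mem_nhds (by linarith))
  obtain ⟨ε, hε, h⟩ := Metric.eventually_nhds_iff_ball.1 (hf.and hc)
  have h2 : 2 * (ε / 2) = ε := by ring
  refine ⟨ε / 2, by positivity, (‖f p‖ + 1) / (ε / 2), fun y hy => (h y ?_).1, ?_⟩
  · exact Metric.ball_subset_ball (by linarith) hy
  · refine norm_fderiv_le_of_bounded_ball (by positivity) (fun y hy => (h y ?_).1)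
      (fun y hy => (h y ?_).2.le) <;> rwa [h2] at hy

/-- Directional derivatives of holomorphic functions are holomorphic. -/
theorem eventually_differentiableAt_fderiv_apply {n : ℕ} {f : (Fin n → ℂ) → ℂ} {p : Fin n → ℂ}
    (hf : ∀ᶠ y in 𝓝 p, DifferentiableAt ℂ f y) (v : Fin n → ℂ) :
    ∀ᶠ y in 𝓝 p, DifferentiableAt ℂ (fun y => fderiv ℂ f y v) y := by
  obtain ⟨r, hr, C, hd, hC⟩ := exists_ball_fderiv_bounded hf
  set ρ : ℝ := r / (2 * (‖v‖ + 1)) with hρ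
  have hv : 0 ≤ ‖v‖ := norm_nonneg v
  have hρ0 : 0 < ρ := by positivity
  have hρv : ρ * ‖v‖ < r / 2 := by
    rw [hρ, div_mul_eq_mul_div, div_lt_div_iff₀ (by positivity) (by positivity)]
    nlinarith
  have hmem : ∀ ζ ∈ Metric.closedBall (0 : ℂ) ρ, ∀ y ∈ Metric.ball p (r / 2),
      y + ζ • v ∈ Metric.ball p r := by
    intro ζ hζ y hy
    rw [mem_closedBall_zero_iff] at hζ
    rw [Metric.mem_ball, dist_eq_norm] at hy ⊢
    calc ‖y + ζ • v - p‖ = ‖(y - p) + ζ • v‖ := by congr 1; abel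
      _ ≤ ‖y - p‖ + ‖ζ‖ * ‖v‖ := (norm_add_le _ _).trans (by rw [norm_smul])
      _ ≤ ‖y - p‖ + ρ * ‖v‖ := by gcongr
      _ < r := by linarith
  have hformula : ∀ y ∈ Metric.ball p (r / 2), fderiv ℂ f y v =
      ∫ θ in (0 : ℝ)..2 * Real.pi, ((2 * Real.pi * Complex.I : ℂ)⁻¹ *
        (deriv (circleMap 0 ρ) θ * ((circleMap 0 ρ θ) ^ 2)⁻¹)) *
        f (ContinuousLinearMap.id ℂ (Fin n → ℂ) y + circleMap 0 ρ θ • v) := by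
    intro y hy
    have hdd : ∀ ζ ∈ Metric.closedBall (0 : ℂ) ρ,
        HasDerivAt (fun ζ : ℂ => f (y + ζ • v)) (fderiv ℂ f (y + ζ • v) v) ζ := by
      intro ζ hζ
      have h1 : HasDerivAt (fun ζ : ℂ => y + ζ • v) v ζ := by
        simpa using ((hasDerivAt_id ζ).smul_const v).const_add y
      exact (hd _ (hmem ζ hζ y hy)).hasFDerivAt.comp_hasDerivAt ζ h1
    have hdc : DiffContOnCl ℂ (fun ζ : ℂ => f (y + ζ • v)) (Metric.ball 0 ρ) := by
      apply DifferentiableOn.diffContOnCl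
      rw [closure_ball _ hρ0.ne']
      exact fun ζ hζ => (hdd ζ hζ).differentiableAt.differentiableWithinAt
    have h3 := hdc.deriv_eq_smul_circleIntegral hρ0
    rw [(hdd 0 (Metric.mem_closedBall_self hρ0.le)).deriv] at h3
    simp only [zero_smul, add_zero] at h3
    have h4 : fderiv ℂ f y v = (2 * Real.pi * Complex.I : ℂ)⁻¹ •
        ∮ z in C(0, ρ), (1 / (z - 0) ^ 2) • f (y + z • v) := by
      rw [h3, smul_smul, inv_mul_cancel₀ Complex.two_pi_I_ne_zero, one_smul]
    rw [h4, circleIntegral, ← intervalIntegral.integral_smul]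
    refine intervalIntegral.integral_congr fun θ _ => ?_
    simp only [smul_eq_mul, sub_zero, one_div, ContinuousLinearMap.id_apply]
    ring
  have hκ : Continuous fun θ : ℝ => ((2 * Real.pi * Complex.I : ℂ)⁻¹ *
        (deriv (circleMap 0 ρ) θ * ((circleMap 0 ρ θ) ^ 2)⁻¹)) := by
    simp only [deriv_circleMap]
    refine continuous_const.mul (((continuous_circleMap 0 ρ).mul continuous_const).mul
      (((continuous_circleMap 0 ρ).pow 2).inv₀ fun θ => pow_ne_zero _ (circleMap_ne_center hρ0.ne')))
  filter_upwards [Metric.ball_mem_nhds p (half_pos hr)] with q hq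
  have hs : Metric.ball p (r / 2) ∈ 𝓝 q := Metric.isOpen_ball.mem_nhds hq
  have := differentiableAt_integral_affine hd hC (a := 0) (b := 2 * Real.pi) _ hκ
    (fun _ => ContinuousLinearMap.id ℂ (Fin n → ℂ)) continuous_const
    (fun θ => circleMap 0 ρ θ • v) ((continuous_circleMap 0 ρ).smul continuous_const) hs
    (fun θ _ y hy => hmem _ (Metric.sphere_subset_closedBall (circleMap_mem_sphere 0 hρ0.le θ)) y hy)
  refine this.congr_of_eventuallyEq ?_
  filter_upwards [hs] with y hy using hformula y hy

/-- Functions holomorphic near a point are continuously differentiable there. -/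
theorem contDiffAt_one_of_eventually_differentiableAt {n : ℕ} {f : (Fin n → ℂ) → ℂ}
    {p : Fin n → ℂ} (hf : ∀ᶠ y in 𝓝 p, DifferentiableAt ℂ f y) : ContDiffAt ℂ 1 f p := by
  rw [contDiffAt_one_iff]
  have h1 : ∀ᶠ y in 𝓝 p, ∀ i, DifferentiableAt ℂ (fun y => fderiv ℂ f y (Pi.single i 1)) y :=
    eventually_all.2 fun i => eventually_differentiableAt_fderiv_apply hf _
  refine ⟨fderiv ℂ f, _, hf.and h1, fun y hy => ?_, fun y hy => hy.1.hasFDerivAt⟩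
  apply ContinuousAt.continuousWithinAt
  rw [continuousAt_clm_apply]
  intro v
  have hv : v = ∑ i, v i • (Pi.single i 1 : Fin n → ℂ) := by
    ext j; simp [Finset.sum_apply, Pi.single_apply]
  have : (fun y => fderiv ℂ f y v) =
      fun y => ∑ i, v i • fderiv ℂ f y (Pi.single i 1) := by
    funext y; conv_lhs => rw [hv]
    simp
  rw [this]
  exact tendsto_finsetSum _ fun i _ => ((hy.2 i).continuousAt.const_smul (v i))

theorem ContDiffAt.eventually_differentiableAt_one {X Y : Type*} [NormedAddCommGroup X]
    [NormedSpace ℂ X] [NormedAddCommGroup Y] [NormedSpace ℂ Y] {f : X → Y} {p : X}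
    (hf : ContDiffAt ℂ 1 f p) : ∀ᶠ y in 𝓝 p, DifferentiableAt ℂ f y := by
  filter_upwards [hf.eventually (by simp)] with y hy using hy.differentiableAt (by simp)

theorem ContDiffAt.fderiv_apply_one {n : ℕ} {f : (Fin n → ℂ) → ℂ} {p : Fin n → ℂ}
    (hf : ContDiffAt ℂ 1 f p) (v : Fin n → ℂ) : ContDiffAt ℂ 1 (fun y => fderiv ℂ f y v) p :=
  contDiffAt_one_of_eventually_differentiableAt
    (eventually_differentiableAt_fderiv_apply hf.eventually_differentiableAt_one v)

/-- Identity theorem along a complex line inside a ball. -/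
theorem eq_zero_of_eventually_zero_on_line {n : ℕ} {f : (Fin n → ℂ) → ℂ} {B : Set (Fin n → ℂ)}
    (hB : Convex ℝ B) (hBo : IsOpen B) (hf : DifferentiableOn ℂ f B) {y y' : Fin n → ℂ}
    (hy : y ∈ B) (hy' : y' ∈ B) (h : ∀ᶠ t : ℂ in 𝓝 0, f (y + t • (y' - y)) = 0) : f y' = 0 := by
  set L : ℂ → (Fin n → ℂ) := fun t => y + t • (y' - y) with hL
  have hLd : Differentiable ℂ L := by fun_prop
  have hUo : IsOpen (L ⁻¹' B) := hBo.preimage hLd.continuous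
  have hUc : Convex ℝ (L ⁻¹' B) := by
    intro s hs t ht a b ha hb hab
    have : L (a • s + b • t) = a • L s + b • L t := by
      simp only [hL]
      have h1 : y = (a + b) • y := by rw [hab, one_smul]
      ext j
      have := congrFun h1 j
      simp only [Pi.add_apply, Pi.smul_apply, Pi.sub_apply, smul_eq_mul, Complex.real_smul] at this ⊢
      push_cast at this
      linear_combination this
    rw [Set.mem_preimage, this]
    exact hB hs ht ha hb hab
  have han : AnalyticOnNhd ℂ (f ∘ L) (L ⁻¹' B) :=
    (hf.comp hLd.differentiableOn (Set.mapsTo_preimage L B)).analyticOnNhd hUo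
  have h0 : (0 : ℂ) ∈ L ⁻¹' B := by simpa [hL] using hy
  have h1 : (1 : ℂ) ∈ L ⁻¹' B := by simpa [hL] using hy'
  have := han.eqOn_zero_of_preconnected_of_eventuallyEq_zero hUc.isPreconnected h0 h h1
  simpa [hL] using this

theorem ContDiffAt.exists_ball_differentiableOn {n : ℕ} {f : (Fin n → ℂ) → ℂ} {p : Fin n → ℂ}
    (hf : ContDiffAt ℂ 1 f p) : ∃ r > 0, ∀ y ∈ Metric.ball p r, DifferentiableAt ℂ f y :=
  Metric.eventually_nhds_iff_ball.1 hf.eventually_differentiableAt_one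

/-- The ring of holomorphic germs is a domain. -/
theorem eventuallyEq_zero_or_of_mul {n : ℕ} {f g : (Fin n → ℂ) → ℂ} {p : Fin n → ℂ}
    (hf' : ∀ᶠ y in 𝓝 p, ContinuousAt f y) (hg : ContDiffAt ℂ 1 g p)
    (h : ∀ᶠ y in 𝓝 p, f y * g y = 0) : (∀ᶠ y in 𝓝 p, f y = 0) ∨ ∀ᶠ y in 𝓝 p, g y = 0 := by
  by_cases hz : ∀ᶠ y in 𝓝 p, f y = 0
  · exact Or.inl hz
  right
  obtain ⟨r, hr, hd⟩ := hg.exists_ball_differentiableOn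
  have hfreq : ∃ᶠ y in 𝓝 p, f y ≠ 0 := not_eventually.1 hz
  have hball : ∀ᶠ y in 𝓝 p, y ∈ Metric.ball p r := Metric.ball_mem_nhds p hr
  obtain ⟨y, hy0, hyB, hyc, hyz⟩ := (hfreq.and_eventually
    (hball.and
      (hf'.and h.eventually_nhds))).exists
  have hgz : ∀ᶠ z in 𝓝 y, g z = 0 := by
    filter_upwards [hyz, hyc.eventually_ne hy0] with z hz hz'
    exact (mul_eq_zero.1 hz).resolve_left hz'
  filter_upwards [Metric.ball_mem_nhds p hr] with y' hy'
  refine eq_zero_of_eventually_zero_on_line (convex_ball p r) Metric.isOpen_ball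
    (fun z hz => (hd z hz).differentiableWithinAt) hyB hy' ?_
  have hc : ContinuousAt (fun t : ℂ => y + t • (y' - y)) 0 := by fun_prop
  exact hc.eventually (by simpa using hgz)

theorem ContDiffAt.eventually_continuousAt_one {X Y : Type*} [NormedAddCommGroup X]
    [NormedSpace ℂ X] [NormedAddCommGroup Y] [NormedSpace ℂ Y] {f : X → Y} {p : X}
    (hf : ContDiffAt ℂ 1 f p) : ∀ᶠ y in 𝓝 p, ContinuousAt f y :=
  hf.eventually_differentiableAt_one.mono fun _ h => h.continuousAt

theorem ContDiffAt.eventuallyEq_zero_or_of_mul {n : ℕ} {f g : (Fin n → ℂ) → ℂ} {p : Fin n → ℂ}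
    (hf : ContDiffAt ℂ 1 f p) (hg : ContDiffAt ℂ 1 g p)
    (h : ∀ᶠ y in 𝓝 p, f y * g y = 0) : (∀ᶠ y in 𝓝 p, f y = 0) ∨ ∀ᶠ y in 𝓝 p, g y = 0 :=
  _root_.eventuallyEq_zero_or_of_mul hf.eventually_continuousAt_one hg h

theorem contDiff_coord {n : ℕ} (i : Fin n) : ContDiff ℂ 1 fun y : Fin n → ℂ => y i :=
  contDiff_apply ℂ ℂ i

theorem not_eventually_coord_eq {n : ℕ} (i : Fin n) (p : Fin n → ℂ) :
    ¬ ∀ᶠ y in 𝓝 p, y i = 0 := by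
  intro h
  have hc : ContinuousAt (fun t : ℂ => Function.update p i (p i + t)) 0 :=
    (continuous_const.update i (by fun_prop)).continuousAt
  have h2 := hc.eventually (by simpa using h : ∀ᶠ y in 𝓝 (Function.update p i (p i + 0)), y i = 0)
  simp only [Function.update_self] at h2
  have h3 : ∀ᶠ t in 𝓝[≠] (0 : ℂ), p i + t = 0 := h2.filter_mono nhdsWithin_le_nhds
  have h4 : ∀ᶠ t in 𝓝[≠] (0 : ℂ), t ≠ -p i ∨ t ≠ 0 := by
    filter_upwards [self_mem_nhdsWithin] with t ht using Or.inr ht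
  by_cases hp : p i = 0
  · have h5 : ∀ᶠ t in 𝓝[≠] (0 : ℂ), False := by
      filter_upwards [h3, self_mem_nhdsWithin] with t ht ht'
      exact ht' (by simpa [hp] using ht)
    exact (h5.exists).elim fun _ h => h
  · exact hp (by simpa using h.self_of_nhds)

/-- If a product with a coordinate vanishes then so does the germ. -/
theorem ContDiffAt.eventually_zero_of_coord_mul {n : ℕ} {g : (Fin n → ℂ) → ℂ} {p : Fin n → ℂ}
    (hg : ContDiffAt ℂ 1 g p) (i : Fin n) (h : ∀ᶠ y in 𝓝 p, y i * g y = 0) :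
    ∀ᶠ y in 𝓝 p, g y = 0 :=
  (((contDiff_coord i).contDiffAt).eventuallyEq_zero_or_of_mul hg h).resolve_left
    (not_eventually_coord_eq i p)

theorem contDiff_update_zero {n : ℕ} (i : Fin n) :
    ContDiff ℂ 1 fun y : Fin n → ℂ => Function.update y i (0 : ℂ) := by
  rw [contDiff_pi]
  intro j
  by_cases h : j = i
  · subst h; simpa using contDiff_const
  · simpa [h] using contDiff_coord j

/-- Division of `f - f|_{y_i = 0}` by the coordinate `y_i`. -/
theorem ContDiffAt.exists_sub_eq_coord_mul {n : ℕ} {f : (Fin n → ℂ) → ℂ} {p : Fin n → ℂ}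
    (hf : ContDiffAt ℂ 1 f p) (i : Fin n) (hp : p i = 0) :
    ∃ g, ContDiffAt ℂ 1 g p ∧
      ∀ᶠ y in 𝓝 p, f y = f (Function.update y i 0) + y i * g y := by
  set v : Fin n → ℂ := Pi.single i 1 with hv
  have hf1 := hf.fderiv_apply_one v
  obtain ⟨r, hr, C, hd, hC⟩ := exists_ball_fderiv_bounded hf1.eventually_differentiableAt_one
  obtain ⟨r', hr', hd'⟩ := hf.exists_ball_differentiableOn
  set L : ℝ → (Fin n → ℂ) →L[ℂ] (Fin n → ℂ) := fun t =>
    ContinuousLinearMap.pi fun j => if j = i then (t : ℂ) • ContinuousLinearMap.proj i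
      else ContinuousLinearMap.proj j with hL
  have hLa : ∀ t y, L t y = Function.update y i ((t : ℂ) * y i) := by
    intro t y; ext j
    by_cases h : j = i
    · subst h; simp [hL]
    · simp [hL, h]
  have hLc : Continuous L := by
    have : L = fun t : ℝ => ContinuousLinearMap.pi (fun j => if j = i then 0
      else ContinuousLinearMap.proj j) + (t : ℂ) • ContinuousLinearMap.pi (fun j => if j = i then
        ContinuousLinearMap.proj i else 0) := by
      funext t; ext y j
      by_cases h : j = i
      · subst h; simp [hL]
      · simp [hL, h]
    rw [this]; fun_prop
  have hmem : ∀ t ∈ Set.uIcc (0 : ℝ) 1, ∀ r, ∀ y ∈ Metric.ball p r, L t y + (0 : Fin n → ℂ) ∈ Metric.ball p r := by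
    intro t ht r y hy
    rw [Set.uIcc_of_le zero_le_one] at ht
    have hr0 : 0 < r := Metric.pos_of_mem_ball hy
    rw [Metric.mem_ball, dist_pi_lt_iff hr0] at hy ⊢
    intro j
    rw [add_zero, hLa]
    by_cases h : j = i
    · subst h
      have := hy j
      rw [hp, dist_zero_right] at this
      rw [hp, dist_zero_right, Function.update_self, norm_mul, Complex.norm_real, Real.norm_eq_abs,
        abs_of_nonneg ht.1]
      nlinarith [ht.2, norm_nonneg (y j)]
    · simpa [h] using hy j
  set g : (Fin n → ℂ) → ℂ := fun y => ∫ t in (0 : ℝ)..1, (1 : ℂ) * fderiv ℂ f (L t y + 0) v with hg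
  refine ⟨g, contDiffAt_one_of_eventually_differentiableAt ?_, ?_⟩
  · filter_upwards [Metric.ball_mem_nhds p hr] with q hq
    exact differentiableAt_integral_affine hd hC (fun _ => 1) continuous_const L hLc (fun _ => 0)
      continuous_const (Metric.isOpen_ball.mem_nhds hq) fun t ht y hy => hmem t ht r y hy
  · filter_upwards [Metric.ball_mem_nhds p hr, Metric.ball_mem_nhds p hr'] with y hy hy'
    have hder : ∀ t ∈ Set.uIcc (0 : ℝ) 1,
        HasDerivAt (fun t : ℝ => f (L t y)) (y i * fderiv ℂ f (L t y + 0) v) t := by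
      intro t ht
      have h1 : HasDerivAt (fun t : ℂ => Function.update y i (t * y i)) (y i • v) (t : ℂ) := by
        rw [hasDerivAt_pi]
        intro j
        by_cases h : j = i
        · subst h; simpa [hv] using (hasDerivAt_id (t : ℂ)).mul_const (y j)
        · simpa [h, hv] using hasDerivAt_const (t : ℂ) (y j)
      have h2 := (hd' _ (hmem t ht r' y hy')).hasFDerivAt
      rw [add_zero, hLa] at h2 ⊢
      have h3 := (h2.comp_hasDerivAt (t : ℂ) h1).comp_ofReal
      simpa [hLa] using h3
    have hcont : ContinuousOn (fun t : ℝ => y i * fderiv ℂ f (L t y + 0) v) (Set.uIcc 0 1) := by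
      refine continuousOn_const.mul ?_
      have h1 : ContinuousOn (fun y => fderiv ℂ f y v) (Metric.ball p r) := fun y hy =>
        (hd y hy).continuousAt.continuousWithinAt
      exact h1.comp (f := fun t : ℝ => L t y + 0)
        ((hLc.clm_apply continuous_const).add continuous_const).continuousOn
        fun t ht => hmem t ht r y hy
    have h4 := intervalIntegral.integral_eq_sub_of_hasDerivAt hder hcont.intervalIntegrable
    rw [intervalIntegral.integral_const_mul] at h4
    simp only [hLa, Complex.ofReal_one, one_mul, Complex.ofReal_zero, zero_mul,
      Function.update_eq_self] at h4
    simp only [hg, one_mul, hLa]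
    rw [h4]; ring

theorem ContDiffAt.exists_eq_coord_mul {n : ℕ} {f : (Fin n → ℂ) → ℂ} {p : Fin n → ℂ}
    (hf : ContDiffAt ℂ 1 f p) (i : Fin n) (hp : p i = 0)
    (h0 : ∀ᶠ y in 𝓝 p, f (Function.update y i 0) = 0) :
    ∃ g, ContDiffAt ℂ 1 g p ∧ ∀ᶠ y in 𝓝 p, f y = y i * g y := by
  obtain ⟨g, hg, h⟩ := hf.exists_sub_eq_coord_mul i hp
  refine ⟨g, hg, ?_⟩
  filter_upwards [h, h0] with y h1 h2
  rw [h1, h2, zero_add]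

/-- The monomial with exponent vector `N`. -/
def monom {n : ℕ} (N : Fin n → ℕ) (y : Fin n → ℂ) : ℂ := ∏ i, y i ^ N i

theorem contDiff_monom {n : ℕ} (N : Fin n → ℕ) : ContDiff ℂ 1 (monom N) :=
  contDiff_prod fun i _ => (contDiff_coord i).pow _

theorem monom_add {n : ℕ} (N M : Fin n → ℕ) (y : Fin n → ℂ) :
    monom (N + M) y = monom N y * monom M y := by
  simp [monom, pow_add, Finset.prod_mul_distrib]

theorem monom_single {n : ℕ} (i : Fin n) (k : ℕ) (y : Fin n → ℂ) :
    monom (Pi.single i k) y = y i ^ k := by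
  rw [monom, Finset.prod_eq_single i] <;> simp +contextual

theorem monom_smul {n : ℕ} (k : ℕ) (N : Fin n → ℕ) (y : Fin n → ℂ) :
    monom (k • N) y = monom N y ^ k := by
  simp [monom, pow_mul', ← Finset.prod_pow]

theorem monom_zero {n : ℕ} (y : Fin n → ℂ) : monom 0 y = 1 := by simp [monom]

theorem monom_ne_zero {n : ℕ} {N : Fin n → ℕ} {y : Fin n → ℂ} (h : ∀ i, N i ≠ 0 → y i ≠ 0) :
    monom N y ≠ 0 := by
  refine Finset.prod_ne_zero_iff.2 fun i _ => ?_
  by_cases hi : N i = 0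
  · simp [hi]
  · exact pow_ne_zero _ (h i hi)

theorem monom_eq_zero {n : ℕ} {N : Fin n → ℕ} {y : Fin n → ℂ} {i : Fin n} (h : N i ≠ 0)
    (hy : y i = 0) : monom N y = 0 :=
  Finset.prod_eq_zero (Finset.mem_univ i) (by rw [hy, zero_pow h])

/-- Multiplication by a monomial is injective on holomorphic germs. -/
theorem ContDiffAt.eventually_zero_of_monom_mul {n : ℕ} (N : Fin n → ℕ) {g : (Fin n → ℂ) → ℂ}
    {p : Fin n → ℂ} (hg : ContDiffAt ℂ 1 g p) (h : ∀ᶠ y in 𝓝 p, monom N y * g y = 0) :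
    ∀ᶠ y in 𝓝 p, g y = 0 := by
  refine ((contDiff_monom N).contDiffAt.eventuallyEq_zero_or_of_mul hg h).resolve_left fun h0 => ?_
  have h1 : ∀ᶠ t in 𝓝[≠] (0 : ℂ), monom N (fun i => p i + t) = 0 := by
    have hc : ContinuousAt (fun t : ℂ => fun i => p i + t) 0 := by fun_prop
    exact (hc.eventually (by simpa using h0)).filter_mono nhdsWithin_le_nhds
  have h2 : ∀ᶠ t in 𝓝[≠] (0 : ℂ), ∀ i, p i + t ≠ 0 := by
    refine eventually_all.2 fun i => ?_
    by_cases hp : p i = 0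
    · filter_upwards [self_mem_nhdsWithin] with t ht
      simpa [hp] using ht
    · have hc : ContinuousAt (fun t : ℂ => p i + t) 0 := by fun_prop
      exact (hc.eventually_ne (by simpa using hp)).filter_mono nhdsWithin_le_nhds
  obtain ⟨t, ht1, ht2⟩ := (h1.and h2).exists
  exact monom_ne_zero (fun i _ => ht2 i) ht1

/-- The germ at `0` is a monomial times a unit. -/
def MonomialGerm {n : ℕ} (N : Fin n → ℕ) (f : (Fin n → ℂ) → ℂ) : Prop :=
  ∃ e : (Fin n → ℂ) → ℂ, ContDiffAt ℂ 1 e 0 ∧ e 0 ≠ 0 ∧ ∀ᶠ y in 𝓝 0, f y = monom N y * e y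

theorem exists_monomialGerm_of_mul {n : ℕ} (s : ℕ) : ∀ (N : Fin n → ℕ) (f g : (Fin n → ℂ) → ℂ),
    ∑ i, N i = s → ContDiffAt ℂ 1 f 0 → ContDiffAt ℂ 1 g 0 →
    MonomialGerm N (fun y => f y * g y) → ∃ M, M ≤ N ∧ MonomialGerm M f := by
  induction s with
  | zero =>
    rintro N f g hs hf hg ⟨e, he, he0, h⟩
    have hN : N = 0 := by
      ext i; simpa using (Finset.sum_eq_zero_iff.1 hs i (Finset.mem_univ i))
    subst hN
    refine ⟨0, le_rfl, f, hf, fun h0 => he0 ?_, by simp [monom_zero]⟩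
    have := h.self_of_nhds
    simpa [h0, monom_zero] using this.symm
  | succ s ih =>
    rintro N f g hs hf hg ⟨e, he, he0, h⟩
    obtain ⟨l, hl⟩ : ∃ l, N l ≠ 0 := by
      by_contra hcon
      push Not at hcon
      simp [hcon] at hs
    have hN : N = Pi.single l 1 + (N - Pi.single l 1) := by
      ext j
      by_cases hj : j = l
      · subst hj; simp; omega
      · simp [hj]
    have hsum : ∑ i, (N - Pi.single l 1 : Fin n → ℕ) i = s := by
      have : ∑ i, N i = ∑ i, (Pi.single l 1 + (N - Pi.single l 1) : Fin n → ℕ) i := by rw [← hN]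
      simp only [Pi.add_apply, Finset.sum_add_distrib, Finset.sum_pi_single', Finset.mem_univ,
        if_true] at this
      omega
    have hπ := (contDiff_update_zero l (n := n))
    have hπ0 : Function.update (0 : Fin n → ℂ) l 0 = 0 := by simp
    have hπc : Tendsto (fun y : Fin n → ℂ => Function.update y l (0 : ℂ)) (𝓝 0) (𝓝 0) := by
      have := hπ.continuous.tendsto 0
      rwa [hπ0] at this
    have hcomp : ∀ {f : (Fin n → ℂ) → ℂ}, ContDiffAt ℂ 1 f 0 →
        ContDiffAt ℂ 1 (fun y => f (Function.update y l 0)) 0 := by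
      intro f hf
      exact ContDiffAt.comp (0 : Fin n → ℂ) (by rwa [hπ0]) hπ.contDiffAt
    have hz : ∀ᶠ y in 𝓝 (0 : Fin n → ℂ), f (Function.update y l 0) * g (Function.update y l 0) = 0 := by
      filter_upwards [hπc.eventually h] with y hy
      rw [hy, monom_eq_zero hl (by simp), zero_mul]
    have key : ∀ f g f1 : (Fin n → ℂ) → ℂ, ContDiffAt ℂ 1 f1 0 → ContDiffAt ℂ 1 g 0 →
        (∀ᶠ y in 𝓝 0, f y = y l * f1 y) → (∀ᶠ y in 𝓝 0, f y * g y = monom N y * e y) →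
        ∀ᶠ y in 𝓝 0, f1 y * g y = monom (N - Pi.single l 1 : Fin n → ℕ) y * e y := by
      intro f g f1 hf1 hg hff h
      have : ∀ᶠ y in 𝓝 (0 : Fin n → ℂ), y l * (f1 y * g y - monom (N - Pi.single l 1 : Fin n → ℕ) y * e y) = 0 := by
        filter_upwards [hff, h] with y h1 h2
        rw [h1, hN, monom_add, monom_single, pow_one] at h2
        linear_combination h2
      filter_upwards [((hf1.mul hg).sub ((contDiff_monom _).contDiffAt.mul he)).eventually_zero_of_coord_mul
        l this] with y hy
      exact sub_eq_zero.1 hy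
    rcases (hcomp hf).eventuallyEq_zero_or_of_mul (hcomp hg) hz with h1 | h1
    · obtain ⟨f1, hf1, hff⟩ := hf.exists_eq_coord_mul l rfl h1
      obtain ⟨M, hM, e1, he1, he10, hM1⟩ := ih _ f1 g hsum hf1 hg ⟨e, he, he0, key f g f1 hf1 hg hff h⟩
      refine ⟨Pi.single l 1 + M, ?_, e1, he1, he10, ?_⟩
      · rw [hN]; gcongr
      · filter_upwards [hff, hM1] with y h2 h3
        rw [h2, h3, monom_add, monom_single]; ring
    · obtain ⟨g1, hg1, hgg⟩ := hg.exists_eq_coord_mul l rfl h1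
      have h' : ∀ᶠ y in 𝓝 0, g y * f y = monom N y * e y := by
        filter_upwards [h] with y hy; rw [← hy, mul_comm]
      have h2 := key g f g1 hg1 hf hgg h'
      obtain ⟨M, hM, hM1⟩ := ih _ f g1 hsum hf hg1 ⟨e, he, he0, by
        filter_upwards [h2] with y hy; rw [← hy, mul_comm]⟩
      exact ⟨M, hM.trans tsub_le_self, hM1⟩

/-- Divisors of a monomial germ are monomial germs. -/
theorem MonomialGerm.of_mul {n : ℕ} {N : Fin n → ℕ} {f g : (Fin n → ℂ) → ℂ}
    (hf : ContDiffAt ℂ 1 f 0) (hg : ContDiffAt ℂ 1 g 0)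
    (h : MonomialGerm N (fun y => f y * g y)) : ∃ M, M ≤ N ∧ MonomialGerm M f :=
  exists_monomialGerm_of_mul _ N f g rfl hf hg h

/-- Two monomial germs whose difference vanishes or is a monomial germ have comparable
exponents. -/
theorem MonomialGerm.le_or_le {n : ℕ} {α β : Fin n → ℕ} {a b : (Fin n → ℂ) → ℂ}
    (ha : MonomialGerm α a) (hb : MonomialGerm β b)
    (hab : (∀ᶠ y in 𝓝 0, a y - b y = 0) ∨ ∃ γ, MonomialGerm γ (fun y => a y - b y)) :
    α ≤ β ∨ β ≤ α := by
  obtain ⟨e, he, he0, hae⟩ := ha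
  obtain ⟨e', he', he0', hbe⟩ := hb
  set μ : Fin n → ℕ := α ⊓ β with hμ
  set α' : Fin n → ℕ := α - μ with hα'
  set β' : Fin n → ℕ := β - μ with hβ'
  have hα : α = μ + α' := by ext i; simp [hα', hμ]
  have hβ : β = μ + β' := by ext i; simp [hβ', hμ]
  have hdisj : ∀ i, α' i = 0 ∨ β' i = 0 := by
    intro i; simp [hα', hβ', hμ]; omega
  by_contra hcon
  push Not at hcon
  obtain ⟨l, hl⟩ : ∃ l, α' l ≠ 0 := by
    by_contra h
    push Not at h
    exact hcon.1 fun i => by have := congrFun hα i; have := congrFun hβ i; simp [h i] at *; omega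
  obtain ⟨j, hj⟩ : ∃ j, β' j ≠ 0 := by
    by_contra h
    push Not at h
    exact hcon.2 fun i => by have := congrFun hα i; have := congrFun hβ i; simp [h i] at *; omega
  -- points vanishing exactly on `S`
  have hpt : ∀ S : Finset (Fin n), Tendsto (fun t : ℂ => fun i => if i ∈ S then (0 : ℂ) else t)
      (𝓝[≠] 0) (𝓝 0) := by
    intro S
    have hc : Continuous (fun t : ℂ => fun i : Fin n => if i ∈ S then (0 : ℂ) else t) :=
      continuous_pi fun i => by split_ifs <;> fun_prop
    have := hc.tendsto 0
    have h0 : (fun i : Fin n => if i ∈ S then (0 : ℂ) else 0) = 0 := by ext; simp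
    rw [h0] at this
    exact this.mono_left nhdsWithin_le_nhds
  have main : ∀ (α' β' : Fin n → ℕ) (e e' : (Fin n → ℂ) → ℂ), ContDiffAt ℂ 1 e' 0 →
      e' 0 ≠ 0 → (∀ i, α' i = 0 ∨ β' i = 0) → ∀ l, α' l ≠ 0 → ∀ S : Finset (Fin n), l ∈ S →
      (∀ i ∈ S, β' i = 0) →
      (∀ᶠ y : Fin n → ℂ in 𝓝 0, (∀ i ∈ S, y i = 0) → monom α' y * e y = monom β' y * e' y) →
      False := by
    intro α' β' e e' he' he0' hdisj l hl S hlS hS h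
    have h1 := (hpt S).eventually (h.and (he'.continuousAt.eventually_ne he0'))
    obtain ⟨t, ⟨ht1, ht2⟩, ht0⟩ := (h1.and self_mem_nhdsWithin).exists
    have := ht1 (by simp +contextual)
    rw [monom_eq_zero hl (by simp [hlS]), zero_mul] at this
    refine mul_ne_zero (monom_ne_zero fun i hi => ?_) ht2 this.symm
    have : i ∉ S := fun h => hi (hS i h)
    simpa [this] using ht0
  have hsub : ∀ᶠ y in 𝓝 0, a y - b y = monom μ y * (monom α' y * e y - monom β' y * e' y) := by
    filter_upwards [hae, hbe] with y h1 h2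
    rw [h1, h2, hα, hβ, monom_add, monom_add]; ring
  have hC : ContDiffAt ℂ 1 (fun y => monom α' y * e y - monom β' y * e' y) 0 :=
    ((contDiff_monom _).contDiffAt.mul he).sub ((contDiff_monom _).contDiffAt.mul he')
  rcases hab with hab | ⟨γ, e₂, he₂, he₂0, hγ⟩
  · have h1 : ∀ᶠ y in 𝓝 0, monom μ y * (monom α' y * e y - monom β' y * e' y) = 0 := by
      filter_upwards [hab, hsub] with y h1 h2
      rw [← h2, h1]
    refine main α' β' e e' he' he0' hdisj l hl {l} (by simp) ?_ ?_
    · simpa using (hdisj l).resolve_left hl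
    · filter_upwards [hC.eventually_zero_of_monom_mul μ h1] with y hy _
      exact sub_eq_zero.1 hy
  · obtain ⟨M, -, e₃, he₃, he₃0, h3⟩ := MonomialGerm.of_mul (N := γ) hC (contDiff_monom μ).contDiffAt
      ⟨e₂, he₂, he₂0, by
        filter_upwards [hγ, hsub] with y h1 h2
        rw [← h1, h2, mul_comm]⟩
    obtain ⟨k, hk⟩ : ∃ k, M k ≠ 0 := by
      by_contra h
      push Not at h
      have hM : M = 0 := by ext; simp [h]
      have := h3.self_of_nhds
      beta_reduce at this
      rw [monom_eq_zero hl rfl, monom_eq_zero hj rfl, hM, monom_zero] at this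
      simp at this
      exact he₃0 this.symm
    rcases hdisj k with hk' | hk'
    · refine main β' α' e' e he he0 (fun i => (hdisj i).symm) j hj {j, k} (by simp) ?_ ?_
      · simpa [hk'] using (hdisj j).resolve_right hj
      · filter_upwards [h3] with y hy hS
        rw [monom_eq_zero hk (hS k (by simp)), zero_mul] at hy
        exact (sub_eq_zero.1 hy).symm
    · refine main α' β' e e' he' he0' hdisj l hl {l, k} (by simp) ?_ ?_
      · simpa [hk'] using (hdisj l).resolve_left hl
      · filter_upwards [h3] with y hy hS
        rw [monom_eq_zero hk (hS k (by simp)), zero_mul] at hy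
        exact sub_eq_zero.1 hy

theorem contDiff_tail {m : ℕ} : ContDiff ℂ 1 (Fin.tail : (Fin (m + 1) → ℂ) → (Fin m → ℂ)) :=
  contDiff_pi.2 fun i => contDiff_coord i.succ

theorem contDiff_cons {m : ℕ} : ContDiff ℂ 1
    (fun x : ℂ × (Fin m → ℂ) => (Fin.cons x.1 x.2 : Fin (m + 1) → ℂ)) := by
  refine contDiff_pi.2 fun i => ?_
  refine Fin.cases ?_ (fun j => ?_) i
  · simp only [Fin.cons_zero]
    exact contDiff_fst
  · simp only [Fin.cons_succ]
    exact (contDiff_coord j).comp contDiff_snd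

theorem ContDiffAt.comp_tail {m : ℕ} {Y : Type*} [NormedAddCommGroup Y] [NormedSpace ℂ Y]
    {a : (Fin m → ℂ) → Y} {z : ℂ} {w : Fin m → ℂ} (ha : ContDiffAt ℂ 1 a w) :
    ContDiffAt ℂ 1 (fun y => a (Fin.tail y)) (Fin.cons z w : Fin (m + 1) → ℂ) := by
  have h : ContDiffAt ℂ 1 a (Fin.tail (Fin.cons z w : Fin (m + 1) → ℂ)) := by
    rwa [Fin.tail_cons]
  exact h.comp (Fin.cons z w : Fin (m + 1) → ℂ) contDiff_tail.contDiffAt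

theorem Filter.Eventually.comp_tail {m : ℕ} {P : (Fin m → ℂ) → Prop} {z : ℂ} {w : Fin m → ℂ}
    (h : ∀ᶠ x in 𝓝 w, P x) : ∀ᶠ y in 𝓝 (Fin.cons z w : Fin (m + 1) → ℂ), P (Fin.tail y) := by
  have : Tendsto (Fin.tail : (Fin (m + 1) → ℂ) → (Fin m → ℂ)) (𝓝 (Fin.cons z w)) (𝓝 w) := by
    simpa using (contDiff_tail (m := m)).continuous.tendsto (Fin.cons z w)
  exact this.eventually h

theorem Filter.Eventually.comp_cons {m : ℕ} {P : (Fin (m + 1) → ℂ) → Prop} {z : ℂ} {w : Fin m → ℂ}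
    (h : ∀ᶠ y in 𝓝 (Fin.cons z w : Fin (m + 1) → ℂ), P y) :
    ∀ᶠ x in 𝓝 (z, w), P (Fin.cons x.1 x.2) :=
  (contDiff_cons (m := m)).continuous.continuousAt.eventually h

theorem Filter.Eventually.slice {m : ℕ} {P : (Fin (m + 1) → ℂ) → Prop} {z : ℂ} {w : Fin m → ℂ}
    (h : ∀ᶠ y in 𝓝 (Fin.cons z w : Fin (m + 1) → ℂ), P y) : ∀ᶠ t in 𝓝 z, P (Fin.cons t w) := by
  have hc : ContinuousAt (fun t : ℂ => (t, w)) z := by fun_prop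
  exact hc.eventually h.comp_cons

theorem ContDiffAt.comp_cons_fst {m : ℕ} {Y : Type*} [NormedAddCommGroup Y] [NormedSpace ℂ Y]
    {f : (Fin (m + 1) → ℂ) → Y} {z : ℂ} {w : Fin m → ℂ}
    (hf : ContDiffAt ℂ 1 f (Fin.cons z w : Fin (m + 1) → ℂ)) :
    ContDiffAt ℂ 1 (fun x => f (Fin.cons z x)) w :=
  ContDiffAt.comp (g := f) (f := fun x : Fin m → ℂ => (Fin.cons z x : Fin (m + 1) → ℂ)) w hf
    (contDiff_cons.comp (contDiff_const.prodMk contDiff_id)).contDiffAt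

theorem hasDerivAt_cons {m : ℕ} (w : Fin m → ℂ) (z : ℂ) :
    HasDerivAt (fun t : ℂ => (Fin.cons t w : Fin (m + 1) → ℂ)) (Pi.single 0 1) z := by
  rw [hasDerivAt_pi]
  intro i
  refine Fin.cases ?_ (fun j => ?_) i
  · simp only [Fin.cons_zero, Pi.single_eq_same]
    exact hasDerivAt_id z
  · simp only [Fin.cons_succ, Pi.single_eq_of_ne (Fin.succ_ne_zero j)]
    exact hasDerivAt_const z (w j)

/-- The restriction of `h` to a line parallel to the first coordinate axis. -/
def slice {m : ℕ} (h : (Fin (m + 1) → ℂ) → ℂ) (w : Fin m → ℂ) (z : ℂ) : ℂ := h (Fin.cons z w)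

theorem ContDiffAt.analyticAt_slice {m : ℕ} {h : (Fin (m + 1) → ℂ) → ℂ} {z : ℂ} {w : Fin m → ℂ}
    (hh : ContDiffAt ℂ 1 h (Fin.cons z w : Fin (m + 1) → ℂ)) : AnalyticAt ℂ (slice h w) z := by
  rw [Complex.analyticAt_iff_eventually_differentiableAt]
  filter_upwards [hh.eventually_differentiableAt_one.slice] with t ht
  exact ht.comp t ((contDiff_cons.comp (contDiff_id.prodMk contDiff_const)).differentiable
    (by simp)).differentiableAt

/-- Taylor expansion in the first coordinate with holomorphic coefficients. -/
theorem ContDiffAt.exists_taylor {m : ℕ} {f : (Fin (m + 1) → ℂ) → ℂ} {w : Fin m → ℂ}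
    (hf : ContDiffAt ℂ 1 f (Fin.cons 0 w : Fin (m + 1) → ℂ)) (d : ℕ) :
    ∃ (a : ℕ → (Fin m → ℂ) → ℂ) (u : (Fin (m + 1) → ℂ) → ℂ),
      (∀ i, ContDiffAt ℂ 1 (a i) w) ∧ ContDiffAt ℂ 1 u (Fin.cons 0 w : Fin (m + 1) → ℂ) ∧
      ∀ᶠ y in 𝓝 (Fin.cons 0 w : Fin (m + 1) → ℂ),
        f y = ∑ i ∈ Finset.range d, a i (Fin.tail y) * y 0 ^ i + y 0 ^ d * u y := by
  induction d with
  | zero => exact ⟨fun _ _ => 0, f, fun _ => contDiffAt_const, hf, by simp⟩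
  | succ d ih =>
    obtain ⟨a, u, ha, hu, h⟩ := ih
    obtain ⟨v, hv, huv⟩ := hu.exists_sub_eq_coord_mul 0 (by simp)
    refine ⟨fun i => if i = d then fun x => u (Fin.cons 0 x) else a i, v, fun i => ?_, hv, ?_⟩
    · beta_reduce
      split_ifs
      · exact hu.comp_cons_fst
      · exact ha i
    · filter_upwards [h, huv] with y h1 h2
      rw [Finset.sum_range_succ, h1, h2]
      have : Function.update y 0 (0 : ℂ) = Fin.cons 0 (Fin.tail y) := by
        ext i; refine Fin.cases ?_ (fun j => ?_) i <;> simp [Fin.tail]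
      rw [this]
      have hs : ∑ i ∈ Finset.range d, (if i = d then fun x => u (Fin.cons 0 x) else a i) (Fin.tail y)
          * y 0 ^ i = ∑ i ∈ Finset.range d, a i (Fin.tail y) * y 0 ^ i :=
        Finset.sum_congr rfl fun i hi => by rw [if_neg (Finset.mem_range.1 hi).ne]
      rw [hs]
      simp only [if_true]
      ring

/-- Iterated derivatives of slices are holomorphic in all variables. -/
theorem ContDiffAt.iteratedDeriv_slice {m : ℕ} {h : (Fin (m + 1) → ℂ) → ℂ}
    {p : Fin (m + 1) → ℂ} (hh : ContDiffAt ℂ 1 h p) (k : ℕ) :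
    ContDiffAt ℂ 1 (fun y : Fin (m + 1) → ℂ => iteratedDeriv k (slice h (Fin.tail y)) (y 0)) p := by
  induction k with
  | zero => simpa [slice] using hh
  | succ k ih =>
    refine (ih.fderiv_apply_one (Pi.single 0 1)).congr_of_eventuallyEq ?_
    filter_upwards [ih.eventually_differentiableAt_one] with y hy
    set G := fun y : Fin (m + 1) → ℂ => iteratedDeriv k (slice h (Fin.tail y)) (y 0) with hG
    have h1 : iteratedDeriv k (slice h (Fin.tail y)) =
        fun t => G (Fin.cons t (Fin.tail y)) := by
      funext t; simp [hG]
    rw [iteratedDeriv_succ, h1]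
    have h2 : HasDerivAt (fun t : ℂ => (Fin.cons t (Fin.tail y) : Fin (m + 1) → ℂ))
        (Pi.single 0 1) (y 0) := by
      exact hasDerivAt_cons _ _
    have h3 : HasFDerivAt G (fderiv ℂ G y) (Fin.cons (y 0) (Fin.tail y)) := by
      rw [Fin.cons_self_tail]; exact hy.hasFDerivAt
    exact (h3.comp_hasDerivAt (y 0) h2).deriv

theorem iteratedDeriv_zero_of_pow_mul {v : ℂ → ℂ} (hv : AnalyticAt ℂ v 0) {d j : ℕ} (hj : j < d) :
    iteratedDeriv j (fun z => z ^ d * v z) 0 = 0 := by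
  have ha : AnalyticAt ℂ (fun z : ℂ => z ^ d * v z) 0 := by fun_prop
  refine (natCast_le_analyticOrderAt_iff_iteratedDeriv_eq_zero ha).1 ?_ j hj
  rw [natCast_le_analyticOrderAt ha]
  exact ⟨v, hv, by simp⟩

theorem iteratedDeriv_self_of_pow_mul {v : ℂ → ℂ} (hv : AnalyticAt ℂ v 0) (d : ℕ) :
    iteratedDeriv d (fun z => z ^ d * v z) 0 = d.factorial * v 0 := by
  obtain ⟨w, hw, hvw⟩ : ∃ w : ℂ → ℂ, AnalyticAt ℂ w 0 ∧ ∀ᶠ z in 𝓝 0, v z - v 0 = (z - 0) ^ 1 • w z := by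
    have ha : AnalyticAt ℂ (fun z => v z - v 0) 0 := by fun_prop
    refine (natCast_le_analyticOrderAt ha).1 ?_
    rw [natCast_le_analyticOrderAt_iff_iteratedDeriv_eq_zero ha]
    intro i hi
    obtain rfl : i = 0 := by omega
    simp
  have h1 : (fun z => z ^ d * v z) =ᶠ[𝓝 0] fun z => z ^ (d + 1) * w z + z ^ d * v 0 := by
    filter_upwards [hvw] with z hz
    simp only [sub_zero, pow_one, smul_eq_mul] at hz
    rw [pow_succ, sub_eq_iff_eq_add.1 hz]; ring
  rw [h1.iteratedDeriv_eq]
  have e1 : (fun z => z ^ (d + 1) * w z + z ^ d * v 0) =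
    (fun z => z ^ (d + 1) * w z) + fun z => v 0 * z ^ d := by ext; simp [mul_comm]
  have c1 : AnalyticAt ℂ (fun z : ℂ => z ^ (d + 1) * w z) 0 := by fun_prop
  have c2 : AnalyticAt ℂ (fun z : ℂ => v 0 * z ^ d) 0 := by fun_prop
  rw [e1, iteratedDeriv_add c1.contDiffAt c2.contDiffAt, iteratedDeriv_zero_of_pow_mul hw (by omega),
    iteratedDeriv_const_mul_field, iteratedDeriv_fun_pow_zero]
  simp [mul_comm]

/-- Derivatives at `0` of a function with a given Taylor expansion. -/
theorem iteratedDeriv_of_taylor {s v : ℂ → ℂ} {c : ℕ → ℂ} {d : ℕ} (hv : AnalyticAt ℂ v 0)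
    (h : ∀ᶠ z in 𝓝 0, s z = ∑ i ∈ Finset.range d, c i * z ^ i + z ^ d * v z) :
    (∀ j < d, iteratedDeriv j s 0 = j.factorial * c j) ∧ iteratedDeriv d s 0 = d.factorial * v 0 := by
  have hs : ∀ j, iteratedDeriv j s 0 = ∑ i ∈ Finset.range d, c i * (if j = i then (j.factorial : ℂ) else 0)
      + iteratedDeriv j (fun z => z ^ d * v z) 0 := by
    intro j
    rw [EventuallyEq.iteratedDeriv_eq j (show s =ᶠ[𝓝 0] _ from h)]
    have e1 : (fun z => ∑ i ∈ Finset.range d, c i * z ^ i + z ^ d * v z) =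
      (fun z => ∑ i ∈ Finset.range d, c i * z ^ i) + fun z => z ^ d * v z := rfl
    have c1 : AnalyticAt ℂ (fun z : ℂ => ∑ i ∈ Finset.range d, c i * z ^ i) 0 := by fun_prop
    have c2 : AnalyticAt ℂ (fun z : ℂ => z ^ d * v z) 0 := by fun_prop
    rw [e1, iteratedDeriv_add c1.contDiffAt c2.contDiffAt]
    congr 1
    rw [iteratedDeriv_fun_sum]
    · refine Finset.sum_congr rfl fun i _ => ?_
      rw [iteratedDeriv_const_mul_field, iteratedDeriv_fun_pow_zero]
      congr 1; split_ifs with h1 h1 <;> simp_all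
    · intro i _
      have : AnalyticAt ℂ (fun z : ℂ => c i * z ^ i) 0 := by fun_prop
      exact this.contDiffAt
  constructor
  · intro j hj
    rw [hs, iteratedDeriv_zero_of_pow_mul hv hj]
    simp [hj, mul_comm]
  · rw [hs, iteratedDeriv_self_of_pow_mul hv]
    simp

/-- Holomorphic implicit function theorem for one dependent variable. -/
theorem ContDiffAt.exists_implicit {m : ℕ} {F : (Fin (m + 1) → ℂ) → ℂ} {z : ℂ} {w : Fin m → ℂ}
    (hF : ContDiffAt ℂ 1 F (Fin.cons z w : Fin (m + 1) → ℂ)) (h0 : F (Fin.cons z w) = 0)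
    (hd : deriv (slice F w) z ≠ 0) :
    ∃ b : (Fin m → ℂ) → ℂ, ContDiffAt ℂ 1 b w ∧ b w = z ∧
      ∀ᶠ x in 𝓝 w, F (Fin.cons (b x) x) = 0 := by
  set p : Fin (m + 1) → ℂ := Fin.cons z w with hp
  set Ψ : (Fin (m + 1) → ℂ) → (Fin (m + 1) → ℂ) := fun y => Fin.cons (F y) (Fin.tail y) with hΨ
  have hΨc : ContDiffAt ℂ 1 Ψ p :=
    contDiff_cons.contDiffAt.comp p (hF.prodMk contDiff_tail.contDiffAt)
  have hder : HasDerivAt (slice F w) (fderiv ℂ F p (Pi.single 0 1)) z := by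
    have h2 : HasDerivAt (fun t : ℂ => (Fin.cons t w : Fin (m + 1) → ℂ)) (Pi.single 0 1) z := by
      exact hasDerivAt_cons _ _
    exact (hF.differentiableAt (by simp)).hasFDerivAt.comp_hasDerivAt z h2
  have hD := (hΨc.differentiableAt (by simp)).hasFDerivAt
  set D := fderiv ℂ Ψ p with hDdef
  have hD0 : ∀ v, D v 0 = fderiv ℂ F p v := by
    intro v
    have h1 := (hasFDerivAt_pi'.1 hD 0)
    have h2 : (fun y => Ψ y 0) = F := by funext y; simp [hΨ]
    rw [h2] at h1
    rw [h1.fderiv]; rfl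
  have hDs : ∀ v (j : Fin m), D v j.succ = v j.succ := by
    intro v j
    have h1 := (hasFDerivAt_pi'.1 hD j.succ)
    have h2 : (fun y => Ψ y j.succ) = fun y => y j.succ := by funext y; simp [hΨ, Fin.tail]
    rw [h2] at h1
    have h3 := h1.unique (ContinuousLinearMap.proj (R := ℂ) (φ := fun _ : Fin (m + 1) => ℂ) j.succ).hasFDerivAt
    have := congrArg (fun L => L v) h3
    simpa using this
  rw [hder.deriv] at hd
  have hinj : Function.Injective D := by
    rw [injective_iff_map_eq_zero]
    intro v hv
    have hvs : ∀ j : Fin m, v j.succ = 0 := fun j => by rw [← hDs v j, hv]; rfl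
    have hv1 : v = v 0 • (Pi.single 0 1 : Fin (m + 1) → ℂ) := by
      ext i; refine Fin.cases ?_ (fun j => ?_) i <;> simp [hvs]
    have h1 := hD0 v
    rw [hv, hv1, map_smul] at h1
    have h2 : v 0 = 0 := by
      have := h1.symm
      simpa [hd] using this
    rw [hv1, h2, zero_smul]
  let D' : (Fin (m + 1) → ℂ) ≃L[ℂ] (Fin (m + 1) → ℂ) :=
    (LinearEquiv.ofInjectiveEndo D.toLinearMap hinj).toContinuousLinearEquiv
  have hD' : HasFDerivAt Ψ (D' : (Fin (m + 1) → ℂ) →L[ℂ] (Fin (m + 1) → ℂ)) p := by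
    have e : (D' : (Fin (m + 1) → ℂ) →L[ℂ] (Fin (m + 1) → ℂ)) = D := by ext v; rfl
    rw [e]; exact hD
  have hΨp : Ψ p = Fin.cons 0 w := by
    simp only [hΨ, h0]; simp [hp]
  have hinv := hΨc.to_localInverse hD' (by simp)
  have hright := (hΨc.hasStrictFDerivAt' hD' (by simp)).eventually_right_inverse
  have happ : hΨc.localInverse hD' (by simp) (Ψ p) = p :=
    (hΨc.hasStrictFDerivAt' hD' (by simp)).localInverse_apply_image
  set g := hΨc.localInverse hD' (by simp) with hg
  rw [hΨp] at hinv happ hright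
  refine ⟨fun x => g (Fin.cons 0 x) 0, ?_, by simp [happ, hp], ?_⟩
  · exact (contDiff_coord 0).contDiffAt.comp w hinv.comp_cons_fst
  · have hc : ContinuousAt (fun x : Fin m → ℂ => (Fin.cons 0 x : Fin (m + 1) → ℂ)) w :=
      (contDiff_cons.comp (contDiff_const.prodMk contDiff_id)).continuous.continuousAt
    filter_upwards [hc.eventually hright] with x hx
    have hx' : Ψ (g (Fin.cons 0 x)) = Fin.cons 0 x := hx
    have h1 : Fin.tail (g (Fin.cons 0 x)) = x := by
      have := congrArg Fin.tail hx'
      simpa [hΨ] using this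
    have h2 : F (g (Fin.cons 0 x)) = 0 := by
      have := congrFun hx' 0
      simpa [hΨ] using this
    rwa [← Fin.cons_self_tail (g (Fin.cons 0 x)), h1] at h2

/-- Holomorphic functions which become a monomial times a unit after finitely many analytic
coordinate changes, ramified coverings along a coordinate hyperplane and blow-ups along a
codimension two coordinate plane. In the last two cases, the function is also multiplied by the
Jacobian determinant. -/
inductive Resolvable {n : ℕ} : ((Fin n → ℂ) → ℂ) → (Fin n → ℂ) → Prop
  | mono (A : (Fin n → ℂ) → ℂ) (N : Fin n → ℕ) : MonomialGerm N A → Resolvable A 0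
  | biholo (A : (Fin n → ℂ) → ℂ) (φ ψ : (Fin n → ℂ) → (Fin n → ℂ)) (q : Fin n → ℂ) :
      ContDiffAt ℂ 1 φ q → ContDiffAt ℂ 1 ψ (φ q) → (∀ᶠ y in 𝓝 q, ψ (φ y) = y) →
      Resolvable (fun y => A (φ y)) q → Resolvable A (φ q)
  | power (A : (Fin n → ℂ) → ℂ) (i : Fin n) (k : ℕ) : 1 ≤ k →
      Resolvable (fun y => A (Function.update y i (y i ^ k)) * y i ^ (k - 1)) 0 → Resolvable A 0
  | blow (A : (Fin n → ℂ) → ℂ) (i j : Fin n) (R : ℝ) : i ≠ j → 0 < R →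
      (∀ ζ : ℂ, ‖ζ‖ ≤ R →
        Resolvable (fun y => A (Function.update y i (y i * y j)) * y j) (Pi.single i ζ)) →
      (∀ ζ : ℂ, ‖ζ‖ ≤ R⁻¹ →
        Resolvable (fun y => A (Function.update y j (y i * y j)) * y i) (Pi.single j ζ)) →
      Resolvable A 0

theorem contDiff_update_mul {n : ℕ} (i j k : Fin n) :
    ContDiff ℂ 1 fun y : Fin n → ℂ => Function.update y i (y j * y k) := by
  rw [contDiff_pi]
  intro l
  by_cases h : l = i
  · subst h; simpa using (contDiff_coord j).mul (contDiff_coord k)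
  · simpa [h] using contDiff_coord l

theorem contDiff_update_pow {n : ℕ} (i : Fin n) (k : ℕ) :
    ContDiff ℂ 1 fun y : Fin n → ℂ => Function.update y i (y i ^ k) := by
  rw [contDiff_pi]
  intro l
  by_cases h : l = i
  · subst h; simpa using (contDiff_coord l).pow k
  · simpa [h] using contDiff_coord l

theorem update_mul_single_left {n : ℕ} {i j : Fin n} (h : i ≠ j) (ζ : ℂ) :
    (fun y : Fin n → ℂ => Function.update y i (y i * y j)) (Pi.single i ζ) = 0 := by
  ext k; by_cases hk : k = i
  · subst hk; simp [Pi.single_eq_of_ne h.symm]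
  · simp [hk]

theorem update_mul_single_right {n : ℕ} {i j : Fin n} (h : i ≠ j) (ζ : ℂ) :
    (fun y : Fin n → ℂ => Function.update y j (y i * y j)) (Pi.single j ζ) = 0 := by
  ext k; by_cases hk : k = j
  · subst hk; simp [Pi.single_eq_of_ne h]
  · simp [hk]

theorem update_pow_zero {n : ℕ} (i : Fin n) {k : ℕ} (hk : 1 ≤ k) :
    (fun y : Fin n → ℂ => Function.update y i (y i ^ k)) 0 = 0 := by
  simp [show k ≠ 0 by omega]

theorem ContDiff.eventually_of_eq {n m : ℕ} {σ : (Fin n → ℂ) → (Fin m → ℂ)} (hσ : ContDiff ℂ 1 σ)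
    {q : Fin n → ℂ} {p : Fin m → ℂ} (h : σ q = p) {P : (Fin m → ℂ) → Prop}
    (hP : ∀ᶠ y in 𝓝 p, P y) : ∀ᶠ y in 𝓝 q, P (σ y) := by
  subst h; exact hσ.continuous.continuousAt.eventually hP

theorem Resolvable.congr {n : ℕ} {A : (Fin n → ℂ) → ℂ} {p : Fin n → ℂ} (h : Resolvable A p) :
    ∀ A', (∀ᶠ y in 𝓝 p, A' y = A y) → Resolvable A' p := by
  induction h with
  | mono A N hA =>
    obtain ⟨e, he, he0, h⟩ := hA
    exact fun A' hA' => .mono A' N ⟨e, he, he0, by filter_upwards [hA', h] with y h1 h2; rw [h1, h2]⟩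
  | biholo A φ ψ q hφ hψ h _ ih =>
    exact fun A' hA' => .biholo A' φ ψ q hφ hψ h (ih _ (hφ.continuousAt.eventually hA'))
  | power A i k hk _ ih =>
    refine fun A' hA' => .power A' i k hk (ih _ ?_)
    filter_upwards [(contDiff_update_pow i k).eventually_of_eq (update_pow_zero i hk) hA'] with y hy
    rw [hy]
  | blow A i j R hij hR _ _ ih1 ih2 =>
    refine fun A' hA' => .blow A' i j R hij hR (fun ζ hζ => ih1 ζ hζ _ ?_) (fun ζ hζ => ih2 ζ hζ _ ?_)
    · filter_upwards [(contDiff_update_mul i i j).eventually_of_eq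
        (update_mul_single_left hij ζ) hA'] with y hy
      rw [hy]
    · filter_upwards [(contDiff_update_mul j i j).eventually_of_eq
        (update_mul_single_right hij ζ) hA'] with y hy
      rw [hy]

theorem Resolvable.of_translate {n : ℕ} {A : (Fin n → ℂ) → ℂ} (p : Fin n → ℂ)
    (h : Resolvable (fun y => A (y + p)) 0) : Resolvable A p := by
  have := Resolvable.biholo A (fun y => y + p) (fun y => y - p) 0
    (contDiff_id.add contDiff_const).contDiffAt (contDiff_id.sub contDiff_const).contDiffAt
    (by simp) h
  simpa using this

/-- A monomial times a unit near an arbitrary point is resolvable. -/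
theorem Resolvable.of_monom_mul {n : ℕ} {A e : (Fin n → ℂ) → ℂ} {p : Fin n → ℂ} (N : Fin n → ℕ)
    (he : ContDiffAt ℂ 1 e p) (he0 : e p ≠ 0) (h : ∀ᶠ y in 𝓝 p, A y = monom N y * e y) :
    Resolvable A p := by
  have hT : ContDiff ℂ 1 fun y : Fin n → ℂ => y + p := contDiff_id.add contDiff_const
  have h0 : (fun y : Fin n → ℂ => y + p) 0 = p := by simp
  refine .of_translate p (.mono _ (fun i => if p i = 0 then N i else 0)
    ⟨fun y => (∏ i, if p i = 0 then 1 else (y i + p i) ^ N i) * e (y + p), ?_, ?_, ?_⟩)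
  · refine ContDiffAt.mul (contDiff_prod fun i _ => ?_).contDiffAt
      (ContDiffAt.comp (g := e) (f := fun y => y + p) 0 (by rwa [zero_add]) hT.contDiffAt)
    by_cases hp : p i = 0
    · simpa [hp] using contDiff_const
    · simpa [hp] using ((contDiff_coord i).add contDiff_const).pow _
  · refine mul_ne_zero (Finset.prod_ne_zero_iff.2 fun i _ => ?_) (by simpa using he0)
    by_cases hp : p i = 0 <;> simp [hp]
  · filter_upwards [hT.eventually_of_eq h0 h] with y hy
    rw [hy, ← mul_assoc]
    congr 1
    rw [monom, monom, ← Finset.prod_mul_distrib]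
    refine Finset.prod_congr rfl fun i _ => ?_
    by_cases hp : p i = 0 <;> simp [hp]

theorem Resolvable.of_pow_finset {n : ℕ} {D : ℕ} (hD : 1 ≤ D) (s : Finset (Fin n)) :
    ∀ {A : (Fin n → ℂ) → ℂ},
    Resolvable (fun y => A (fun i => if i ∈ s then y i ^ D else y i) * ∏ i ∈ s, y i ^ (D - 1)) 0 →
    Resolvable A 0 := by
  induction s using Finset.induction_on with
  | empty => intro A h; simpa using h
  | insert i s hi ih =>
    intro A h
    refine ih (.power _ i D hD ?_)
    convert h using 1
    funext y
    rw [Finset.prod_insert hi]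
    have h1 : (fun j => if j ∈ s then Function.update y i (y i ^ D) j ^ D
        else Function.update y i (y i ^ D) j) = fun j => if j ∈ insert i s then y j ^ D else y j := by
      funext j
      by_cases hj : j = i
      · subst hj; simp [hi]
      · simp [hj]
    have h2 : ∏ j ∈ s, Function.update y i (y i ^ D) j ^ (D - 1) = ∏ j ∈ s, y j ^ (D - 1) :=
      Finset.prod_congr rfl fun j hj => by
        rw [Function.update_of_ne (ne_of_mem_of_not_mem hj hi)]
    rw [h1, h2]; ring

theorem Resolvable.of_pow_tail {m : ℕ} {D : ℕ} (hD : 1 ≤ D) {A : (Fin (m + 1) → ℂ) → ℂ}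
    (h : Resolvable (fun y => A (Fin.cons (y 0) (fun j => y j.succ ^ D)) *
      monom (fun _ => D - 1) (Fin.tail y)) 0) : Resolvable A 0 := by
  refine Resolvable.of_pow_finset hD (Finset.univ.erase 0) ?_
  convert h using 1
  funext y
  have h1 : (fun i => if i ∈ Finset.univ.erase (0 : Fin (m + 1)) then y i ^ D else y i) =
      Fin.cons (y 0) (fun j => y j.succ ^ D) := by
    funext i; refine Fin.cases ?_ (fun j => ?_) i <;> simp
  rw [h1]
  congr 1
  have h2 := Fin.prod_univ_succ (fun i : Fin (m + 1) => y i ^ (D - 1))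
  rw [monom]
  have : Finset.univ.erase (0 : Fin (m + 1)) = Finset.univ.map (Fin.succEmb m) := by
    ext i; simp [Fin.exists_succ_eq]
  rw [this, Finset.prod_map]; rfl

theorem cons_zero_zero {m : ℕ} : (Fin.cons 0 0 : Fin (m + 1) → ℂ) = 0 := by
  ext i; refine Fin.cases ?_ (fun j => ?_) i <;> simp

theorem cons_zero_right {m : ℕ} (ζ : ℂ) : (Fin.cons ζ 0 : Fin (m + 1) → ℂ) = Pi.single 0 ζ := by
  ext i; refine Fin.cases ?_ (fun j => ?_) i <;> simp

theorem cons_single {m : ℕ} (i : Fin m) (ζ : ℂ) :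
    (Fin.cons 0 (Pi.single i ζ) : Fin (m + 1) → ℂ) = Pi.single i.succ ζ := by
  ext k; refine Fin.cases ?_ (fun j => ?_) k
  · simp [Pi.single_apply, (Fin.succ_ne_zero i).symm]
  · simp [Pi.single_apply]

theorem exists_order_le_of_iteratedDeriv_ne_zero {s : ℂ → ℂ} {z : ℂ} (hs : AnalyticAt ℂ s z) {j : ℕ}
    (h : iteratedDeriv j s z ≠ 0) : ∃ d ≤ j, analyticOrderAt s z = d := by
  have h1 : ¬ ((j + 1 : ℕ) : ℕ∞) ≤ analyticOrderAt s z := fun hle =>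
    h ((natCast_le_analyticOrderAt_iff_iteratedDeriv_eq_zero hs).1 hle j (by omega))
  rw [not_le] at h1
  obtain ⟨d, hd⟩ := ENat.ne_top_iff_exists.1 (ne_top_of_lt h1)
  rw [← hd] at h1 ⊢
  exact ⟨d, by have := Nat.cast_lt.1 h1; omega, rfl⟩

/-- The statement, used for inductions, that products of a function regular of order `d` in the
first variable with a function of the other variables are resolvable. -/
def RegularResolvable (m d : ℕ) : Prop :=
  ∀ (h : (Fin (m + 1) → ℂ) → ℂ) (z : ℂ) (w : Fin m → ℂ) (g : (Fin m → ℂ) → ℂ),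
    ContDiffAt ℂ 1 h (Fin.cons z w : Fin (m + 1) → ℂ) → analyticOrderAt (slice h w) z = d →
    ContDiffAt ℂ 1 g w → (¬ ∀ᶠ x in 𝓝 w, g x = 0) →
    Resolvable (fun y => g (Fin.tail y) * h y) (Fin.cons z w)

theorem MonomialGerm.not_eventually_zero {n : ℕ} {N : Fin n → ℕ} {f : (Fin n → ℂ) → ℂ}
    (h : MonomialGerm N f) : ¬ ∀ᶠ y in 𝓝 0, f y = 0 := by
  obtain ⟨e, he, he0, h⟩ := h
  intro h0
  have : ∀ᶠ y in 𝓝 0, e y = 0 := by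
    refine he.eventually_zero_of_monom_mul N ?_
    filter_upwards [h, h0] with y h1 h2
    rw [← h1, h2]
  exact he0 this.self_of_nhds

theorem MonomialGerm.contDiffAt {n : ℕ} {N : Fin n → ℕ} {f : (Fin n → ℂ) → ℂ}
    (h : MonomialGerm N f) : ContDiffAt ℂ 1 f 0 := by
  obtain ⟨e, he, he0, h⟩ := h
  exact ((contDiff_monom N).contDiffAt.mul he).congr_of_eventuallyEq h

theorem MonomialGerm.mul {n : ℕ} {N M : Fin n → ℕ} {f g : (Fin n → ℂ) → ℂ}
    (hf : MonomialGerm N f) (hg : MonomialGerm M g) : MonomialGerm (N + M) (fun y => f y * g y) := by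
  obtain ⟨e, he, he0, h⟩ := hf
  obtain ⟨e', he', he0', h'⟩ := hg
  refine ⟨fun y => e y * e' y, he.mul he', mul_ne_zero he0 he0', ?_⟩
  filter_upwards [h, h'] with y h1 h2
  rw [h1, h2, monom_add]; ring

theorem monomialGerm_monom {n : ℕ} (N : Fin n → ℕ) : MonomialGerm N (monom N) :=
  ⟨fun _ => 1, contDiffAt_const, one_ne_zero, by simp⟩

theorem MonomialGerm.pow {n : ℕ} {N : Fin n → ℕ} {f : (Fin n → ℂ) → ℂ}
    (hf : MonomialGerm N f) (k : ℕ) : MonomialGerm (k • N) (fun y => f y ^ k) := by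
  obtain ⟨e, he, he0, h⟩ := hf
  refine ⟨fun y => e y ^ k, he.pow k, pow_ne_zero k he0, ?_⟩
  filter_upwards [h] with y h1
  rw [h1, mul_pow, monom_smul]

theorem monom_update_mul {n : ℕ} (N : Fin n → ℕ) (x : Fin n → ℂ) (l : Fin n) (z : ℂ) :
    monom N (Function.update x l (z * x l)) = z ^ N l * monom N x := by
  rw [monom, monom, Fintype.prod_eq_mul_prod_compl l, Fintype.prod_eq_mul_prod_compl l,
    Function.update_self, mul_pow, mul_assoc]
  congr 2
  refine Finset.prod_congr rfl fun j hj => ?_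
  rw [Function.update_of_ne (by simpa using hj)]

theorem tail_update_succ {m : ℕ} (y : Fin (m + 1) → ℂ) (l : Fin m) (c : ℂ) :
    Fin.tail (Function.update y l.succ c) = Function.update (Fin.tail y) l c := by
  ext j; simp [Fin.tail, Function.update_apply]

theorem tail_update_zero' {m : ℕ} (y : Fin (m + 1) → ℂ) (c : ℂ) :
    Fin.tail (Function.update y 0 c) = Fin.tail y := by
  ext j; simp [Fin.tail]

theorem monom_eq_pow_mul {n : ℕ} {l : Fin n} {e e' : Fin n → ℕ} (he : e = Pi.single l 1 + e') (k : ℕ)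
    (x : Fin n → ℂ) : monom (k • e) x = x l ^ k * monom (k • e') x := by
  rw [he, smul_add, monom_add, monom_smul k (Pi.single l 1), monom_single, pow_one]

/-- A weighted homogeneous situation: after finitely many blow-ups of the first coordinate with the
other coordinates, either the function is a monomial times a unit, or the order drops. -/
theorem resolvable_of_weighted {m d : ℕ} (hS : ∀ d' < d, RegularResolvable m d') (s : ℕ) :
    ∀ (e : Fin m → ℕ), ∑ i, e i = s → ∀ (a : ℕ → (Fin m → ℂ) → ℂ) (u h : (Fin (m + 1) → ℂ) → ℂ)
      (g : (Fin m → ℂ) → ℂ) (γ : Fin m → ℕ) (i₀ : ℕ), (∀ i, ContDiffAt ℂ 1 (a i) 0) →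
      ContDiffAt ℂ 1 u 0 → u 0 ≠ 0 → i₀ < d → a i₀ 0 ≠ 0 → (∀ i, i + 1 = d → a i 0 = 0) →
      MonomialGerm γ g →
      (∀ᶠ y in 𝓝 0, h y = ∑ i ∈ Finset.range d,
        monom ((d - i) • e) (Fin.tail y) * a i (Fin.tail y) * y 0 ^ i + y 0 ^ d * u y) →
      Resolvable (fun y => g (Fin.tail y) * h y) 0 := by
  induction s with
  | zero =>
    intro e he a u h g γ i₀ ha hu hu0 hi₀ hai had hg hh
    have he0 : e = 0 := by
      ext i; simpa using Finset.sum_eq_zero_iff.1 he i (Finset.mem_univ i)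
    subst he0
    simp only [smul_zero, monom_zero, one_mul] at hh
    rw [← cons_zero_zero] at hh hu hu0 ⊢
    have hhc : ContDiffAt ℂ 1 h (Fin.cons 0 0 : Fin (m + 1) → ℂ) := by
      refine ContDiffAt.congr_of_eventuallyEq ?_ hh
      refine ContDiffAt.add (ContDiffAt.sum fun i _ => ((ha i).comp_tail).mul
        ((contDiff_coord 0).contDiffAt.pow i)) (((contDiff_coord 0).contDiffAt.pow d).mul hu)
    have h1 : ∀ᶠ z in 𝓝 0, slice h 0 z = ∑ i ∈ Finset.range d, a i 0 * z ^ i + z ^ d * slice u 0 z := by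
      filter_upwards [hh.slice] with z hz
      simpa [slice] using hz
    have h2 := (iteratedDeriv_of_taylor hu.analyticAt_slice h1).1 i₀ hi₀
    obtain ⟨d', hd', hord⟩ := exists_order_le_of_iteratedDeriv_ne_zero hhc.analyticAt_slice
      (j := i₀) (by rw [h2]; exact mul_ne_zero (by exact_mod_cast Nat.factorial_ne_zero _) hai)
    exact hS d' (by omega) h 0 0 g hhc hord hg.contDiffAt hg.not_eventually_zero
  | succ s ih =>
    intro e he a u h g γ i₀ ha hu hu0 hi₀ hai had hg hh
    obtain ⟨l, hl⟩ : ∃ l, e l ≠ 0 := by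
      by_contra hcon
      push Not at hcon
      simp [hcon] at he
    set e' : Fin m → ℕ := e - Pi.single l 1 with he'
    have hee : e = Pi.single l 1 + e' := by
      ext j
      by_cases hj : j = l
      · subst hj; simp [he']; omega
      · simp [he', hj]
    have hsum : ∑ i, e' i = s := by
      rw [hee] at he
      simp only [Pi.add_apply, Finset.sum_add_distrib, Finset.sum_pi_single', Finset.mem_univ,
        if_true] at he
      omega
    have h0l : (0 : Fin (m + 1)) ≠ l.succ := (Fin.succ_ne_zero l).symm
    -- chart in which the first coordinate is divided
    set σ : (Fin (m + 1) → ℂ) → (Fin (m + 1) → ℂ) :=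
      fun y => Function.update y 0 (y 0 * y l.succ) with hσ
    have hσc : ContDiff ℂ 1 σ := contDiff_update_mul 0 0 l.succ
    have hσt : ∀ y, Fin.tail (σ y) = Fin.tail y := fun y => tail_update_zero' _ _
    have hσ0 : ∀ ζ, σ (Fin.cons ζ 0) = 0 := fun ζ => by
      rw [cons_zero_right]; exact update_mul_single_left h0l ζ
    set h₁ : (Fin (m + 1) → ℂ) → ℂ := fun y => ∑ i ∈ Finset.range d,
        monom ((d - i) • e') (Fin.tail y) * a i (Fin.tail y) * y 0 ^ i + y 0 ^ d * u (σ y) with hh₁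
    have hσh : ∀ ζ : ℂ, ∀ᶠ y in 𝓝 (Fin.cons ζ 0 : Fin (m + 1) → ℂ),
        h (σ y) = y l.succ ^ d * h₁ y := by
      intro ζ
      filter_upwards [hσc.eventually_of_eq (hσ0 ζ) hh] with y hy
      rw [hy, hσt, hh₁]
      simp only [hσ, Function.update_self]
      rw [mul_add, Finset.mul_sum]
      congr 1
      · refine Finset.sum_congr rfl fun i hi => ?_
        rw [monom_eq_pow_mul hee]
        have : Fin.tail y l = y l.succ := rfl
        rw [this]
        have hd : d = (d - i) + i := by have := Finset.mem_range.1 hi; omega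
        conv_rhs => rw [hd, pow_add]
        have hd' : d - i + i - i = d - i := by omega
        rw [hd']
        ring
      · ring
    have hσu : ∀ ζ : ℂ, ContDiffAt ℂ 1 (fun y => u (σ y)) (Fin.cons ζ 0 : Fin (m + 1) → ℂ) := fun ζ =>
      ContDiffAt.comp (g := u) (f := σ) (Fin.cons ζ 0 : Fin (m + 1) → ℂ) (by rwa [hσ0]) hσc.contDiffAt
    have hg₁ : MonomialGerm (γ + (d + 1) • Pi.single l 1)
        (fun x => g x * monom ((d + 1) • Pi.single l 1) x) := hg.mul (monomialGerm_monom _)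
    have hgoal1 : ∀ ζ : ℂ, Resolvable (fun y => (fun x => g x * monom ((d + 1) • Pi.single l 1) x)
        (Fin.tail y) * h₁ y) (Fin.cons ζ 0) →
        Resolvable (fun y => g (Fin.tail (σ y)) * h (σ y) * y l.succ) (Fin.cons ζ 0) := by
      intro ζ hr
      refine hr.congr _ ?_
      filter_upwards [hσh ζ] with y hy
      rw [hy, hσt, monom_smul, monom_single]
      have : Fin.tail y l = y l.succ := rfl
      rw [this]; ring
    -- chart in which the coordinate `l` is divided
    set τ : (Fin (m + 1) → ℂ) → (Fin (m + 1) → ℂ) :=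
      fun y => Function.update y l.succ (y 0 * y l.succ) with hτ
    have hτc : ContDiff ℂ 1 τ := contDiff_update_mul l.succ 0 l.succ
    have hτt : ∀ y, Fin.tail (τ y) = Function.update (Fin.tail y) l (y 0 * Fin.tail y l) :=
      fun y => tail_update_succ _ _ _
    have hτ0 : ∀ ζ, τ (Fin.cons 0 (Pi.single l ζ)) = 0 := fun ζ => by
      rw [cons_single]; exact update_mul_single_right h0l ζ
    have hτtc : ContDiff ℂ 1 fun y => Fin.tail (τ y) := contDiff_tail.comp hτc
    have hτt0 : ∀ ζ, Fin.tail (τ (Fin.cons 0 (Pi.single l ζ))) = 0 := fun ζ => by rw [hτ0]; rfl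
    set U : (Fin (m + 1) → ℂ) → ℂ := fun y => ∑ i ∈ Finset.range d,
      y 0 ^ ((d - i) * (e l - 1)) * monom ((d - i) • e) (Fin.tail y) * a i (Fin.tail (τ y)) + u (τ y)
      with hU
    have hτh : ∀ ζ : ℂ, ∀ᶠ y in 𝓝 (Fin.cons 0 (Pi.single l ζ) : Fin (m + 1) → ℂ),
        h (τ y) = y 0 ^ d * U y := by
      intro ζ
      filter_upwards [hτc.eventually_of_eq (hτ0 ζ) hh] with y hy
      have h0 : τ y 0 = y 0 := Function.update_of_ne h0l _ _
      rw [hy, hU, h0, mul_add, Finset.mul_sum]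
      congr 1
      refine Finset.sum_congr rfl fun i hi => ?_
      have hm : monom ((d - i) • e) (Fin.tail (τ y)) =
        y 0 ^ ((d - i) * e l) * monom ((d - i) • e) (Fin.tail y) := by
        rw [hτt, monom_update_mul]; rfl
      rw [hm]
      have hd : d = (d - i) + i := by have := Finset.mem_range.1 hi; omega
      have hp : y 0 ^ ((d - i) * e l) * y 0 ^ i = y 0 ^ d * y 0 ^ ((d - i) * (e l - 1)) := by
        rw [← pow_add, ← pow_add]
        congr 1
        obtain ⟨k, hk⟩ := Nat.exists_eq_succ_of_ne_zero hl
        rw [hk, Nat.succ_sub_one, Nat.mul_succ]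
        omega
      linear_combination monom ((d - i) • e) (Fin.tail y) * a i (Fin.tail (τ y)) * hp
    have hUc : ∀ ζ : ℂ, ContDiffAt ℂ 1 U (Fin.cons 0 (Pi.single l ζ) : Fin (m + 1) → ℂ) := by
      intro ζ
      refine ContDiffAt.add (ContDiffAt.sum fun i _ => ContDiffAt.mul
        (((contDiff_coord 0).pow _).mul ((contDiff_monom _).comp contDiff_tail)).contDiffAt ?_) ?_
      · exact ContDiffAt.comp (g := a i) (f := fun y => Fin.tail (τ y))
          (Fin.cons 0 (Pi.single l ζ) : Fin (m + 1) → ℂ) (by rw [hτt0]; exact ha i) hτtc.contDiffAt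
      · exact ContDiffAt.comp (g := u) (f := τ)
          (Fin.cons 0 (Pi.single l ζ) : Fin (m + 1) → ℂ) (by rwa [hτ0]) hτc.contDiffAt
    have hmz : ∀ i < d, monom ((d - i) • e) (0 : Fin m → ℂ) = 0 := fun i hi =>
      monom_eq_zero (i := l) (by simp; omega) rfl
    have hU0 : U (Fin.cons 0 (Pi.single l 0)) ≠ 0 := by
      have : U (Fin.cons 0 (Pi.single l 0)) = u 0 := by
        simp only [hU, hτ0]
        rw [Finset.sum_eq_zero, zero_add]
        intro i hi
        rw [Pi.single_zero, Fin.tail_cons, hmz i (Finset.mem_range.1 hi)]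
        simp
      rwa [this]
    obtain ⟨ρ, hρ, hρU⟩ : ∃ ρ > 0, ∀ ζ : ℂ, ‖ζ‖ ≤ ρ → U (Fin.cons 0 (Pi.single l ζ)) ≠ 0 := by
      have hc : Continuous fun ζ : ℂ => (Fin.cons 0 (Pi.single l ζ) : Fin (m + 1) → ℂ) :=
        contDiff_cons.continuous.comp (continuous_const.prodMk (continuous_single l))
      have h1 : ∀ᶠ ζ : ℂ in 𝓝 0, U (Fin.cons 0 (Pi.single l ζ)) ≠ 0 :=
        (ContinuousAt.comp (g := U) (f := fun ζ : ℂ => (Fin.cons 0 (Pi.single l ζ) : Fin (m + 1) → ℂ))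
          (hUc 0).continuousAt hc.continuousAt).eventually_ne hU0
      obtain ⟨ε, hε, h2⟩ := Metric.eventually_nhds_iff_ball.1 h1
      refine ⟨ε / 2, by positivity, fun ζ hζ => h2 ζ ?_⟩
      rw [mem_ball_zero_iff]; linarith
    refine .blow _ 0 l.succ ρ⁻¹ h0l (by positivity) (fun ζ _ => ?_) fun ζ hζ => ?_
    · rw [← cons_zero_right]
      apply hgoal1
      rcases eq_or_ne ζ 0 with rfl | hζ
      · rw [cons_zero_zero]
        have hu' := hσu 0
        rw [cons_zero_zero] at hu'
        have hσ00 : σ 0 = 0 := by rw [← cons_zero_zero, hσ0, cons_zero_zero]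
        exact ih e' hsum a (fun y => u (σ y)) h₁ _ _ i₀ ha hu' (by simpa [hσ00] using hu0) hi₀ hai had hg₁
          (Eventually.of_forall fun y => rfl)
      · have hc : ContDiffAt ℂ 1 h₁ (Fin.cons ζ 0 : Fin (m + 1) → ℂ) := by
          refine ContDiffAt.add (ContDiffAt.sum fun i _ => (ContDiffAt.mul
            ((contDiff_monom _).comp contDiff_tail).contDiffAt (ha i).comp_tail).mul
            ((contDiff_coord 0).contDiffAt.pow i)) (((contDiff_coord 0).contDiffAt.pow d).mul (hσu ζ))
        have hP : slice h₁ 0 = fun z => ∑ i ∈ Finset.range d, (monom ((d - i) • e') 0 * a i 0) * z ^ i +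
            u 0 * z ^ d := by
          funext z
          simp [slice, hh₁, hσ0, mul_comm]
        have hder : iteratedDeriv (d - 1) (slice h₁ 0) ζ = d.factorial * u 0 * ζ := by
          have c1 : AnalyticAt ℂ (fun z : ℂ => ∑ i ∈ Finset.range d,
            (monom ((d - i) • e') 0 * a i 0) * z ^ i) ζ := by fun_prop
          have c2 : AnalyticAt ℂ (fun z : ℂ => u 0 * z ^ d) ζ := by fun_prop
          have e1 : slice h₁ 0 = (fun z : ℂ => ∑ i ∈ Finset.range d,
            (monom ((d - i) • e') 0 * a i 0) * z ^ i) + fun z => u 0 * z ^ d := hP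
          rw [e1, iteratedDeriv_add c1.contDiffAt c2.contDiffAt, iteratedDeriv_fun_sum
            (fun i _ => by
              have : AnalyticAt ℂ (fun z : ℂ => monom ((d - i) • e') 0 * a i 0 * z ^ i) ζ := by fun_prop
              exact this.contDiffAt), Finset.sum_eq_zero, zero_add, iteratedDeriv_const_mul_field]
          · have hd1 : d = (d - 1) + 1 := by omega
            have hd2 : d - (d - 1) = 1 := by omega
            have hf : d.descFactorial (d - 1) = d.factorial := by
              have := Nat.factorial_mul_descFactorial (show d - 1 ≤ d by omega)
              rwa [hd2, Nat.factorial_one, one_mul] at this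
            simp [hd2, hf]
            ring
          · intro i hi
            rw [iteratedDeriv_const_mul_field]
            by_cases hid : i + 1 = d
            · simp [had i hid]
            · have : i < d - 1 := by have := Finset.mem_range.1 hi; omega
              simp [Nat.descFactorial_of_lt this]
        obtain ⟨d', hd', hord⟩ := exists_order_le_of_iteratedDeriv_ne_zero hc.analyticAt_slice
          (j := d - 1) (by
            rw [hder]
            exact mul_ne_zero (mul_ne_zero (by exact_mod_cast Nat.factorial_ne_zero _) hu0) hζ)
        exact hS d' (by omega) h₁ ζ 0 _ hc hord hg₁.contDiffAt hg₁.not_eventually_zero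
    · rw [inv_inv] at hζ
      rw [← cons_single]
      obtain ⟨eg, heg, heg0, hge⟩ := hg
      refine .of_monom_mul (e := fun y => eg (Fin.tail (τ y)) * U y)
        (Fin.cons (γ l + d + 1) γ) ?_ ?_ ?_
      · exact ContDiffAt.mul (ContDiffAt.comp (g := eg) (f := fun y => Fin.tail (τ y))
          (Fin.cons 0 (Pi.single l ζ) : Fin (m + 1) → ℂ) (by rwa [hτt0]) hτtc.contDiffAt) (hUc ζ)
      · refine mul_ne_zero ?_ (hρU ζ hζ)
        rwa [hτt0]
      · filter_upwards [hτh ζ, hτtc.eventually_of_eq (hτt0 ζ) hge] with y h1 h2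
        have h3 : monom (Fin.cons (γ l + d + 1) γ) y = y 0 ^ (γ l + d + 1) * monom γ (Fin.tail y) := by
          simp [monom, Fin.prod_univ_succ, Fin.tail]
        change g (Fin.tail (τ y)) * h (τ y) * y 0 = _
        rw [h1, h2, h3, hτt, monom_update_mul]
        ring

/-- Divisibility of holomorphic germs. -/
def DvdGerm {n : ℕ} (p : Fin n → ℂ) (f A : (Fin n → ℂ) → ℂ) : Prop :=
  ∃ c : (Fin n → ℂ) → ℂ, ContDiffAt ℂ 1 c p ∧ ∀ᶠ y in 𝓝 p, A y = f y * c y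

theorem DvdGerm.comp_mul {n k : ℕ} {q : Fin n → ℂ} {f A : (Fin k → ℂ) → ℂ}
    {τ : (Fin n → ℂ) → (Fin k → ℂ)} {J : (Fin n → ℂ) → ℂ} (hτ : ContDiffAt ℂ 1 τ q)
    (h : DvdGerm (τ q) f A) :
    DvdGerm q (fun y => f (τ y) * J y) (fun y => A (τ y) * J y) := by
  obtain ⟨c, hc, h⟩ := h
  refine ⟨fun y => c (τ y), hc.comp q hτ, ?_⟩
  filter_upwards [hτ.continuousAt.eventually h] with y hy
  rw [hy]; ring

theorem DvdGerm.mul_right {n : ℕ} {q : Fin n → ℂ} {f A J : (Fin n → ℂ) → ℂ}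
    (hJ : ContDiffAt ℂ 1 J q) (h : DvdGerm q f A) : DvdGerm q f (fun y => A y * J y) := by
  obtain ⟨c, hc, h⟩ := h
  refine ⟨fun y => c y * J y, hc.mul hJ, ?_⟩
  filter_upwards [h] with y hy
  rw [hy]; ring

theorem DvdGerm.comp {n k : ℕ} {q : Fin n → ℂ} {f A : (Fin k → ℂ) → ℂ}
    {τ : (Fin n → ℂ) → (Fin k → ℂ)} (hτ : ContDiffAt ℂ 1 τ q)
    (h : DvdGerm (τ q) f A) : DvdGerm q (fun y => f (τ y)) (fun y => A (τ y)) := by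
  simpa using h.comp_mul (J := fun _ => 1) hτ

/-- A divisor of a monomial germ is a monomial germ. -/
theorem MonomialGerm.of_dvdGerm {n : ℕ} {N : Fin n → ℕ} {f A : (Fin n → ℂ) → ℂ}
    (hf : ContDiffAt ℂ 1 f 0) (hA : MonomialGerm N A) (h : DvdGerm 0 f A) :
    ∃ M, M ≤ N ∧ MonomialGerm M f := by
  obtain ⟨c, hc, h⟩ := h
  obtain ⟨e, he, he0, hA⟩ := hA
  refine MonomialGerm.of_mul hf hc ⟨e, he, he0, ?_⟩
  filter_upwards [h, hA] with y h1 h2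
  rw [← h1, h2]

/-- A polynomial expansion in the first variable whose nonzero coefficients, and the nonzero
differences of their suitable powers, divide `A`. -/
structure LiftData {m : ℕ} (d : ℕ) (A g : (Fin m → ℂ) → ℂ) (a : ℕ → (Fin m → ℂ) → ℂ)
    (u h : (Fin (m + 1) → ℂ) → ℂ) (w : Fin m → ℂ) : Prop where
  coeff : ∀ i, ContDiffAt ℂ 1 (a i) w
  rem : ContDiffAt ℂ 1 u (Fin.cons 0 w : Fin (m + 1) → ℂ)
  rem_ne : u (Fin.cons 0 w) ≠ 0
  factor : ContDiffAt ℂ 1 g w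
  expand : ∀ᶠ y in 𝓝 (Fin.cons 0 w : Fin (m + 1) → ℂ),
    h y = ∑ i ∈ Finset.range d, a i (Fin.tail y) * y 0 ^ i + y 0 ^ d * u y
  last : ∀ i, i + 1 = d → ∀ᶠ x in 𝓝 w, a i x = 0
  factor_dvd : DvdGerm w g A
  coeff_dvd : ∀ i < d, (∀ᶠ x in 𝓝 w, a i x = 0) ∨ DvdGerm w (a i) A
  diff_dvd : ∀ i < d, ∀ j < d,
    (∀ᶠ x in 𝓝 w, a i x ^ (d.factorial / (d - i)) - a j x ^ (d.factorial / (d - j)) = 0) ∨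
    DvdGerm w (fun x => a i x ^ (d.factorial / (d - i)) - a j x ^ (d.factorial / (d - j))) A

theorem LiftData.pull {m d : ℕ} {A g : (Fin m → ℂ) → ℂ} {a : ℕ → (Fin m → ℂ) → ℂ}
    {u h : (Fin (m + 1) → ℂ) → ℂ} {q w : Fin m → ℂ} {τ : (Fin m → ℂ) → (Fin m → ℂ)}
    {J : (Fin m → ℂ) → ℂ} (hτ : ContDiffAt ℂ 1 τ q) (hw : τ q = w) (hJ : ContDiffAt ℂ 1 J q)
    (H : LiftData d A g a u h w) :
    LiftData d (fun y => A (τ y) * J y) (fun y => g (τ y) * J y) (fun i y => a i (τ y))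
      (fun y => u (Fin.cons (y 0) (τ (Fin.tail y)))) (fun y => h (Fin.cons (y 0) (τ (Fin.tail y)))) q := by
  subst hw
  set T : (Fin (m + 1) → ℂ) → (Fin (m + 1) → ℂ) := fun y => Fin.cons (y 0) (τ (Fin.tail y)) with hT
  have hTc : ContDiffAt ℂ 1 T (Fin.cons 0 q : Fin (m + 1) → ℂ) :=
    ContDiffAt.comp (g := fun x : ℂ × (Fin m → ℂ) => (Fin.cons x.1 x.2 : Fin (m + 1) → ℂ))
      (f := fun y : Fin (m + 1) → ℂ => (y 0, τ (Fin.tail y))) (Fin.cons 0 q : Fin (m + 1) → ℂ)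
      contDiff_cons.contDiffAt ((contDiff_coord 0).contDiffAt.prodMk hτ.comp_tail)
  have hT0 : T (Fin.cons 0 q) = Fin.cons 0 (τ q) := by simp [hT]
  refine ⟨fun i => (H.coeff i).comp q hτ, ?_, ?_, (H.factor.comp q hτ).mul hJ, ?_, ?_,
    H.factor_dvd.comp_mul hτ, ?_, ?_⟩
  · exact ContDiffAt.comp (g := u) (f := T) (Fin.cons 0 q : Fin (m + 1) → ℂ)
      (by rw [hT0]; exact H.rem) hTc
  · simpa using H.rem_ne
  · have := H.expand
    rw [← hT0] at this
    filter_upwards [hTc.continuousAt.eventually this] with y hy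
    rw [hy]; simp [hT]
  · exact fun i hi => hτ.continuousAt.eventually (H.last i hi)
  · exact fun i hi => (H.coeff_dvd i hi).imp (fun h => hτ.continuousAt.eventually h)
      fun h => (h.comp hτ).mul_right hJ
  · exact fun i hi j hj => (H.diff_dvd i hi j hj).imp (fun h => hτ.continuousAt.eventually h)
      fun h => (h.comp hτ).mul_right hJ

theorem contDiff_pow_all {m : ℕ} (D : ℕ) : ContDiff ℂ 1 fun (x : Fin m → ℂ) j => x j ^ D :=
  contDiff_pi.2 fun j => (contDiff_coord j).pow D

theorem MonomialGerm.comp_pow {m : ℕ} {N : Fin m → ℕ} {f : (Fin m → ℂ) → ℂ} (hf : MonomialGerm N f)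
    {D : ℕ} (hD : 1 ≤ D) : MonomialGerm (D • N) (fun x => f (fun j => x j ^ D)) := by
  obtain ⟨e, he, he0, h⟩ := hf
  have h0 : (fun (x : Fin m → ℂ) (j : Fin m) => x j ^ D) 0 = 0 := by
    ext j; simp [show D ≠ 0 by omega]
  have h0' : (fun j => (0 : Fin m → ℂ) j ^ D) = 0 := h0
  refine ⟨fun x => e (fun j => x j ^ D), ?_, by beta_reduce; rwa [h0'], ?_⟩
  · exact ContDiffAt.comp (g := e) (f := fun (x : Fin m → ℂ) (j : Fin m) => x j ^ D) 0
      (by beta_reduce; rw [h0']; exact he) (contDiff_pow_all D).contDiffAt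
  · filter_upwards [(contDiff_pow_all D).eventually_of_eq h0 h] with x hx
    rw [hx, monom_smul]
    simp [monom, ← Finset.prod_pow, ← pow_mul, mul_comm]

theorem LiftData.resolvable_of_monomialGerm {m d : ℕ} (hS : ∀ d' < d, RegularResolvable m d')
    {A g : (Fin m → ℂ) → ℂ} {N : Fin m → ℕ} (hA : MonomialGerm N A) {a : ℕ → (Fin m → ℂ) → ℂ}
    {u h : (Fin (m + 1) → ℂ) → ℂ} (H : LiftData d A g a u h 0) :
    Resolvable (fun y => g (Fin.tail y) * h y) 0 := by
  obtain ⟨γ, -, hg⟩ := hA.of_dvdGerm H.factor H.factor_dvd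
  have hexp := H.expand
  have hrem := H.rem
  have hrem0 := H.rem_ne
  rw [cons_zero_zero] at hexp hrem hrem0
  by_cases hall : ∀ i < d, ∀ᶠ x in 𝓝 0, a i x = 0
  · obtain ⟨e, he, he0, hge⟩ := hg
    rw [← cons_zero_zero] at hexp hrem hrem0 ⊢
    refine .of_monom_mul (e := fun y => e (Fin.tail y) * u y) (Fin.cons d γ) (he.comp_tail.mul hrem)
      (mul_ne_zero (by simpa using he0) hrem0) ?_
    have h1 : ∀ᶠ x in 𝓝 (0 : Fin m → ℂ), ∀ i ∈ Finset.range d, a i x = 0 := by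
      rw [Finset.eventually_all]
      exact fun i hi => hall i (Finset.mem_range.1 hi)
    filter_upwards [hexp, h1.comp_tail, hge.comp_tail] with y h1 h2 h3
    have h4 : monom (Fin.cons d γ) y = y 0 ^ d * monom γ (Fin.tail y) := by
      simp [monom, Fin.prod_univ_succ, Fin.tail]
    rw [h1, Finset.sum_eq_zero (fun i hi => by rw [h2 i hi, zero_mul]), h3, h4]
    ring
  · have hmon : ∀ i, ∃ α, i < d → (¬ ∀ᶠ x in 𝓝 0, a i x = 0) → MonomialGerm α (a i) := by
      intro i
      by_cases hi : i < d
      · by_cases hz : ∀ᶠ x in 𝓝 0, a i x = 0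
        · exact ⟨0, fun _ h => absurd hz h⟩
        · obtain ⟨α, -, hα⟩ := hA.of_dvdGerm (H.coeff i) ((H.coeff_dvd i hi).resolve_left hz)
          exact ⟨α, fun _ _ => hα⟩
      · exact ⟨0, fun h => absurd h hi⟩
    choose α hα using hmon
    classical
    set I := (Finset.range d).filter fun i => ¬ ∀ᶠ x in 𝓝 0, a i x = 0 with hI
    have hIα : ∀ i ∈ I, MonomialGerm (α i) (a i) := fun i hi => by
      rw [hI, Finset.mem_filter, Finset.mem_range] at hi
      exact hα i hi.1 hi.2
    have hId : ∀ i ∈ I, i < d := fun i hi => Finset.mem_range.1 (Finset.mem_filter.1 hi).1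
    have hIne : I.Nonempty := by
      simp only [not_forall] at hall
      obtain ⟨i, hi, hz⟩ := hall
      refine ⟨i, ?_⟩
      rw [hI, Finset.mem_filter, Finset.mem_range]
      exact ⟨hi, hz⟩
    set k : ℕ → ℕ := fun i => d.factorial / (d - i) with hk
    have hkd : ∀ i < d, (d - i) * k i = d.factorial := fun i hi =>
      Nat.mul_div_cancel' (Nat.dvd_factorial (by omega) (by omega))
    obtain ⟨i₀, hi₀, hmin⟩ := Finset.exists_min_image I (fun i => ∑ j, (k i • α i) j) hIne
    have hle : ∀ i ∈ I, k i₀ • α i₀ ≤ k i • α i := by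
      intro i hi
      have hdiff : (∀ᶠ x in 𝓝 0, a i₀ x ^ k i₀ - a i x ^ k i = 0) ∨
          ∃ γ, MonomialGerm γ (fun x => a i₀ x ^ k i₀ - a i x ^ k i) := by
        refine (H.diff_dvd i₀ (hId _ hi₀) i (hId _ hi)).imp id fun hdv => ?_
        obtain ⟨γ, -, hγ⟩ := hA.of_dvdGerm (((H.coeff i₀).pow _).sub ((H.coeff i).pow _)) hdv
        exact ⟨γ, hγ⟩
      rcases ((hIα _ hi₀).pow (k i₀)).le_or_le ((hIα _ hi).pow (k i)) hdiff with hle | hle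
      · exact hle
      · have := (Finset.sum_eq_sum_iff_of_le (fun j _ => hle j)).1
          (le_antisymm (Finset.sum_le_sum fun j _ => hle j) (hmin i hi))
        exact fun j => (this j (Finset.mem_univ j)).ge
    set D := d.factorial with hD
    have hD1 : 1 ≤ D := Nat.factorial_pos d
    set e : Fin m → ℕ := k i₀ • α i₀ with he
    have hfac : ∀ i, ∃ b : (Fin m → ℂ) → ℂ, ContDiffAt ℂ 1 b 0 ∧ (i = i₀ → b 0 ≠ 0) ∧
        (i + 1 = d → b 0 = 0) ∧
        (i < d → ∀ᶠ x in 𝓝 0, a i (fun j => x j ^ D) = monom ((d - i) • e) x * b x) := by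
      intro i
      have h0 : (fun (x : Fin m → ℂ) (j : Fin m) => x j ^ D) 0 = 0 := by
        ext j; simp [show D ≠ 0 by omega]
      by_cases hi : i ∈ I
      · obtain ⟨ε, hε, hε0, hx⟩ := (hIα i hi).comp_pow hD1
        have hαe : D • α i = (d - i) • e + (d - i) • (k i • α i - e) := by
          rw [← smul_add, add_tsub_cancel_of_le (hle i hi), smul_smul, hkd i (hId i hi)]
        refine ⟨fun x => monom ((d - i) • (k i • α i - e)) x * ε x,
          (contDiff_monom _).contDiffAt.mul hε, ?_, ?_, fun _ => ?_⟩
        · rintro rfl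
          simpa [he, monom_zero] using hε0
        · intro hid
          exact absurd (H.last i hid) (Finset.mem_filter.1 hi).2
        · filter_upwards [hx] with x hx
          rw [hx, hαe, monom_add]; ring
      · refine ⟨fun _ => 0, contDiffAt_const, fun h => absurd (h ▸ hi₀) hi, fun _ => rfl, fun hid => ?_⟩
        have hz : ∀ᶠ x in 𝓝 0, a i x = 0 := by
          by_contra hz
          exact hi (Finset.mem_filter.2 ⟨Finset.mem_range.2 hid, hz⟩)
        filter_upwards [(contDiff_pow_all D).eventually_of_eq h0 hz] with x hx
        rw [hx, mul_zero]
    choose b hb hb0 hbl hbe using hfac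
    refine .of_pow_tail hD1 ?_
    set P : (Fin (m + 1) → ℂ) → (Fin (m + 1) → ℂ) := fun y => Fin.cons (y 0) (fun j => y j.succ ^ D)
      with hP
    have hPc : ContDiff ℂ 1 P := contDiff_cons.comp
      ((contDiff_coord 0).prodMk ((contDiff_pow_all D).comp contDiff_tail))
    have hP0 : P 0 = 0 := by
      ext i; refine Fin.cases ?_ (fun j => ?_) i <;> simp [hP, show D ≠ 0 by omega]
    refine (resolvable_of_weighted hS _ e rfl b (fun y => u (P y)) (fun y => h (P y))
      (fun x => g (fun j => x j ^ D) * monom (fun _ => D - 1) x) _ i₀ hb ?_ ?_ (hId _ hi₀)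
      (hb0 i₀ rfl) hbl ((hg.comp_pow hD1).mul (monomialGerm_monom _)) ?_).congr _ ?_
    · exact ContDiffAt.comp (g := u) (f := P) 0 (by rwa [hP0]) hPc.contDiffAt
    · rwa [hP0]
    · have h1 : ∀ᶠ x in 𝓝 (0 : Fin m → ℂ), ∀ i ∈ Finset.range d,
          a i (fun j => x j ^ D) = monom ((d - i) • e) x * b i x := by
        rw [Finset.eventually_all]
        exact fun i hi => hbe i (Finset.mem_range.1 hi)
      have h2 : ∀ᶠ y in 𝓝 (0 : Fin (m + 1) → ℂ), ∀ i ∈ Finset.range d,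
          a i (fun j => Fin.tail y j ^ D) = monom ((d - i) • e) (Fin.tail y) * b i (Fin.tail y) := by
        have := h1.comp_tail (z := 0)
        rwa [cons_zero_zero] at this
      filter_upwards [hPc.eventually_of_eq hP0 hexp, h2] with y h3 h4
      rw [h3]
      congr 1
      refine Finset.sum_congr rfl fun i hi => ?_
      have h5 : Fin.tail (P y) = fun j => Fin.tail y j ^ D := by ext j; simp [hP, Fin.tail]
      rw [h5, h4 i hi]
      simp [hP]
    · refine Eventually.of_forall fun y => ?_
      have h5 : Fin.tail (P y) = fun j => Fin.tail y j ^ D := by ext j; simp [hP, Fin.tail]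
      rw [← h5]
      ring

theorem Resolvable.lift {m d : ℕ} (hS : ∀ d' < d, RegularResolvable m d') {A : (Fin m → ℂ) → ℂ}
    {w : Fin m → ℂ} (hA : Resolvable A w) :
    ∀ (g : (Fin m → ℂ) → ℂ) (a : ℕ → (Fin m → ℂ) → ℂ) (u h : (Fin (m + 1) → ℂ) → ℂ),
      LiftData d A g a u h w → Resolvable (fun y => g (Fin.tail y) * h y) (Fin.cons 0 w) := by
  induction hA with
  | mono A N hA =>
    intro g a u h H
    rw [cons_zero_zero]
    exact H.resolvable_of_monomialGerm hS hA
  | biholo A φ ψ q hφ hψ hψφ _ ih =>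
    intro g a u h H
    have H' := H.pull (J := fun _ => 1) hφ rfl contDiffAt_const
    simp only [mul_one] at H'
    have hΦ : ∀ (θ : (Fin m → ℂ) → (Fin m → ℂ)) (x : Fin m → ℂ), ContDiffAt ℂ 1 θ x →
        ContDiffAt ℂ 1 (fun y : Fin (m + 1) → ℂ => (Fin.cons (y 0) (θ (Fin.tail y)) : Fin (m + 1) → ℂ))
        (Fin.cons 0 x : Fin (m + 1) → ℂ) := fun θ x hθ =>
      ContDiffAt.comp (g := fun x : ℂ × (Fin m → ℂ) => (Fin.cons x.1 x.2 : Fin (m + 1) → ℂ))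
        (f := fun y : Fin (m + 1) → ℂ => (y 0, θ (Fin.tail y))) (Fin.cons 0 x : Fin (m + 1) → ℂ)
        contDiff_cons.contDiffAt ((contDiff_coord 0).contDiffAt.prodMk hθ.comp_tail)
    have := Resolvable.biholo (fun y => g (Fin.tail y) * h y)
      (fun y => Fin.cons (y 0) (φ (Fin.tail y))) (fun y => Fin.cons (y 0) (ψ (Fin.tail y)))
      (Fin.cons 0 q) (hΦ φ q hφ) (by simpa using hΦ ψ (φ q) hψ) ?_ ?_
    · simpa using this
    · filter_upwards [hψφ.comp_tail (z := 0)] with y hy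
      simp [hy]
    · simpa using ih _ _ _ _ H'
  | power A i k hk _ ih =>
    intro g a u h H
    have H' := H.pull (J := fun y => y i ^ (k - 1)) (contDiff_update_pow i k).contDiffAt
      (update_pow_zero i hk) ((contDiff_coord i).pow _).contDiffAt
    have h1 := ih _ _ _ _ H'
    rw [cons_zero_zero] at h1 ⊢
    refine .power _ i.succ k hk (h1.congr _ (Eventually.of_forall fun y => ?_))
    have h2 : (Fin.cons (y 0) (Function.update (Fin.tail y) i (Fin.tail y i ^ k)) : Fin (m + 1) → ℂ) =
        Function.update y i.succ (y i.succ ^ k) := by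
      rw [← tail_update_succ]
      conv_rhs => rw [← Fin.cons_self_tail (Function.update y i.succ (y i.succ ^ k))]
      rw [Function.update_of_ne (Fin.succ_ne_zero i).symm]; rfl
    rw [h2, tail_update_succ]
    simp only [Fin.tail]
    ring
  | blow A i j R hij hR _ _ ih1 ih2 =>
    intro g a u h H
    have key : ∀ (k l : Fin m) (y : Fin (m + 1) → ℂ),
        (Fin.cons (y 0) (Function.update (Fin.tail y) k (Fin.tail y i * Fin.tail y j)) :
          Fin (m + 1) → ℂ) = Function.update y k.succ (y i.succ * y j.succ) := by
      intro k l y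
      rw [← tail_update_succ]
      conv_rhs => rw [← Fin.cons_self_tail (Function.update y k.succ (y i.succ * y j.succ))]
      rw [Function.update_of_ne (Fin.succ_ne_zero k).symm]; rfl
    rw [cons_zero_zero]
    refine .blow _ i.succ j.succ R (by simpa using hij) hR (fun ζ hζ => ?_) fun ζ hζ => ?_
    · have H' := H.pull (J := fun y => y j) (contDiff_update_mul i i j).contDiffAt
        (update_mul_single_left hij ζ) (contDiff_coord j).contDiffAt
      have h1 := ih1 ζ hζ _ _ _ _ H'
      rw [cons_single] at h1
      refine h1.congr _ (Eventually.of_forall fun y => ?_)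
      rw [key i j, tail_update_succ]
      simp only [Fin.tail]
      ring
    · have H' := H.pull (J := fun y => y i) (contDiff_update_mul j i j).contDiffAt
        (update_mul_single_right hij ζ) (contDiff_coord i).contDiffAt
      have h1 := ih2 ζ hζ _ _ _ _ H'
      rw [cons_single] at h1
      refine h1.congr _ (Eventually.of_forall fun y => ?_)
      rw [key j i, tail_update_succ]
      simp only [Fin.tail]
      ring

/-- Finitely many holomorphic germs have a nonzero common multiple, zero germs excluded. -/
theorem exists_common_multiple {n : ℕ} {ι : Type*} (s : Finset ι) {F : ι → (Fin n → ℂ) → ℂ}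
    {p : Fin n → ℂ} (hF : ∀ i, ContDiffAt ℂ 1 (F i) p) :
    ∃ A : (Fin n → ℂ) → ℂ, ContDiffAt ℂ 1 A p ∧ (¬ ∀ᶠ y in 𝓝 p, A y = 0) ∧
      ∀ i ∈ s, (∀ᶠ y in 𝓝 p, F i y = 0) ∨ DvdGerm p (F i) A := by
  classical
  induction s using Finset.induction_on with
  | empty => exact ⟨fun _ => 1, contDiffAt_const, by simp [NeBot.ne], by simp⟩
  | insert i s hi ih =>
    obtain ⟨A, hA, hA0, h⟩ := ih
    by_cases hz : ∀ᶠ y in 𝓝 p, F i y = 0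
    · exact ⟨A, hA, hA0, by simpa [hz] using h⟩
    · refine ⟨fun y => A y * F i y, hA.mul (hF i), fun h0 => ?_, fun j hj => ?_⟩
      · exact (hA.eventuallyEq_zero_or_of_mul (hF i) h0).elim hA0 hz
      · rcases Finset.mem_insert.1 hj with rfl | hj
        · exact Or.inr ⟨A, hA, Eventually.of_forall fun y => mul_comm _ _⟩
        · exact (h j hj).imp id fun h => h.mul_right (hF i)

/-- Every nonzero holomorphic germ in `n` variables is resolvable. -/
def AllResolvable (n : ℕ) : Prop :=
  ∀ (h : (Fin n → ℂ) → ℂ) (x : Fin n → ℂ), ContDiffAt ℂ 1 h x → (¬ ∀ᶠ y in 𝓝 x, h y = 0) →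
    Resolvable h x

theorem exists_shear {m d : ℕ} {h : (Fin (m + 1) → ℂ) → ℂ} {z : ℂ} {w : Fin m → ℂ}
    (hh : ContDiffAt ℂ 1 h (Fin.cons z w : Fin (m + 1) → ℂ))
    (hord : analyticOrderAt (slice h w) z = d) :
    ∃ b : (Fin m → ℂ) → ℂ, ContDiffAt ℂ 1 b w ∧ b w = z ∧
      ∀ i, i + 1 = d → ∀ᶠ x in 𝓝 w, iteratedDeriv i (slice h x) (b x) = 0 := by
  cases d with
  | zero => exact ⟨fun _ => z, contDiffAt_const, rfl, fun i hi => by omega⟩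
  | succ k =>
    have hs := hh.analyticAt_slice
    have h1 := (natCast_le_analyticOrderAt_iff_iteratedDeriv_eq_zero hs).1 hord.ge
    have h2 : iteratedDeriv (k + 1) (slice h w) z ≠ 0 := by
      intro h0
      have : ((k + 2 : ℕ) : ℕ∞) ≤ analyticOrderAt (slice h w) z := by
        refine (natCast_le_analyticOrderAt_iff_iteratedDeriv_eq_zero hs).2 fun j hj => ?_
        rcases Nat.lt_succ_iff_lt_or_eq.1 hj with hj | rfl
        · exact h1 j hj
        · exact h0
      rw [hord] at this
      exact absurd (Nat.cast_le.1 this) (by omega)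
    obtain ⟨b, hb, hbw, hbe⟩ := (hh.iteratedDeriv_slice k).exists_implicit
      (by simpa using h1 k (by omega)) (by
        have : slice (fun y : Fin (m + 1) → ℂ => iteratedDeriv k (slice h (Fin.tail y)) (y 0)) w =
            iteratedDeriv k (slice h w) := by funext t; simp [slice]
        rwa [this, ← iteratedDeriv_succ])
    refine ⟨b, hb, hbw, fun i hi => ?_⟩
    obtain rfl : i = k := by omega
    simpa using hbe

theorem RegularResolvable.of_allResolvable {m : ℕ} (hm : AllResolvable m) (d : ℕ) :
    RegularResolvable m d := by
  induction d using Nat.strong_induction_on with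
  | _ d ih =>
  intro h z w g hh hord hg hg0
  obtain ⟨b, hb, hbw, hbd⟩ := exists_shear hh hord
  set φ : (Fin (m + 1) → ℂ) → (Fin (m + 1) → ℂ) := fun y => Fin.cons (y 0 + b (Fin.tail y)) (Fin.tail y)
    with hφ
  have hφq : φ (Fin.cons 0 w) = Fin.cons z w := by simp [hφ, hbw]
  have hφc : ContDiffAt ℂ 1 φ (Fin.cons 0 w : Fin (m + 1) → ℂ) :=
    ContDiffAt.comp (g := fun x : ℂ × (Fin m → ℂ) => (Fin.cons x.1 x.2 : Fin (m + 1) → ℂ))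
      (f := fun y : Fin (m + 1) → ℂ => (y 0 + b (Fin.tail y), Fin.tail y)) (Fin.cons 0 w : Fin (m + 1) → ℂ)
      contDiff_cons.contDiffAt
      (((contDiff_coord 0).contDiffAt.add hb.comp_tail).prodMk contDiff_tail.contDiffAt)
  have hψc : ContDiffAt ℂ 1 (fun y : Fin (m + 1) → ℂ => (Fin.cons (y 0 - b (Fin.tail y)) (Fin.tail y) :
      Fin (m + 1) → ℂ)) (Fin.cons z w : Fin (m + 1) → ℂ) :=
    ContDiffAt.comp (g := fun x : ℂ × (Fin m → ℂ) => (Fin.cons x.1 x.2 : Fin (m + 1) → ℂ))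
      (f := fun y : Fin (m + 1) → ℂ => (y 0 - b (Fin.tail y), Fin.tail y)) (Fin.cons z w : Fin (m + 1) → ℂ)
      contDiff_cons.contDiffAt
      (((contDiff_coord 0).contDiffAt.sub hb.comp_tail).prodMk contDiff_tail.contDiffAt)
  have hh' : ContDiffAt ℂ 1 (fun y => h (φ y)) (Fin.cons 0 w : Fin (m + 1) → ℂ) :=
    ContDiffAt.comp (g := h) (f := φ) (Fin.cons 0 w : Fin (m + 1) → ℂ) (by rwa [hφq]) hφc
  obtain ⟨a, u, ha, hu, hexp⟩ := hh'.exists_taylor d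
  have hslice : ∀ x, slice (fun y => h (φ y)) x = fun t => slice h x (t + b x) := by
    intro x; funext t; simp [slice, hφ]
  have htay : ∀ᶠ x in 𝓝 w, (∀ j < d, iteratedDeriv j (slice h x) (b x) = j.factorial * a j x) ∧
      iteratedDeriv d (slice h x) (b x) = d.factorial * u (Fin.cons 0 x) := by
    have hcw : ContinuousAt (fun x : Fin m → ℂ => (Fin.cons 0 x : Fin (m + 1) → ℂ)) w :=
      (contDiff_cons.continuous.comp (continuous_const.prodMk continuous_id)).continuousAt
    filter_upwards [hcw.eventually (hu.eventually (by simp)),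
      hcw.eventually (eventually_eventually_nhds.2 hexp)] with x hux hex
    have h1 : ∀ᶠ t in 𝓝 (0 : ℂ), slice (fun y => h (φ y)) x t =
        ∑ i ∈ Finset.range d, a i x * t ^ i + t ^ d * slice u x t := by
      filter_upwards [hex.slice] with t ht
      simpa [slice] using ht
    have h2 := iteratedDeriv_of_taylor hux.analyticAt_slice h1
    have h3 : ∀ j, iteratedDeriv j (slice (fun y => h (φ y)) x) 0 = iteratedDeriv j (slice h x) (b x) := by
      intro j
      rw [hslice, iteratedDeriv_comp_add_const]
      simp
    exact ⟨fun j hj => by rw [← h3]; exact h2.1 j hj, by rw [← h3]; exact h2.2⟩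
  have hne : iteratedDeriv d (slice h w) z ≠ 0 := by
    intro h0
    have hs := hh.analyticAt_slice
    have h1 := (natCast_le_analyticOrderAt_iff_iteratedDeriv_eq_zero hs).1 hord.ge
    have : ((d + 1 : ℕ) : ℕ∞) ≤ analyticOrderAt (slice h w) z := by
      refine (natCast_le_analyticOrderAt_iff_iteratedDeriv_eq_zero hs).2 fun j hj => ?_
      rcases Nat.lt_succ_iff_lt_or_eq.1 hj with hj | rfl
      · exact h1 j hj
      · exact h0
    rw [hord] at this
    exact absurd (Nat.cast_le.1 this) (by omega)
  obtain ⟨A₁, hA₁, hA₁0, hd₁⟩ := exists_common_multiple (Finset.range d) ha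
  obtain ⟨A₂, hA₂, hA₂0, hd₂⟩ := exists_common_multiple (Finset.range d ×ˢ Finset.range d)
    (F := fun ij x => a ij.1 x ^ (d.factorial / (d - ij.1)) - a ij.2 x ^ (d.factorial / (d - ij.2)))
    (p := w) (fun ij => ((ha _).pow _).sub ((ha _).pow _))
  have hA : Resolvable (fun x => g x * (A₁ x * A₂ x)) w := by
    refine hm _ w (hg.mul (hA₁.mul hA₂)) fun h0 => ?_
    rcases hg.eventuallyEq_zero_or_of_mul (hA₁.mul hA₂) h0 with h0 | h0
    · exact hg0 h0
    · exact (hA₁.eventuallyEq_zero_or_of_mul hA₂ h0).elim hA₁0 hA₂0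
  have H : LiftData d (fun x => g x * (A₁ x * A₂ x)) g a u (fun y => h (φ y)) w := by
    refine ⟨ha, hu, ?_, hg, hexp, fun i hi => ?_, ?_, fun i hi => ?_, fun i hi j hj => ?_⟩
    · intro h0
      have := htay.self_of_nhds.2
      rw [h0, hbw, mul_zero] at this
      exact hne this
    · filter_upwards [htay, hbd i hi] with x hx hx'
      have := hx.1 i (by omega)
      rw [hx'] at this
      exact (mul_eq_zero.1 this.symm).resolve_left (by exact_mod_cast Nat.factorial_ne_zero _)
    · exact ⟨_, hA₁.mul hA₂, Eventually.of_forall fun y => rfl⟩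
    · refine (hd₁ i (Finset.mem_range.2 hi)).imp id fun h => ?_
      have := h.mul_right (hA₂.mul hg)
      convert this using 2
      ring
    · refine (hd₂ (i, j) (by simp [hi, hj])).imp id fun h => ?_
      have := h.mul_right (hA₁.mul hg)
      convert this using 2
      ring
  have hR := hA.lift ih _ _ _ _ H
  rw [← hφq]
  refine .biholo _ φ _ _ hφc (by rw [hφq]; exact hψc) (Eventually.of_forall fun y => by simp [hφ]) ?_
  simpa [hφ] using hR

/-- **Local resolution** of holomorphic germs. -/
theorem allResolvable (n : ℕ) : AllResolvable n := by
  induction n with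
  | zero =>
    intro h x hh h0
    refine .of_monom_mul 0 hh (fun hx => h0 ?_) (Eventually.of_forall fun y => by rw [monom_zero, one_mul])
    exact Eventually.of_forall fun y => by rwa [Subsingleton.elim y x]
  | succ m ih =>
    intro h x hh h0
    by_cases hx : h x = 0
    swap
    · exact .of_monom_mul 0 hh hx (by simp [monom_zero])
    obtain ⟨r, hr, hd⟩ := hh.exists_ball_differentiableOn
    obtain ⟨y, hy0, hy⟩ := ((not_eventually.1 h0).and_eventually (Metric.ball_mem_nhds x hr)).exists
    have hline : ¬ ∀ᶠ t : ℂ in 𝓝 0, h (x + t • (y - x)) = 0 := fun hl =>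
      hy0 (eq_zero_of_eventually_zero_on_line (convex_ball x r) Metric.isOpen_ball
        (fun y hy => (hd y hy).differentiableWithinAt) (Metric.mem_ball_self hr) hy hl)
    have hv : y - x ≠ 0 := sub_ne_zero.2 fun h => hy0 (h ▸ hx)
    obtain ⟨L, hL⟩ := SeparatingDual.exists_continuousLinearEquiv_apply_eq (R := ℂ)
      (x := (Pi.single 0 1 : Fin (m + 1) → ℂ)) (y := y - x) (by simp) hv
    have hφc : ContDiff ℂ 1 fun y : Fin (m + 1) → ℂ => x + L y := contDiff_const.add L.contDiff
    have hh' : ContDiffAt ℂ 1 (fun y => h (x + L y)) (Fin.cons 0 0 : Fin (m + 1) → ℂ) :=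
      ContDiffAt.comp (g := h) (f := fun y => x + L y) (Fin.cons 0 0 : Fin (m + 1) → ℂ)
        (by rw [cons_zero_zero]; simpa using hh) hφc.contDiffAt
    have hs : slice (fun y => h (x + L y)) 0 = fun t => h (x + t • (y - x)) := by
      funext t
      have : (Pi.single 0 t : Fin (m + 1) → ℂ) = t • Pi.single 0 1 := by
        rw [← Pi.single_smul, smul_eq_mul, mul_one]
      simp only [slice, cons_zero_right]
      rw [this, map_smul, hL]
    have hord : analyticOrderAt (slice (fun y => h (x + L y)) 0) 0 ≠ ⊤ := by
      rw [Ne, analyticOrderAt_eq_top, hs]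
      exact hline
    obtain ⟨d, hd⟩ := ENat.ne_top_iff_exists.1 hord
    have hR := RegularResolvable.of_allResolvable ih d _ 0 0 (fun _ => 1) hh' hd.symm contDiffAt_const
      (by simp [NeBot.ne])
    have hx0 : x + L 0 = x := by simp
    have := Resolvable.biholo h (fun y => x + L y) (fun y => L.symm (y - x)) 0 hφc.contDiffAt
      (L.symm.contDiff.comp (contDiff_id.sub contDiff_const)).contDiffAt (by simp)
      (by simpa [cons_zero_zero] using hR)
    simpa [hx0] using this

/-- A measure on `ℂ` which is essentially increasing under dilations by factors in `[1, 2]`. -/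
def DilationBound (m : Measure ℂ) : Prop :=
  ∃ K : ENNReal, K ≠ ⊤ ∧ ∀ l : ℂ, 1 ≤ ‖l‖ → ‖l‖ ≤ 2 → ∀ F : ℂ → ENNReal, Measurable F →
    ∫⁻ s, F s ∂m ≤ K * ∫⁻ s, F (l * s) ∂m

/-- The mass of small balls for `m` has order of magnitude at least `t ^ (2 * c)`, and negative
moments of order less than `2 * c` are finite. -/
def HasExponent (m : Measure ℂ) (c : ℝ) : Prop :=
  0 < c ∧ (∃ k : ENNReal, k ≠ 0 ∧ ∀ t : ℝ, 0 < t → t ≤ 1 →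
    k * ENNReal.ofReal (t ^ (2 * c)) ≤ m (Metric.ball 0 t)) ∧
  ∀ α : ℝ, 0 ≤ α → α < c → ∫⁻ s, ‖s‖ₑ ^ (-(2 * α)) ∂m ≠ ⊤

/-- Measures on `ℂ` behaving under dilations like finite sums of push-forwards of monomial
densities under monomial maps. -/
def NiceMeasure (m : Measure ℂ) : Prop := DilationBound m ∧ (m = 0 ∨ ∃ c, HasExponent m c)

theorem NiceMeasure.zero : NiceMeasure 0 :=
  ⟨⟨0, by simp, by simp⟩, Or.inl rfl⟩

theorem NiceMeasure.smul {m : Measure ℂ} (h : NiceMeasure m) {b : ENNReal} (hb : b ≠ ⊤) :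
    NiceMeasure (b • m) := by
  obtain ⟨⟨K, hK, hd⟩, he⟩ := h
  refine ⟨⟨K, hK, fun l h1 h2 F hF => ?_⟩, ?_⟩
  · rw [lintegral_smul_measure, lintegral_smul_measure, smul_eq_mul, smul_eq_mul, mul_left_comm]
    gcongr
    exact hd l h1 h2 F hF
  · rcases eq_or_ne b 0 with rfl | hb0
    · left; simp
    rcases he with rfl | ⟨c, hc, ⟨k, hk, hkt⟩, hf⟩
    · left; simp
    refine Or.inr ⟨c, hc, ⟨b * k, mul_ne_zero hb0 hk, fun t h0 h1 => ?_⟩, fun α h0 h1 => ?_⟩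
    · rw [Measure.smul_apply, smul_eq_mul, mul_assoc]
      gcongr
      exact hkt t h0 h1
    · rw [lintegral_smul_measure, smul_eq_mul]
      exact ENNReal.mul_ne_top hb (hf α h0 h1)

theorem HasExponent.add {m m' : Measure ℂ} {c c' : ℝ} (h : HasExponent m c) (h' : HasExponent m' c')
    (hc : c ≤ c') : HasExponent (m + m') c := by
  obtain ⟨hc, ⟨k, hk, hkt⟩, hf⟩ := h
  refine ⟨hc, ⟨k, hk, fun t h0 h1 => (hkt t h0 h1).trans ?_⟩, fun α h0 h1 => ?_⟩
  · rw [Measure.add_apply]; exact le_self_add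
  · rw [lintegral_add_measure]
    exact ENNReal.add_ne_top.2 ⟨hf α h0 h1, h'.2.2 α h0 (by linarith)⟩

theorem NiceMeasure.add {m m' : Measure ℂ} (h : NiceMeasure m) (h' : NiceMeasure m') :
    NiceMeasure (m + m') := by
  obtain ⟨⟨K, hK, hd⟩, he⟩ := h
  obtain ⟨⟨K', hK', hd'⟩, he'⟩ := h'
  refine ⟨⟨K + K', ENNReal.add_ne_top.2 ⟨hK, hK'⟩, fun l h1 h2 F hF => ?_⟩, ?_⟩
  · rw [lintegral_add_measure, lintegral_add_measure, mul_add]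
    refine add_le_add ((hd l h1 h2 F hF).trans ?_) ((hd' l h1 h2 F hF).trans ?_) <;> gcongr
    · exact le_self_add
    · exact le_add_self
  · rcases he with rfl | ⟨c, hc⟩
    · simpa using he'
    rcases he' with rfl | ⟨c', hc'⟩
    · exact Or.inr ⟨c, by simpa using hc⟩
    rcases le_total c c' with h | h
    · exact Or.inr ⟨c, hc.add hc' h⟩
    · rw [add_comm]; exact Or.inr ⟨c', hc'.add hc h⟩

theorem NiceMeasure.sum {ι : Type*} (s : Finset ι) {m : ι → Measure ℂ} (h : ∀ i ∈ s, NiceMeasure (m i)) :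
    NiceMeasure (∑ i ∈ s, m i) := by
  classical
  induction s using Finset.induction_on with
  | empty => simpa using NiceMeasure.zero
  | insert i s hi ih =>
    rw [Finset.sum_insert hi]
    exact (h i (Finset.mem_insert_self i s)).add (ih fun j hj => h j (Finset.mem_insert_of_mem hj))

/-- Locally at `p`, the push-forward under `f` of the measure with density `w` is comparable,
close to the origin, to a nice measure. -/
def RegularAt {n : ℕ} (f : (Fin n → ℂ) → ℂ) (w : (Fin n → ℂ) → ENNReal) (p : Fin n → ℂ) : Prop :=
  ∀ V' ∈ 𝓝 p, ∃ V ∈ 𝓝 p, ∃ δ > (0 : ℝ), ∃ m : Measure ℂ, NiceMeasure m ∧ ∃ C : ENNReal, C ≠ ⊤ ∧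
    ∀ F : ℂ → ENNReal, Measurable F →
      ((∀ s, δ ≤ ‖s‖ → F s = 0) → ∫⁻ y in V, F (f y) * w y ≤ ∫⁻ s, F s ∂m) ∧
      ∫⁻ s, F s ∂m ≤ C * ∫⁻ y in V', F (f y) * w y

theorem RegularAt.of_ne {n : ℕ} {f : (Fin n → ℂ) → ℂ} {w : (Fin n → ℂ) → ENNReal} {p : Fin n → ℂ}
    (hf : ContinuousAt f p) (h : f p ≠ 0) : RegularAt f w p := by
  intro V' _
  have h1 : ∀ᶠ y in 𝓝 p, ‖f p‖ / 2 < ‖f y‖ :=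
    hf.norm.eventually (lt_mem_nhds (half_lt_self (norm_pos_iff.2 h)))
  obtain ⟨V, hV, hVo, hp⟩ := eventually_nhds_iff.1 h1
  refine ⟨V, hVo.mem_nhds hp, ‖f p‖ / 2, half_pos (norm_pos_iff.2 h), 0, .zero, 0, by simp,
    fun F hF => ⟨fun hs => ?_, by simp⟩⟩
  rw [setLIntegral_congr_fun hVo.measurableSet (g := fun _ => 0)
    (fun y hy => by simp [hs _ (hV y hy).le])]
  simp

theorem RegularAt.congr {n : ℕ} {f f' : (Fin n → ℂ) → ℂ} {w w' : (Fin n → ℂ) → ENNReal} {p : Fin n → ℂ}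
    (h : RegularAt f w p) (hf : ∀ᶠ y in 𝓝 p, f' y = f y) {b b' : ENNReal} (hb : b ≠ ⊤) (hb' : b' ≠ ⊤)
    (hw : ∀ᶠ y in 𝓝 p, w' y ≤ b * w y ∧ w y ≤ b' * w' y) : RegularAt f' w' p := by
  intro V' hV'
  obtain ⟨G, hG, hGo, hpG⟩ := eventually_nhds_iff.1 ((hf.and hw).and hV')
  obtain ⟨V, hV, δ, hδ, m, hm, C, hC, H⟩ := h G (hGo.mem_nhds hpG)
  obtain ⟨V₂, hV₂, hV₂o, hpV₂⟩ := mem_nhds_iff.1 (inter_mem hV (hGo.mem_nhds hpG))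
  refine ⟨V₂, hV₂o.mem_nhds hpV₂, δ, hδ, b • m, hm.smul hb, b * C * b',
    ENNReal.mul_ne_top (ENNReal.mul_ne_top hb hC) hb', fun F hF => ⟨fun hs => ?_, ?_⟩⟩
  · rw [lintegral_smul_measure, smul_eq_mul]
    calc ∫⁻ y in V₂, F (f' y) * w' y ≤ ∫⁻ y in V₂, b * (F (f y) * w y) := by
          refine setLIntegral_mono' hV₂o.measurableSet fun y hy => ?_
          have := (hG y (hV₂ hy).2).1
          rw [this.1, mul_left_comm]
          gcongr
          exact this.2.1
      _ = b * ∫⁻ y in V₂, F (f y) * w y := lintegral_const_mul' _ _ hb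
      _ ≤ b * ∫⁻ y in V, F (f y) * w y := by
          gcongr
          exact fun y hy => (hV₂ hy).1
      _ ≤ _ := by gcongr; exact (H F hF).1 hs
  · rw [lintegral_smul_measure, smul_eq_mul, mul_assoc, mul_assoc]
    gcongr
    refine ((H F hF).2).trans ?_
    gcongr
    calc ∫⁻ y in G, F (f y) * w y ≤ ∫⁻ y in G, b' * (F (f' y) * w' y) := by
          refine setLIntegral_mono' hGo.measurableSet fun y hy => ?_
          have := (hG y hy).1
          rw [this.1, mul_left_comm]
          gcongr
          exact this.2.2
      _ = b' * ∫⁻ y in G, F (f' y) * w' y := lintegral_const_mul' _ _ hb'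
      _ ≤ _ := by
          gcongr
          exact fun y hy => (hG y hy).2

theorem RegularAt.biholo {n : ℕ} {f : (Fin n → ℂ) → ℂ} {w : (Fin n → ℂ) → ENNReal}
    {φ ψ : (Fin n → ℂ) → (Fin n → ℂ)} {q : Fin n → ℂ} (hφ : ContDiffAt ℝ 1 φ q)
    (hψ : ContDiffAt ℝ 1 ψ (φ q)) (hψφ : ∀ᶠ y in 𝓝 q, ψ (φ y) = y)
    (h : RegularAt (fun y => f (φ y)) (fun y => w (φ y)) q) : RegularAt f w (φ q) := by
  have hφ1 : ∀ᶠ y in 𝓝 q, HasFDerivAt φ (fderiv ℝ φ y) y := by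
    filter_upwards [hφ.eventually (by simp)] with y hy
    exact (hy.differentiableAt (by simp)).hasFDerivAt
  have hdet0 : (fderiv ℝ φ q).det ≠ 0 := by
    have h1 : (fderiv ℝ ψ (φ q)).comp (fderiv ℝ φ q) = ContinuousLinearMap.id ℝ _ := by
      refine HasFDerivAt.unique (f := fun y => ψ (φ y)) (x := q)
        ((hψ.differentiableAt (by simp)).hasFDerivAt.comp q hφ1.self_of_nhds) ?_
      exact (hasFDerivAt_id q).congr_of_eventuallyEq hψφ
    intro h0
    have h2 : LinearMap.det (((fderiv ℝ ψ (φ q)).comp (fderiv ℝ φ q) :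
        (Fin n → ℂ) →L[ℝ] (Fin n → ℂ)) : (Fin n → ℂ) →ₗ[ℝ] (Fin n → ℂ)) = 1 := by
      rw [h1]; simp
    have h3 : LinearMap.det (((fderiv ℝ ψ (φ q)) : (Fin n → ℂ) →ₗ[ℝ] (Fin n → ℂ)).comp
        ((fderiv ℝ φ q) : (Fin n → ℂ) →ₗ[ℝ] (Fin n → ℂ))) = 1 := h2
    rw [LinearMap.det_comp] at h3
    rw [ContinuousLinearMap.det] at h0
    rw [h0, mul_zero] at h3
    exact zero_ne_one h3
  have hdc : ContinuousAt (fun y => (fderiv ℝ φ y).det) q :=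
    ContinuousAt.comp (g := fun A : (Fin n → ℂ) →L[ℝ] (Fin n → ℂ) => A.det)
      ContinuousLinearMap.continuous_det.continuousAt (hφ.fderiv_right (m := 0) (by simp)).continuousAt
  set D : ℝ := |(fderiv ℝ φ q).det| with hD
  have hDpos : 0 < D := abs_pos.2 hdet0
  have hdet : ∀ᶠ y in 𝓝 q, |(fderiv ℝ φ y).det| < 2 * D ∧ D / 2 < |(fderiv ℝ φ y).det| :=
    (hdc.abs.eventually (gt_mem_nhds (by linarith))).and (hdc.abs.eventually (lt_mem_nhds (by linarith)))
  have hstrict : HasStrictFDerivAt φ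
      (((fderiv ℝ φ q).toContinuousLinearEquivOfDetNeZero hdet0 : (Fin n → ℂ) ≃L[ℝ] (Fin n → ℂ)) :
        (Fin n → ℂ) →L[ℝ] (Fin n → ℂ)) q := by
    simpa using hφ.hasStrictFDerivAt (by simp)
  have hmap := hstrict.map_nhds_eq_of_equiv
  intro V' hV'
  obtain ⟨G, hG, hGo, hqG⟩ := eventually_nhds_iff.1
    (((hφ1.and hdet).and hψφ).and (hφ.continuousAt.eventually hV'))
  have hint : ∀ S : Set (Fin n → ℂ), MeasurableSet S → S ⊆ G → ∀ Φ : (Fin n → ℂ) → ENNReal,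
      ∫⁻ x in φ '' S, Φ x ≤ ENNReal.ofReal (2 * D) * ∫⁻ y in S, Φ (φ y) ∧
      ∫⁻ y in S, Φ (φ y) ≤ (ENNReal.ofReal (D / 2))⁻¹ * ∫⁻ x in φ '' S, Φ x := by
    intro S hS hSG Φ
    have hinj : Set.InjOn φ S := fun x hx y hy hxy => by
      rw [← (hG x (hSG hx)).1.2, ← (hG y (hSG hy)).1.2, hxy]
    rw [lintegral_image_eq_lintegral_abs_det_fderiv_mul volume hS
      (fun x hx => (hG x (hSG hx)).1.1.1.hasFDerivWithinAt) hinj]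
    constructor
    · rw [← lintegral_const_mul' _ _ ENNReal.ofReal_ne_top]
      refine setLIntegral_mono' hS fun y hy => ?_
      gcongr
      exact (hG y (hSG hy)).1.1.2.1.le
    · have hD2 : ENNReal.ofReal (D / 2) ≠ 0 := by simp [hDpos]
      rw [← lintegral_const_mul' _ _ (by simp [hDpos])]
      refine setLIntegral_mono' hS fun y hy => ?_
      rw [← mul_assoc]
      refine le_mul_of_one_le_left (by simp) ?_
      rw [← ENNReal.inv_mul_cancel hD2 (by simp)]
      gcongr
      exact (hG y (hSG hy)).1.1.2.2.le
  obtain ⟨V, hV, δ, hδ, m, hm, C, hC, H⟩ := h G (hGo.mem_nhds hqG)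
  obtain ⟨V₂, hV₂, hV₂o, hqV₂⟩ := mem_nhds_iff.1 (inter_mem hV (hGo.mem_nhds hqG))
  refine ⟨φ '' V₂, ?_, δ, hδ, ENNReal.ofReal (2 * D) • m, hm.smul ENNReal.ofReal_ne_top,
    ENNReal.ofReal (2 * D) * (C * (ENNReal.ofReal (D / 2))⁻¹),
    ENNReal.mul_ne_top ENNReal.ofReal_ne_top (ENNReal.mul_ne_top hC (by simp [hDpos])),
    fun F hF => ⟨fun hs => ?_, ?_⟩⟩
  · rw [← hmap]; exact image_mem_map (hV₂o.mem_nhds hqV₂)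
  · rw [lintegral_smul_measure, smul_eq_mul]
    refine (hint V₂ hV₂o.measurableSet (fun y hy => (hV₂ hy).2) fun x => F (f x) * w x).1.trans ?_
    gcongr
    refine le_trans ?_ ((H F hF).1 hs)
    exact lintegral_mono_set fun y hy => (hV₂ hy).1
  · rw [lintegral_smul_measure, smul_eq_mul, mul_assoc, mul_assoc]
    gcongr
    refine ((H F hF).2).trans ?_
    gcongr
    refine (hint G hGo.measurableSet subset_rfl fun x => F (f x) * w x).2.trans ?_
    gcongr
    rintro _ ⟨y, hy, rfl⟩
    exact (hG y hy).2

theorem setLIntegral_biUnion_finset_le {α ι : Type*} [MeasurableSpace α] {μ : Measure α} (T : Finset ι)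
    (V : ι → Set α) (F : α → ENNReal) : ∫⁻ y in ⋃ q ∈ T, V q, F y ∂μ ≤ ∑ q ∈ T, ∫⁻ y in V q, F y ∂μ := by
  classical
  induction T using Finset.induction_on with
  | empty => simp
  | insert i s hi ih =>
    rw [Finset.sum_insert hi, Finset.set_biUnion_insert]
    exact (lintegral_union_le F _ _).trans (by gcongr)

/-- Regularity can be checked on finitely many charts which are proper on the relevant sets. -/
theorem RegularAt.of_charts {n : ℕ} {ι : Type*} [Fintype ι] {f : (Fin n → ℂ) → ℂ}
    {w : (Fin n → ℂ) → ENNReal} {p : Fin n → ℂ} (hf : Measurable f) (hw : Measurable w)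
    {σ : ι → (Fin n → ℂ) → (Fin n → ℂ)} {ω : ι → (Fin n → ℂ) → ENNReal} {S K : ι → Set (Fin n → ℂ)}
    (hσ : ∀ j, Continuous (σ j)) (hω : ∀ j, Measurable (ω j)) (hS : ∀ j, MeasurableSet (S j))
    (hcov : ∀ x, ∃ j, x ∈ S j) (hK : ∀ j y, σ j y ∈ S j → ω j y ≠ 0 → y ∈ K j)
    (hcomp : ∀ j, IsCompact (K j ∩ σ j ⁻¹' Metric.closedBall p 1)) {b b' : ENNReal} (hb : b ≠ ⊤)
    (hb' : b' ≠ ⊤) (hint : ∀ j (Φ : (Fin n → ℂ) → ENNReal), Measurable Φ →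
      ∫⁻ x, Φ x ≤ b * ∫⁻ y, Φ (σ j y) * ω j y ∧ ∫⁻ y, Φ (σ j y) * ω j y ≤ b' * ∫⁻ x, Φ x)
    (h : ∀ j, ∀ q ∈ K j, σ j q = p → RegularAt (fun y => f (σ j y)) (fun y => w (σ j y) * ω j y) q) :
    RegularAt f w p := by
  classical
  intro V'₀ hV'₀
  obtain ⟨V', hV'₀V', hV'o, hpV'⟩ := mem_nhds_iff.1 hV'₀
  have hq : ∀ j (q : Fin n → ℂ), ∃ V : Set (Fin n → ℂ), IsOpen V ∧ ∃ δ > (0 : ℝ), ∃ m : Measure ℂ,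
      NiceMeasure m ∧ ∃ C : ENNReal, C ≠ ⊤ ∧ ((q ∈ K j ∧ σ j q = p) → q ∈ V ∧
      ∀ F : ℂ → ENNReal, Measurable F →
      ((∀ s, δ ≤ ‖s‖ → F s = 0) → ∫⁻ y in V, F (f (σ j y)) * (w (σ j y) * ω j y) ≤ ∫⁻ s, F s ∂m) ∧
      ∫⁻ s, F s ∂m ≤ C * ∫⁻ y in σ j ⁻¹' V', F (f (σ j y)) * (w (σ j y) * ω j y)) := by
    intro j q
    by_cases hqp : q ∈ K j ∧ σ j q = p
    · obtain ⟨V, hV, δ, hδ, m, hm, C, hC, H⟩ := h j q hqp.1 hqp.2 (σ j ⁻¹' V')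
        ((hσ j).continuousAt.preimage_mem_nhds (by rw [hqp.2]; exact hV'o.mem_nhds hpV'))
      obtain ⟨V₂, hV₂, hV₂o, hqV₂⟩ := mem_nhds_iff.1 hV
      refine ⟨V₂, hV₂o, δ, hδ, m, hm, C, hC, fun _ => ⟨hqV₂, fun F hF => ⟨fun hs => ?_, (H F hF).2⟩⟩⟩
      exact (lintegral_mono_set hV₂).trans ((H F hF).1 hs)
    · exact ⟨∅, isOpen_empty, 1, one_pos, 0, .zero, 0, by simp, fun h => absurd h hqp⟩
  choose V hVo δ hδ m hm C hC H using hq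
  have hfin : ∀ j, ∃ T : Finset (Fin n → ℂ), (∀ q ∈ T, q ∈ K j ∧ σ j q = p) ∧
      ∃ U ∈ 𝓝 p, ∀ y ∈ K j, σ j y ∈ U → ∃ q ∈ T, y ∈ V j q := by
    intro j
    have hc1 : IsCompact ((K j ∩ σ j ⁻¹' Metric.closedBall p 1) ∩ σ j ⁻¹' {p}) :=
      (hcomp j).inter_right (isClosed_singleton.preimage (hσ j))
    obtain ⟨T, hTs, hT⟩ := hc1.elim_nhds_subcover (V j) fun q hq =>
      (hVo j q).mem_nhds (H j q ⟨hq.1.1, hq.2⟩).1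
    refine ⟨T, fun q hq => ⟨(hTs q hq).1.1, (hTs q hq).2⟩, ?_⟩
    set O : Set (Fin n → ℂ) := ⋃ q ∈ T, V j q with hO
    have hOo : IsOpen O := isOpen_biUnion fun q _ => hVo j q
    have hc2 : IsCompact (σ j '' ((K j ∩ σ j ⁻¹' Metric.closedBall p 1) \ O)) :=
      ((hcomp j).diff hOo).image (hσ j)
    refine ⟨Metric.ball p 1 ∩ (σ j '' ((K j ∩ σ j ⁻¹' Metric.closedBall p 1) \ O))ᶜ,
      inter_mem (Metric.ball_mem_nhds p one_pos) (hc2.isClosed.isOpen_compl.mem_nhds ?_), ?_⟩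
    · rintro ⟨y, ⟨hy1, hy2⟩, hy3⟩
      exact hy2 (hT ⟨hy1, hy3⟩)
    · intro y hyK hyU
      by_contra hcon
      refine hyU.2 ⟨y, ⟨⟨hyK, Metric.ball_subset_closedBall hyU.1⟩, fun hyO => hcon ?_⟩, rfl⟩
      simpa [hO] using hyO
  choose T hTK U hU hTU using hfin
  obtain ⟨W, hW, hWo, hpW⟩ := mem_nhds_iff.1 (iInter_mem.2 hU)
  have hδmin : ∃ ε > 0, ∀ j, ∀ q ∈ T j, ε ≤ δ j q := by
    have h1 : ∀ᶠ ε in 𝓝[>] (0 : ℝ), ∀ x ∈ Finset.univ.sigma T, ε ≤ δ x.1 x.2 := by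
      rw [Finset.eventually_all]
      exact fun x _ => mem_nhdsWithin_of_mem_nhds (Iic_mem_nhds (hδ x.1 x.2))
    obtain ⟨ε, hε, hε0⟩ := (h1.and self_mem_nhdsWithin).exists
    exact ⟨ε, hε0, fun j q hq => hε ⟨j, q⟩ (by simpa using hq)⟩
  obtain ⟨ε, hε, hεδ⟩ := hδmin
  refine ⟨W, hWo.mem_nhds hpW, ε, hε, b • ∑ j, ∑ q ∈ T j, m j q,
    (NiceMeasure.sum _ fun j _ => NiceMeasure.sum _ fun q _ => hm j q).smul hb,
    b * ∑ j, ∑ q ∈ T j, (C j q * b'), ENNReal.mul_ne_top hb (ENNReal.sum_ne_top.2 fun j _ =>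
      ENNReal.sum_ne_top.2 fun q _ => ENNReal.mul_ne_top (hC j q) hb'), fun F hF => ⟨fun hs => ?_, ?_⟩⟩
  · rw [lintegral_smul_measure, smul_eq_mul, lintegral_finsetSum_measure]
    have hFw : Measurable fun x => F (f x) * w x := (hF.comp hf).mul hw
    calc ∫⁻ x in W, F (f x) * w x ≤ ∑ j, ∫⁻ x in W ∩ S j, F (f x) * w x := by
          have : W ⊆ ⋃ j ∈ (Finset.univ : Finset ι), W ∩ S j := fun x hx => by
            obtain ⟨j, hj⟩ := hcov x
            simp only [Set.mem_iUnion]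
            exact ⟨j, Finset.mem_univ j, hx, hj⟩
          exact (lintegral_mono_set this).trans (setLIntegral_biUnion_finset_le _ _ _)
      _ ≤ ∑ j, b * ∑ q ∈ T j, ∫⁻ s, F s ∂(m j q) := by
          refine Finset.sum_le_sum fun j _ => ?_
          rw [← lintegral_indicator (hWo.measurableSet.inter (hS j))]
          refine ((hint j _ (hFw.indicator (hWo.measurableSet.inter (hS j)))).1).trans ?_
          gcongr
          calc ∫⁻ y, (W ∩ S j).indicator (fun x => F (f x) * w x) (σ j y) * ω j y
              ≤ ∫⁻ y, (⋃ q ∈ T j, V j q).indicator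
                (fun y => F (f (σ j y)) * (w (σ j y) * ω j y)) y := by
                refine lintegral_mono fun y => ?_
                by_cases hy : σ j y ∈ W ∩ S j
                · rw [Set.indicator_of_mem hy]
                  rcases eq_or_ne (ω j y) 0 with h0 | h0
                  · simp [h0]
                  · obtain ⟨q, hq, hyq⟩ := hTU j y (hK j y hy.2 h0) (Set.mem_iInter.1 (hW hy.1) j)
                    rw [Set.indicator_of_mem (show y ∈ ⋃ q ∈ T j, V j q from Set.mem_biUnion hq hyq), mul_assoc]
                · rw [Set.indicator_of_notMem hy]; simp
            _ = ∫⁻ y in ⋃ q ∈ T j, V j q, F (f (σ j y)) * (w (σ j y) * ω j y) :=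
                lintegral_indicator (isOpen_biUnion fun q _ => hVo j q).measurableSet _
            _ ≤ ∑ q ∈ T j, ∫⁻ y in V j q, F (f (σ j y)) * (w (σ j y) * ω j y) :=
                setLIntegral_biUnion_finset_le _ _ _
            _ ≤ _ := Finset.sum_le_sum fun q hq => ((H j q (hTK j q hq)).2 F hF).1
                fun s hsn => hs s ((hεδ j q hq).trans hsn)
      _ = _ := by
          rw [← Finset.mul_sum]
          simp_rw [lintegral_finsetSum_measure]
  · rw [lintegral_smul_measure, smul_eq_mul, lintegral_finsetSum_measure, mul_assoc]
    gcongr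
    rw [Finset.sum_mul]
    refine Finset.sum_le_sum fun j _ => ?_
    rw [lintegral_finsetSum_measure, Finset.sum_mul]
    refine Finset.sum_le_sum fun q hq => (((H j q (hTK j q hq)).2 F hF).2).trans ?_
    rw [mul_assoc]
    gcongr
    have hFw : Measurable fun x => F (f x) * w x := (hF.comp hf).mul hw
    have h1 := (hint j _ (hFw.indicator hV'o.measurableSet)).2
    rw [lintegral_indicator hV'o.measurableSet] at h1
    refine (le_trans ?_ h1).trans ?_
    · rw [← lintegral_indicator (hV'o.measurableSet.preimage (hσ j).measurable)]
      refine lintegral_mono fun y => ?_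
      by_cases hy : σ j y ∈ V'
      · rw [Set.indicator_of_mem hy, Set.indicator_of_mem (show y ∈ σ j ⁻¹' V' from hy), mul_assoc]
      · rw [Set.indicator_of_notMem (show y ∉ σ j ⁻¹' V' from hy)]; simp
    · gcongr

/-- Integrals over `ℂⁿ` can be compared one coordinate at a time. -/
theorem lintegral_le_of_lintegral_update_le {n : ℕ} (i : Fin n) {G H : (Fin n → ℂ) → ENNReal}
    (hG : Measurable G) (hH : Measurable H)
    (h : ∀ y, ∫⁻ z, G (Function.update y i z) ≤ ∫⁻ z, H (Function.update y i z)) :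
    ∫⁻ y, G y ≤ ∫⁻ y, H y := by
  rw [volume_pi]
  refine lintegral_le_of_lmarginal_le {i} hG hH ?_
  rw [lmarginal_singleton, lmarginal_singleton]
  exact h

theorem lintegral_comp_mul_left {μ : ℂ} (hμ : μ ≠ 0) {G : ℂ → ENNReal} (hG : Measurable G) :
    ∫⁻ z, G (μ * z) * ‖μ‖ₑ ^ 2 = ∫⁻ z, G z := by
  set L : ℂ →ₗ[ℝ] ℂ := (LinearMap.mulLeft ℂ μ).restrictScalars ℝ with hL
  have hdet : LinearMap.det L = ‖μ‖ ^ 2 := by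
    rw [hL, LinearMap.det_restrictScalars]
    simp [Algebra.norm_complex_eq, Complex.normSq_eq_norm_sq]
  have h0 : LinearMap.det L ≠ 0 := by
    rw [hdet]; exact pow_ne_zero 2 (norm_ne_zero_iff.2 hμ)
  have h1 := Measure.map_linearMap_addHaar_eq_smul_addHaar (volume : Measure ℂ) h0
  have h2 : ∫⁻ z, G (μ * z) = ENNReal.ofReal |(LinearMap.det L)⁻¹| * ∫⁻ z, G z := by
    rw [← smul_eq_mul, ← lintegral_smul_measure, ← h1,
      lintegral_map hG (LinearMap.continuous_of_finiteDimensional L).measurable]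
    rfl
  rw [lintegral_mul_const _ (by fun_prop), h2, hdet, mul_right_comm]
  convert! one_mul _
  rw [abs_of_nonneg (by positivity), ← ofReal_norm, ← ENNReal.ofReal_pow (norm_nonneg _),
    ← ENNReal.ofReal_mul (by positivity),
    inv_mul_cancel₀ (pow_ne_zero 2 (norm_ne_zero_iff.2 hμ)), ENNReal.ofReal_one]

theorem lintegral_comp_pow {k : ℕ} (hk : 1 ≤ k) {G : ℂ → ENNReal} (hG : Measurable G) :
    ∫⁻ z, G z ≤ (k : ENNReal) ^ 2 * ∫⁻ z, G (z ^ k) * ‖z ^ (k - 1)‖ₑ ^ 2 ∧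
    ∫⁻ z, G (z ^ k) * ‖z ^ (k - 1)‖ₑ ^ 2 ≤
      ((Polynomial.nthRootsFinset k (1 : ℂ)).card : ENNReal) * ∫⁻ z, G z := by
  have hk0 : k ≠ 0 := by omega
  set S : Set ℂ := {z | (z ^ k) ^ ((k : ℂ)⁻¹) = z} with hS
  have hSm : MeasurableSet S := measurableSet_eq_fun (by fun_prop) measurable_id
  have hinj : Set.InjOn (fun z : ℂ => z ^ k) S := fun x hx y hy hxy => by
    rw [← show (x ^ k) ^ ((k : ℂ)⁻¹) = x from hx, ← show (y ^ k) ^ ((k : ℂ)⁻¹) = y from hy]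
    exact congrArg (· ^ ((k : ℂ)⁻¹)) hxy
  have himg : (fun z : ℂ => z ^ k) '' S = Set.univ := by
    refine Set.eq_univ_of_forall fun w => ⟨w ^ ((k : ℂ)⁻¹), ?_, Complex.cpow_nat_inv_pow w hk0⟩
    show ((w ^ ((k : ℂ)⁻¹)) ^ k) ^ ((k : ℂ)⁻¹) = _
    rw [Complex.cpow_nat_inv_pow w hk0]
  have hder : ∀ z ∈ S, HasFDerivWithinAt (fun z : ℂ => z ^ k)
      ((ContinuousLinearMap.toSpanSingleton ℂ ((k : ℂ) * z ^ (k - 1))).restrictScalars ℝ) S z := fun z _ =>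
    ((hasDerivAt_pow k z).hasFDerivAt.restrictScalars ℝ).hasFDerivWithinAt
  have hdet : ∀ z : ℂ, ENNReal.ofReal |((ContinuousLinearMap.toSpanSingleton ℂ
      ((k : ℂ) * z ^ (k - 1))).restrictScalars ℝ).det| = (k : ENNReal) ^ 2 * ‖z ^ (k - 1)‖ₑ ^ 2 := by
    intro z
    have h1 : ((ContinuousLinearMap.toSpanSingleton ℂ ((k : ℂ) * z ^ (k - 1))).restrictScalars ℝ).det
        = ‖(k : ℂ) * z ^ (k - 1)‖ ^ 2 := by
      simp [ContinuousLinearMap.det, LinearMap.det_restrictScalars, Algebra.norm_complex_eq,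
        Complex.normSq_eq_norm_sq]
    rw [h1, abs_of_nonneg (by positivity), ENNReal.ofReal_pow (norm_nonneg _), ofReal_norm,
      enorm_mul, mul_pow, show ‖(k : ℂ)‖ₑ = k by rw [← ofReal_norm, Complex.norm_natCast,
        ENNReal.ofReal_natCast]]
  have key : ∫⁻ z, G z = ∫⁻ z in S, (k : ENNReal) ^ 2 * (G (z ^ k) * ‖z ^ (k - 1)‖ₑ ^ 2) := by
    rw [← setLIntegral_univ, ← himg, lintegral_image_eq_lintegral_abs_det_fderiv_mul volume hSm hder hinj]
    refine lintegral_congr fun z => ?_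
    rw [hdet]; ring
  have hkk : ((k : ENNReal) ^ 2) ≠ ⊤ := by simp
  rw [lintegral_const_mul' _ _ hkk] at key
  refine ⟨?_, ?_⟩
  · rw [key]
    gcongr
    exact Measure.restrict_le_self
  · set Φ : ℂ → ENNReal := fun z => G (z ^ k) * ‖z ^ (k - 1)‖ₑ ^ 2 with hΦ
    have hΦm : Measurable Φ := by fun_prop
    have hle : ∫⁻ z in S, Φ z ≤ ∫⁻ z, G z := by
      rw [key]
      refine le_mul_of_one_le_left (by simp) ?_
      exact one_le_pow₀ (by exact_mod_cast hk)
    have hrot : ∀ ζ ∈ Polynomial.nthRootsFinset k (1 : ℂ),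
        ∫⁻ z, S.indicator Φ (ζ * z) = ∫⁻ z in S, Φ z := by
      intro ζ hζ
      have hζ1 : ζ ^ k = 1 := (Polynomial.mem_nthRootsFinset (by omega) _).1 hζ
      have hζn : ‖ζ‖ = 1 := by
        rw [← pow_left_inj₀ (norm_nonneg _) zero_le_one hk0, ← norm_pow, hζ1]; simp
      have hζ0 : ζ ≠ 0 := norm_ne_zero_iff.1 (by rw [hζn]; exact one_ne_zero)
      rw [← lintegral_indicator hSm, ← lintegral_comp_mul_left hζ0 (hΦm.indicator hSm)]
      have : ‖ζ‖ₑ = 1 := by rw [← ofReal_norm, hζn, ENNReal.ofReal_one]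
      simp [this]
    calc ∫⁻ z, Φ z ≤ ∫⁻ z, ∑ ζ ∈ Polynomial.nthRootsFinset k (1 : ℂ), S.indicator Φ (ζ * z) := by
          refine lintegral_mono fun z => ?_
          obtain ⟨ζ, hζ1, hζS⟩ : ∃ ζ : ℂ, ζ ^ k = 1 ∧ ζ * z ∈ S := by
            rcases eq_or_ne z 0 with rfl | hz
            · refine ⟨1, one_pow k, ?_⟩
              simp [hS, hk0]
            · refine ⟨(z ^ k) ^ ((k : ℂ)⁻¹) / z, ?_, ?_⟩
              · rw [div_pow, Complex.cpow_nat_inv_pow _ hk0, div_self (pow_ne_zero k hz)]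
              · rw [div_mul_cancel₀ _ hz, hS, Set.mem_ofPred_eq, Complex.cpow_nat_inv_pow _ hk0]
          have hζm : ζ ∈ Polynomial.nthRootsFinset k (1 : ℂ) :=
            (Polynomial.mem_nthRootsFinset (by omega) _).2 hζ1
          refine le_trans (le_of_eq ?_) (Finset.single_le_sum (fun _ _ => zero_le) hζm)
          rw [Set.indicator_of_mem hζS]
          have hζn : ‖ζ‖ = 1 := by
            rw [← pow_left_inj₀ (norm_nonneg _) zero_le_one hk0, ← norm_pow, hζ1]; simp
          have : ‖ζ‖ₑ = 1 := by rw [← ofReal_norm, hζn, ENNReal.ofReal_one]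
          simp only [hΦ, mul_pow, hζ1, one_mul, enorm_mul, enorm_pow, this, one_pow]
      _ = ∑ ζ ∈ Polynomial.nthRootsFinset k (1 : ℂ), ∫⁻ z, S.indicator Φ (ζ * z) :=
          lintegral_finsetSum _ fun ζ _ => (hΦm.indicator hSm).comp (by fun_prop)
      _ = (Polynomial.nthRootsFinset k (1 : ℂ)).card * ∫⁻ z in S, Φ z := by
          rw [Finset.sum_congr rfl hrot]; simp
      _ ≤ _ := by gcongr

theorem enorm_rpow_eq_ofReal {F : Type*} [NormedAddCommGroup F] {x : F} (hx : x ≠ 0) (s : ℝ) :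
    ‖x‖ₑ ^ s = ENNReal.ofReal (‖x‖ ^ s) := by
  rw [← ofReal_norm, ENNReal.ofReal_rpow_of_pos (norm_pos_iff.2 hx)]

theorem lintegral_ball_enorm_rpow_ne_top_iff {r : ℝ} (hr : 0 < r) (s : ℝ) :
    ∫⁻ z in Metric.ball (0 : ℂ) r, ‖z‖ₑ ^ s ≠ ⊤ ↔ -2 < s := by
  have h1 : ∫⁻ z in Metric.ball (0 : ℂ) r, ‖z‖ₑ ^ s =
      ∫⁻ z in Metric.ball (0 : ℂ) r, ENNReal.ofReal (‖z‖ ^ s) := by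
    refine lintegral_congr_ae (ae_restrict_of_ae ?_)
    filter_upwards [Measure.ae_ne volume (0 : ℂ)] with z hz
    exact enorm_rpow_eq_ofReal hz s
  have h2 : ∫⁻ z in Metric.ball (0 : ℂ) r, ENNReal.ofReal (‖z‖ ^ s) ≠ ⊤ ↔
      IntegrableOn (fun z : ℂ => ‖z‖ ^ s) (Metric.ball 0 r) := by
    rw [IntegrableOn, ← lt_top_iff_ne_top, ← hasFiniteIntegral_iff_ofReal
      (ae_of_all _ fun z => Real.rpow_nonneg (norm_nonneg z) s)]
    exact ⟨fun h => ⟨(by fun_prop : Measurable fun z : ℂ => ‖z‖ ^ s).aestronglyMeasurable, h⟩,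
      fun h => h.2⟩
  rw [h1, h2, integrableOn_fun_norm_addHaar volume (f := fun t => t ^ s),
    Complex.finrank_real_complex]
  rw [integrableOn_congr_fun (g := fun y : ℝ => y ^ (s + 1)) (fun y hy => ?_) measurableSet_Ioo,
    intervalIntegral.integrableOn_Ioo_rpow_iff hr]
  · constructor <;> intro h <;> linarith
  · simp only [smul_eq_mul]
    rw [Real.rpow_add_one hy.1.ne', mul_comm]; simp

theorem ae_eval_ne_zero {n : ℕ} (i : Fin n) : ∀ᵐ y : Fin n → ℂ, y i ≠ 0 := by
  rw [volume_pi]; exact Measure.ae_eval_ne _ i 0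

/-- The change of variables formula for the chart `y ↦ update y i (y i * y j)` of a blow-up. -/
theorem lintegral_update_mul {n : ℕ} {i j : Fin n} (hij : i ≠ j) {Φ : (Fin n → ℂ) → ENNReal}
    (hΦ : Measurable Φ) :
    ∫⁻ y, Φ (Function.update y i (y i * y j)) * ‖y j‖ₑ ^ 2 = ∫⁻ y, Φ y := by
  have hm : Measurable fun y : Fin n → ℂ => Φ (Function.update y i (y i * y j)) * ‖y j‖ₑ ^ 2 := by
    refine (hΦ.comp ?_).mul (by fun_prop)
    exact (contDiff_update_mul i i j).continuous.measurable
  have hsl : ∀ y : Fin n → ℂ, y j ≠ 0 →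
      ∫⁻ z, Φ (Function.update (Function.update y i z) i (Function.update y i z i *
        Function.update y i z j)) * ‖Function.update y i z j‖ₑ ^ 2 = ∫⁻ z, Φ (Function.update y i z) := by
    intro y hy
    simp only [Function.update_self, Function.update_of_ne hij.symm, Function.update_idem]
    rw [← lintegral_comp_mul_left hy (G := fun z => Φ (Function.update y i z))
      (hΦ.comp (measurable_update y))]
    simp only [mul_comm]
  apply le_antisymm
  · refine lintegral_le_of_lintegral_update_le i hm hΦ fun y => ?_
    by_cases hy : y j = 0
    · simp [Function.update_of_ne hij.symm, hy]
    · exact (hsl y hy).le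
  · have hms : MeasurableSet {y : Fin n → ℂ | y j ≠ 0} :=
      (measurableSet_singleton (0 : ℂ)).compl.preimage (measurable_pi_apply j)
    rw [← lintegral_congr_ae (f := {y : Fin n → ℂ | y j ≠ 0}.indicator Φ) (g := Φ)]
    · refine lintegral_le_of_lintegral_update_le i (hΦ.indicator hms) hm fun y => ?_
      by_cases hy : y j = 0
      · simp [Set.indicator, Function.update_of_ne hij.symm, hy]
      · rw [hsl y hy]
        exact lintegral_mono fun z => Set.indicator_le_self _ _ _
    · filter_upwards [ae_eval_ne_zero j] with y hy
      exact Set.indicator_of_mem (s := {y : Fin n → ℂ | y j ≠ 0}) hy Φ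

theorem lintegral_update_pow {n : ℕ} (i : Fin n) {k : ℕ} (hk : 1 ≤ k) {Φ : (Fin n → ℂ) → ENNReal}
    (hΦ : Measurable Φ) :
    ∫⁻ y, Φ y ≤ (k : ENNReal) ^ 2 * ∫⁻ y, Φ (Function.update y i (y i ^ k)) * ‖y i ^ (k - 1)‖ₑ ^ 2 ∧
    ∫⁻ y, Φ (Function.update y i (y i ^ k)) * ‖y i ^ (k - 1)‖ₑ ^ 2 ≤
      ((Polynomial.nthRootsFinset k (1 : ℂ)).card : ENNReal) * ∫⁻ y, Φ y := by
  have hm : Measurable fun y : Fin n → ℂ => Φ (Function.update y i (y i ^ k)) * ‖y i ^ (k - 1)‖ₑ ^ 2 := by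
    refine (hΦ.comp ?_).mul (by fun_prop)
    exact (contDiff_update_pow i k).continuous.measurable
  have hs : ∀ y : Fin n → ℂ, Measurable fun z => Φ (Function.update y i z) := fun y =>
    hΦ.comp (measurable_update y)
  rw [← lintegral_const_mul _ hm, ← lintegral_const_mul _ hΦ]
  constructor
  · refine lintegral_le_of_lintegral_update_le i hΦ (hm.const_mul _) fun y => ?_
    simp only [Function.update_self, Function.update_idem]
    rw [lintegral_const_mul' _ _ (by simp)]
    exact (lintegral_comp_pow hk (hs y)).1
  · refine lintegral_le_of_lintegral_update_le i hm (hΦ.const_mul _) fun y => ?_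
    simp only [Function.update_self, Function.update_idem]
    rw [lintegral_const_mul' _ _ (by simp)]
    exact (lintegral_comp_pow hk (hs y)).2

theorem measurable_monom {n : ℕ} (N : Fin n → ℕ) : Measurable (monom N) :=
  (contDiff_monom N).continuous.measurable

theorem measurable_update_const_mul {n : ℕ} (i : Fin n) (μ : ℂ) :
    Measurable fun y : Fin n → ℂ => Function.update y i (μ * y i) := by
  rw [measurable_pi_iff]
  intro j
  by_cases h : j = i
  · subst h; simp only [Function.update_self]; fun_prop
  · simp only [Function.update_of_ne h]; fun_prop

theorem lintegral_update_const_mul {n : ℕ} (i : Fin n) {μ : ℂ} (hμ : μ ≠ 0)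
    {Φ : (Fin n → ℂ) → ENNReal} (hΦ : Measurable Φ) :
    ‖μ‖ₑ ^ 2 * ∫⁻ y, Φ (Function.update y i (μ * y i)) = ∫⁻ y, Φ y := by
  have hm : Measurable fun y : Fin n → ℂ => Φ (Function.update y i (μ * y i)) :=
    hΦ.comp (measurable_update_const_mul i μ)
  rw [mul_comm, ← lintegral_mul_const _ hm]
  have key : ∀ y : Fin n → ℂ, ∫⁻ z, Φ (Function.update y i (μ * z)) * ‖μ‖ₑ ^ 2 =
      ∫⁻ z, Φ (Function.update y i z) := fun y =>
    lintegral_comp_mul_left hμ (G := fun z => Φ (Function.update y i z)) (hΦ.comp (measurable_update y))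
  have hm' := hm.mul_const (‖μ‖ₑ ^ 2)
  apply le_antisymm
  · refine lintegral_le_of_lintegral_update_le i hm' hΦ fun y => ?_
    simp only [Function.update_self, Function.update_idem]
    exact (key y).le
  · refine lintegral_le_of_lintegral_update_le i hΦ hm' fun y => ?_
    simp only [Function.update_self, Function.update_idem]
    exact (key y).ge

theorem update_mul_mem_ball {n : ℕ} {i : Fin n} {μ : ℂ} {y : Fin n → ℂ} {ρ : ℝ} (hμ : ‖μ‖ ≤ 1)
    (hρ : 0 < ρ) (hy : y ∈ Metric.ball 0 ρ) : Function.update y i (μ * y i) ∈ Metric.ball (0 : Fin n → ℂ) ρ := by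
  rw [mem_ball_zero_iff, pi_norm_lt_iff hρ] at hy ⊢
  intro j
  by_cases h : j = i
  · subst h
    rw [Function.update_self, norm_mul]
    exact (mul_le_of_le_one_left (norm_nonneg _) hμ).trans_lt (hy j)
  · rw [Function.update_of_ne h]; exact hy j

theorem mem_ball_of_update_mul {n : ℕ} {i : Fin n} {μ : ℂ} {y : Fin n → ℂ} {ρ : ℝ} (hμ : 1 ≤ ‖μ‖)
    (hρ : 0 < ρ) (hy : Function.update y i (μ * y i) ∈ Metric.ball (0 : Fin n → ℂ) ρ) :
    y ∈ Metric.ball 0 ρ := by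
  rw [mem_ball_zero_iff, pi_norm_lt_iff hρ] at hy ⊢
  intro j
  have := hy j
  by_cases h : j = i
  · subst h
    rw [Function.update_self, norm_mul] at this
    exact (le_mul_of_one_le_left (norm_nonneg _) hμ).trans_lt this
  · rwa [Function.update_of_ne h] at this

/-- The density `‖y ^ a‖ ^ 2` on the polydisc of radius `ρ` pushed forward by the monomial `y ^ N`. -/
def monomialMeasure {n : ℕ} (N a : Fin n → ℕ) (ρ : ℝ) : Measure ℂ :=
  Measure.map (monom N) ((volume.restrict (Metric.ball 0 ρ)).withDensity fun y => ‖monom a y‖ₑ ^ 2)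

theorem lintegral_monomialMeasure {n : ℕ} (N a : Fin n → ℕ) (ρ : ℝ) {F : ℂ → ENNReal}
    (hF : Measurable F) :
    ∫⁻ s, F s ∂(monomialMeasure N a ρ) = ∫⁻ y in Metric.ball 0 ρ, F (monom N y) * ‖monom a y‖ₑ ^ 2 := by
  have h1 := measurable_monom N
  have h2 := measurable_monom a
  rw [monomialMeasure, lintegral_map hF h1, lintegral_withDensity_eq_lintegral_mul _ (by fun_prop)
    (g := fun y => F (monom N y)) (hF.comp h1)]
  exact lintegral_congr fun y => mul_comm _ _

theorem exists_pow_eq_norm_le {N : ℕ} (hN : N ≠ 0) {l : ℂ} (h1 : 1 ≤ ‖l‖) (h2 : ‖l‖ ≤ 2) :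
    ∃ μ : ℂ, μ ^ N = l ∧ 1 ≤ ‖μ‖ ∧ ‖μ‖ ≤ 2 := by
  refine ⟨l ^ ((N : ℂ)⁻¹), Complex.cpow_nat_inv_pow l hN, ?_, ?_⟩ <;> by_contra! h
  · have := pow_lt_one₀ (norm_nonneg _) h hN
    rw [← norm_pow, Complex.cpow_nat_inv_pow l hN] at this
    linarith
  · have := le_self_pow₀ (by linarith : 1 ≤ ‖l ^ ((N : ℂ)⁻¹)‖) hN
    rw [← norm_pow, Complex.cpow_nat_inv_pow l hN] at this
    linarith

theorem dilationBound_monomialMeasure {n : ℕ} {N : Fin n → ℕ} (a : Fin n → ℕ) {ρ : ℝ} (hρ : 0 < ρ)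
    {i : Fin n} (hi : N i ≠ 0) : DilationBound (monomialMeasure N a ρ) := by
  have hN := measurable_monom N
  have ha := measurable_monom a
  refine ⟨(2 : ENNReal) ^ 2 * (2 ^ a i) ^ 2, by finiteness, fun l h1 h2 F hF => ?_⟩
  obtain ⟨μ, rfl, hμ1, hμ2⟩ := exists_pow_eq_norm_le hi h1 h2
  have hμ0 : μ ≠ 0 := norm_pos_iff.1 (by linarith)
  have hμe : ‖μ‖ₑ ≤ 2 := by
    rw [← ofReal_norm]; simpa using ENNReal.ofReal_le_ofReal hμ2
  rw [lintegral_monomialMeasure N a ρ hF, lintegral_monomialMeasure N a ρ (F := fun s => F (μ ^ N i * s))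
    (by fun_prop), ← lintegral_indicator measurableSet_ball, ← lintegral_indicator measurableSet_ball,
    ← lintegral_update_const_mul i hμ0 (Measurable.indicator (by fun_prop) measurableSet_ball),
    mul_assoc]
  refine mul_le_mul' (by gcongr) ?_
  rw [← lintegral_const_mul' _ _ (by simp)]
  refine lintegral_mono fun y => ?_
  by_cases hy : Function.update y i (μ * y i) ∈ Metric.ball (0 : Fin n → ℂ) ρ
  · rw [Set.indicator_of_mem hy, Set.indicator_of_mem (mem_ball_of_update_mul hμ1 hρ hy),
      monom_update_mul, monom_update_mul, enorm_mul, mul_pow, mul_left_comm]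
    gcongr
    rw [enorm_pow]; gcongr
  · rw [Set.indicator_of_notMem hy]; exact zero_le

theorem ae_monom_ne_zero {n : ℕ} (a : Fin n → ℕ) : ∀ᵐ y : Fin n → ℂ, monom a y ≠ 0 := by
  filter_upwards [ae_all_iff.2 fun i => ae_eval_ne_zero (n := n) i] with y hy
  exact monom_ne_zero fun i _ => hy i

theorem lintegral_ball_prod_enorm_rpow_ne_top {n : ℕ} {ρ : ℝ} (hρ : 0 < ρ) {s : Fin n → ℝ}
    (hs : ∀ i, -2 < s i) : ∫⁻ y in Metric.ball (0 : Fin n → ℂ) ρ, ∏ i, ‖y i‖ₑ ^ s i ≠ ⊤ := by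
  have h1 : ∀ i, Integrable (fun z : ℂ => ‖z‖ ^ s i) (volume.restrict (Metric.ball (0 : ℂ) ρ)) := by
    intro i
    refine ⟨(by fun_prop : Measurable fun z : ℂ => ‖z‖ ^ s i).aestronglyMeasurable, ?_⟩
    rw [hasFiniteIntegral_iff_ofReal (ae_of_all _ fun z => Real.rpow_nonneg (norm_nonneg z) _),
      lt_top_iff_ne_top]
    convert! (lintegral_ball_enorm_rpow_ne_top_iff hρ (s i)).2 (hs i) using 1
    refine lintegral_congr_ae (ae_restrict_of_ae ?_)
    filter_upwards [Measure.ae_ne volume (0 : ℂ)] with z hz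
    exact (enorm_rpow_eq_ofReal hz _).symm
  have h2 := Integrable.fintype_prod h1
  rw [← Measure.restrict_pi_pi, ← volume_pi, show Set.univ.pi (fun _ : Fin n => Metric.ball (0 : ℂ) ρ) =
    Metric.ball 0 ρ from (ball_pi 0 hρ).symm] at h2
  have h3 := h2.2
  rw [hasFiniteIntegral_iff_ofReal (ae_of_all _ fun y =>
    Finset.prod_nonneg fun i _ => Real.rpow_nonneg (norm_nonneg _) _), lt_top_iff_ne_top] at h3
  convert! h3 using 1
  refine lintegral_congr_ae (ae_restrict_of_ae ?_)
  filter_upwards [ae_all_iff.2 fun i => ae_eval_ne_zero (n := n) i] with y hy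
  rw [ENNReal.ofReal_prod_of_nonneg fun i _ => Real.rpow_nonneg (norm_nonneg _) _]
  exact Finset.prod_congr rfl fun i _ => enorm_rpow_eq_ofReal (hy i) _

theorem hasExponent_monomialMeasure {n : ℕ} {N : Fin n → ℕ} (a : Fin n → ℕ) {ρ : ℝ} (hρ : 0 < ρ)
    {i : Fin n} (hi : N i ≠ 0) : ∃ c, HasExponent (monomialMeasure N a ρ) c := by
  have hN := measurable_monom N
  have ha := measurable_monom a
  obtain ⟨l, hl, hmin⟩ := (Finset.univ.filter fun j => N j ≠ 0).exists_min_image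
    (fun j => ((a j : ℝ) + 1) / N j) ⟨i, by simpa using hi⟩
  have hl0 : N l ≠ 0 := by simpa using hl
  have hlpos : (0 : ℝ) < N l := by exact_mod_cast Nat.pos_of_ne_zero hl0
  have hball : ∀ t : ℝ, monomialMeasure N a ρ (Metric.ball 0 t) = ∫⁻ y in Metric.ball 0 ρ,
      (Metric.ball (0 : ℂ) t).indicator 1 (monom N y) * ‖monom a y‖ₑ ^ 2 := fun t => by
    rw [← lintegral_monomialMeasure N a ρ (measurable_one.indicator measurableSet_ball),
      lintegral_indicator_one measurableSet_ball]
  have hfm : ∀ t : ℝ, Measurable fun y =>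
      (Metric.ball (0 : ℂ) t).indicator (1 : ℂ → ENNReal) (monom N y) * ‖monom a y‖ₑ ^ 2 := fun t =>
    ((measurable_one.indicator measurableSet_ball).comp hN).mul (by fun_prop)
  refine ⟨((a l : ℝ) + 1) / N l, by positivity, ⟨monomialMeasure N a ρ (Metric.ball 0 1), ?_, ?_⟩, ?_⟩
  · intro h0
    rw [hball, ← lintegral_indicator measurableSet_ball, lintegral_eq_zero_iff
      ((hfm 1).indicator measurableSet_ball)] at h0
    have hopen : IsOpen (Metric.ball (0 : Fin n → ℂ) ρ ∩ monom N ⁻¹' Metric.ball 0 1) :=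
      Metric.isOpen_ball.inter (Metric.isOpen_ball.preimage (contDiff_monom N).continuous)
    have hpos := hopen.measure_pos volume ⟨0, Metric.mem_ball_self hρ, by
      rw [Set.mem_preimage, monom_eq_zero hl0 rfl]; exact Metric.mem_ball_self one_pos⟩
    refine hpos.ne' (measure_eq_zero_iff_ae_notMem.2 ?_)
    filter_upwards [h0, ae_monom_ne_zero a] with y hy hya hyB
    rw [Set.indicator_of_mem hyB.1, Set.indicator_of_mem (show monom N y ∈ Metric.ball (0 : ℂ) 1 from hyB.2)] at hy
    simp [hya] at hy
  · intro t ht0 ht1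
    set μ : ℝ := t ^ ((N l : ℝ)⁻¹) with hμ
    have hμ0 : 0 < μ := Real.rpow_pos_of_pos ht0 _
    have hμ1 : μ ≤ 1 := Real.rpow_le_one ht0.le ht1 (by positivity)
    have hμN : μ ^ N l = t := Real.rpow_inv_natCast_pow ht0.le hl0
    have hμn : ‖(μ : ℂ)‖ = μ := by rw [Complex.norm_real, Real.norm_of_nonneg hμ0.le]
    have hμa : ENNReal.ofReal (t ^ (2 * (((a l : ℝ) + 1) / N l))) = ‖(μ : ℂ)‖ₑ ^ 2 * (‖(μ : ℂ)‖ₑ ^ a l) ^ 2 := by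
      rw [← ofReal_norm, hμn, ← ENNReal.ofReal_pow hμ0.le, ← ENNReal.ofReal_pow hμ0.le,
        ← ENNReal.ofReal_pow (by positivity), ← ENNReal.ofReal_mul (by positivity)]
      congr 1
      rw [← pow_mul, ← pow_add, hμ, ← Real.rpow_natCast, ← Real.rpow_mul ht0.le]
      congr 1
      push_cast
      field_simp
      ring
    rw [hμa, hball, hball, ← lintegral_indicator measurableSet_ball, ← lintegral_indicator measurableSet_ball,
      ← lintegral_update_const_mul l (Complex.ofReal_ne_zero.2 hμ0.ne') 
        ((hfm t).indicator measurableSet_ball),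
      mul_left_comm, mul_comm _ ((‖(μ : ℂ)‖ₑ ^ a l) ^ 2)]
    refine mul_le_mul' le_rfl ?_
    rw [← lintegral_const_mul' _ _ (by simp)]
    refine lintegral_mono fun y => ?_
    by_cases hy : y ∈ Metric.ball (0 : Fin n → ℂ) ρ
    · rw [Set.indicator_of_mem hy, Set.indicator_of_mem (update_mul_mem_ball (by rw [hμn]; exact hμ1) hρ hy),
        monom_update_mul, monom_update_mul, enorm_mul, mul_pow, mul_left_comm, enorm_pow]
      gcongr
      by_cases hs : monom N y ∈ Metric.ball (0 : ℂ) 1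
      · rw [Set.indicator_of_mem (show (μ : ℂ) ^ N l * monom N y ∈ Metric.ball (0 : ℂ) t from ?_)]
        · exact Set.indicator_le_self _ _ _
        · rw [mem_ball_zero_iff] at hs ⊢
          rw [norm_mul, norm_pow, hμn, hμN]
          exact mul_lt_of_lt_one_right ht0 hs
      · rw [Set.indicator_of_notMem hs]; exact zero_le
    · rw [Set.indicator_of_notMem hy]; simp
  · intro α hα0 hα
    rw [lintegral_monomialMeasure N a ρ (by fun_prop)]
    have hs : ∀ j, (-2 : ℝ) < N j * (-(2 * α)) + a j * 2 := by
      intro j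
      rcases eq_or_ne (N j) 0 with h0 | h0
      · have : (0 : ℝ) ≤ a j := Nat.cast_nonneg _
        rw [h0]; push_cast; linarith
      · have h1 := hα.trans_le (hmin j (by simpa using h0))
        rw [lt_div_iff₀ (by exact_mod_cast Nat.pos_of_ne_zero h0)] at h1
        linarith
    convert! lintegral_ball_prod_enorm_rpow_ne_top hρ hs using 1
    refine lintegral_congr_ae (ae_restrict_of_ae ?_)
    filter_upwards [ae_all_iff.2 fun i => ae_eval_ne_zero (n := n) i] with y hy
    have hen : ∀ N : Fin n → ℕ, ‖monom N y‖ₑ = ∏ j, ‖y j‖ₑ ^ N j := fun N => by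
      simp only [monom, enorm, nnnorm_prod, nnnorm_pow, ENNReal.ofNNReal_finsetProd, ENNReal.coe_pow]
    rw [hen, hen, ← ENNReal.prod_rpow_of_ne_top (fun j _ => by simp), ← Finset.prod_pow, ← Finset.prod_mul_distrib]
    refine Finset.prod_congr rfl fun j _ => ?_
    have hj : ‖y j‖ₑ ≠ 0 := by simpa using hy j
    rw [ENNReal.rpow_add _ _ hj (by simp), ENNReal.rpow_mul, ENNReal.rpow_mul]
    simp

theorem regularAt_monom {n : ℕ} {N : Fin n → ℕ} (a : Fin n → ℕ) {i : Fin n} (hi : N i ≠ 0) :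
    RegularAt (monom N) (fun y => ‖monom a y‖ₑ ^ 2) 0 := by
  intro V' hV'
  obtain ⟨ρ, hρ, hρV⟩ := Metric.mem_nhds_iff.1 hV'
  refine ⟨Metric.ball 0 ρ, Metric.ball_mem_nhds 0 hρ, 1, one_pos, monomialMeasure N a ρ,
    ⟨dilationBound_monomialMeasure a hρ hi, Or.inr (hasExponent_monomialMeasure a hρ hi)⟩, 1, by simp,
    fun F hF => ⟨fun _ => (lintegral_monomialMeasure N a ρ hF).ge, ?_⟩⟩
  rw [lintegral_monomialMeasure N a ρ hF, one_mul]
  exact lintegral_mono_set hρV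

theorem RegularAt.congr_unit {n : ℕ} {f f' J J' v : (Fin n → ℂ) → ℂ} {p : Fin n → ℂ}
    (h : RegularAt f (fun y => ‖J y‖ₑ ^ 2) p) (hf : ∀ᶠ y in 𝓝 p, f' y = f y)
    (hv : ContinuousAt v p) (hv0 : v p ≠ 0) (hJ : ∀ᶠ y in 𝓝 p, J' y = v y * J y) :
    RegularAt f' (fun y => ‖J' y‖ₑ ^ 2) p := by
  have hpos : 0 < ‖v p‖ := norm_pos_iff.2 hv0
  have h1 : ∀ᶠ y in 𝓝 p, ‖v y‖ < 2 * ‖v p‖ := hv.norm.eventually (gt_mem_nhds (by linarith))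
  have h2 : ∀ᶠ y in 𝓝 p, ‖v p‖ / 2 < ‖v y‖ := hv.norm.eventually (lt_mem_nhds (by linarith))
  have hn : ENNReal.ofReal (‖v p‖ / 2) ≠ 0 := by simpa using hpos
  refine h.congr (b := ENNReal.ofReal (2 * ‖v p‖) ^ 2) (b' := (ENNReal.ofReal (‖v p‖ / 2))⁻¹ ^ 2) hf
    (by finiteness) (by simp [hpos]) ?_
  filter_upwards [hJ, h1, h2] with y hJ h1 h2
  rw [hJ, enorm_mul, mul_pow]
  constructor
  · gcongr
    rw [← ofReal_norm]
    exact ENNReal.ofReal_le_ofReal h1.le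
  · rw [← mul_assoc, ← mul_pow]
    refine le_mul_of_one_le_left (by simp) (one_le_pow₀ ?_)
    rw [← ENNReal.inv_mul_cancel hn ENNReal.ofReal_ne_top, ← ofReal_norm]
    gcongr

theorem RegularAt.of_biholo {n : ℕ} {f : (Fin n → ℂ) → ℂ} {w : (Fin n → ℂ) → ENNReal}
    {φ ψ : (Fin n → ℂ) → (Fin n → ℂ)} {q : Fin n → ℂ} (hφ : ContDiffAt ℂ 1 φ q)
    (hψ : ContDiffAt ℂ 1 ψ (φ q)) (hψφ : ∀ᶠ y in 𝓝 q, ψ (φ y) = y)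
    (h : RegularAt (fun y => f (φ y)) (fun y => w (φ y)) q) : RegularAt f w (φ q) :=
  RegularAt.biholo (hφ.restrict_scalars ℝ) (hψ.restrict_scalars ℝ) hψφ h

/-- Rescaling one coordinate by a unit has a local inverse at the origin. -/
theorem exists_inverse_update_mul {n : ℕ} (i : Fin n) {u : (Fin n → ℂ) → ℂ} (hu : ContDiffAt ℂ 1 u 0)
    (hu0 : u 0 ≠ 0) : ∃ ψ : (Fin n → ℂ) → (Fin n → ℂ), ContDiffAt ℂ 1 ψ 0 ∧ ψ 0 = 0 ∧
      (∀ᶠ y in 𝓝 0, ψ (Function.update y i (u y * y i)) = y) ∧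
      ∀ᶠ y in 𝓝 0, Function.update (ψ y) i (u (ψ y) * ψ y i) = y := by
  set Φ : (Fin n → ℂ) → (Fin n → ℂ) := fun y => Function.update y i (u y * y i) with hΦ
  have hΦ0 : Φ 0 = 0 := by simp [hΦ]
  have hcoord : ∀ j, ContDiffAt ℂ 1 (fun y => Φ y j) 0 := fun j => by
    by_cases h : j = i
    · subst h
      simp only [hΦ, Function.update_self]
      exact hu.mul (contDiff_coord j).contDiffAt
    · simp only [hΦ, Function.update_of_ne h]
      exact (contDiff_coord j).contDiffAt
  have hΦc : ContDiffAt ℂ 1 Φ 0 := contDiffAt_pi.2 hcoord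
  have hD := (hΦc.differentiableAt (by simp)).hasFDerivAt
  set D := fderiv ℂ Φ 0 with hDdef
  have hDi : ∀ v, D v i = u 0 * v i := by
    intro v
    have h1 := hasFDerivAt_pi'.1 hD i
    have h2 : (fun y => Φ y i) = fun y => u y * y i := by funext y; simp [hΦ]
    rw [h2] at h1
    have h3 := (hu.differentiableAt (by simp)).hasFDerivAt.mul
      ((ContinuousLinearMap.proj (R := ℂ) (φ := fun _ : Fin n => ℂ) i).hasFDerivAt (x := 0))
    have := congrArg (fun L => L v) (h1.unique h3)
    simpa using this
  have hDj : ∀ v j, j ≠ i → D v j = v j := by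
    intro v j hj
    have h1 := hasFDerivAt_pi'.1 hD j
    have h2 : (fun y => Φ y j) = fun y => y j := by funext y; simp [hΦ, hj]
    rw [h2] at h1
    have h3 := h1.unique (ContinuousLinearMap.proj (R := ℂ) (φ := fun _ : Fin n => ℂ) j).hasFDerivAt
    have := congrArg (fun L => L v) h3
    simpa using this
  have hinj : Function.Injective D := by
    rw [injective_iff_map_eq_zero]
    intro v hv
    ext j
    by_cases hj : j = i
    · subst hj
      have := hDi v
      rw [hv] at this
      simpa [hu0] using this.symm
    · rw [← hDj v j hj, hv]
  let D' : (Fin n → ℂ) ≃L[ℂ] (Fin n → ℂ) :=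
    (LinearEquiv.ofInjectiveEndo D.toLinearMap hinj).toContinuousLinearEquiv
  have hD' : HasFDerivAt Φ (D' : (Fin n → ℂ) →L[ℂ] (Fin n → ℂ)) 0 := by
    have e : (D' : (Fin n → ℂ) →L[ℂ] (Fin n → ℂ)) = D := by ext v; rfl
    rw [e]; exact hD
  have hstr := hΦc.hasStrictFDerivAt' hD' (by simp)
  have hinv := hΦc.to_localInverse hD' (by simp)
  have hright := hstr.eventually_right_inverse
  have hleft := hstr.eventually_left_inverse
  have happ : hΦc.localInverse hD' (by simp) (Φ 0) = 0 := hstr.localInverse_apply_image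
  rw [hΦ0] at hinv hright happ
  exact ⟨hΦc.localInverse hD' (by simp), hinv, happ, hleft, hright⟩

theorem RegularAt.of_monomialGerm {n : ℕ} {N a : Fin n → ℕ} {f J : (Fin n → ℂ) → ℂ}
    (hf : MonomialGerm N f) (hJ : MonomialGerm a J) : RegularAt f (fun y => ‖J y‖ₑ ^ 2) 0 := by
  obtain ⟨e, he, he0, hfe⟩ := hf
  obtain ⟨e', he', he'0, hJe⟩ := hJ
  by_cases hN : ∀ i, N i = 0
  · have hN' : N = 0 := funext hN
    subst hN'
    refine RegularAt.of_ne (he.continuousAt.congr ?_) ?_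
    · filter_upwards [hfe] with y hy; rw [hy, monom_zero, one_mul]
    · rw [hfe.self_of_nhds, monom_zero, one_mul]; exact he0
  push Not at hN
  obtain ⟨i, hi⟩ := hN
  set u : (Fin n → ℂ) → ℂ := fun y => (e 0) ^ ((N i : ℂ)⁻¹) * (e y / e 0) ^ ((N i : ℂ)⁻¹) with hu
  have huN : ∀ y, u y ^ N i = e y := fun y => by
    simp only [hu]
    rw [mul_pow, Complex.cpow_nat_inv_pow _ hi, Complex.cpow_nat_inv_pow _ hi, mul_div_cancel₀ _ he0]
  have huc : ContDiffAt ℂ 1 u 0 := by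
    refine contDiffAt_const.mul ?_
    have h1 : ContDiffAt ℂ 1 (fun z : ℂ => z ^ ((N i : ℂ)⁻¹)) ((fun y => e y / e 0) 0) := by
      have : AnalyticAt ℂ (fun z : ℂ => z ^ ((N i : ℂ)⁻¹)) ((fun y => e y / e 0) 0) :=
        analyticAt_id.cpow analyticAt_const (by simp [he0])
      exact this.contDiffAt
    exact h1.comp (0 : Fin n → ℂ) (he.div_const (e 0))
  have hu0 : u 0 ≠ 0 := fun h => he0 (by rw [← huN 0, h, zero_pow hi])
  obtain ⟨ψ, hψ, hψ0, hl, hr⟩ := exists_inverse_update_mul i huc hu0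
  have hψt : Tendsto ψ (𝓝 0) (𝓝 0) := by simpa [ContinuousAt, hψ0] using hψ.continuousAt
  have hkey : ∀ (M : Fin n → ℕ) (y : Fin n → ℂ), Function.update (ψ y) i (u (ψ y) * ψ y i) = y →
      monom M y = u (ψ y) ^ M i * monom M (ψ y) := fun M y h => by
    conv_lhs => rw [← h]
    rw [monom_update_mul]
  have huψ : ContinuousAt (fun y => u (ψ y)) 0 := by
    refine ContinuousAt.comp (g := u) ?_ hψ.continuousAt
    rw [hψ0]; exact huc.continuousAt
  have he'ψ : ContinuousAt (fun y => e' (ψ y)) 0 := by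
    refine ContinuousAt.comp (g := e') ?_ hψ.continuousAt
    rw [hψ0]; exact he'.continuousAt
  have h0 : (fun y => u (ψ y)) 0 ≠ 0 := by simpa [hψ0] using hu0
  have hΦc : ContDiffAt ℂ 1 (fun y : Fin n → ℂ => Function.update y i (u y * y i)) (ψ 0) := by
    rw [hψ0]
    refine contDiffAt_pi.2 fun j => ?_
    by_cases h : j = i
    · subst h
      simp only [Function.update_self]
      exact huc.mul (contDiff_coord j).contDiffAt
    · simp only [Function.update_of_ne h]
      exact (contDiff_coord j).contDiffAt
  rw [← hψ0]
  refine RegularAt.of_biholo (f := f) (w := fun y => ‖J y‖ₑ ^ 2) hψ hΦc hr ?_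
  refine (regularAt_monom a hi).congr_unit (J' := fun y => J (ψ y))
    (v := fun y => e' (ψ y) / u (ψ y) ^ a i) ?_ (he'ψ.div (huψ.pow _) (pow_ne_zero _ h0)) ?_ ?_
  · filter_upwards [hr, hψt.eventually hfe] with y h1 h2
    rw [h2, hkey N y h1, huN, mul_comm]
  · refine div_ne_zero ?_ (pow_ne_zero _ h0)
    rw [hψ0]; exact he'0
  · filter_upwards [hr, hψt.eventually hJe, huψ.eventually_ne h0] with y h1 h2 h3
    rw [h2, hkey a y h1]
    field_simp

theorem exists_measurable_eventuallyEq {n : ℕ} {f : (Fin n → ℂ) → ℂ} {p : Fin n → ℂ}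
    (hf : ContDiffAt ℂ 1 f p) : ∃ g : (Fin n → ℂ) → ℂ, Measurable g ∧ ∀ᶠ y in 𝓝 p, g y = f y := by
  classical
  obtain ⟨B, hB, hBo, hp⟩ := eventually_nhds_iff.1 (hf.eventually (by simp))
  refine ⟨B.piecewise f 0, ContinuousOn.measurable_piecewise
    (fun y hy => (hB y hy).continuousAt.continuousWithinAt) continuousOn_const hBo.measurableSet, ?_⟩
  filter_upwards [hBo.mem_nhds hp] with y hy
  exact Set.piecewise_eq_of_mem B f 0 hy

theorem isCompact_inter_preimage_closedBall {n : ℕ} {i : Fin n} {R : ℝ} {σ : (Fin n → ℂ) → (Fin n → ℂ)}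
    (hσ : Continuous σ) {K : Set (Fin n → ℂ)} (hK : IsClosed K) (hi : ∀ y ∈ K, ‖σ y‖ ≤ 1 → ‖y i‖ ≤ R)
    (hj : ∀ y j, j ≠ i → σ y j = y j) : IsCompact (K ∩ σ ⁻¹' Metric.closedBall 0 1) := by
  refine Metric.isCompact_of_isClosed_isBounded
    (hK.inter (Metric.isClosed_closedBall.preimage hσ)) ?_
  refine (Metric.isBounded_closedBall (x := (0 : Fin n → ℂ)) (r := max R 1)).subset fun y hy => ?_
  have hy2 : ‖σ y‖ ≤ 1 := mem_closedBall_zero_iff.1 hy.2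
  rw [mem_closedBall_zero_iff, pi_norm_le_iff_of_nonneg (zero_le_one.trans (le_max_right _ _))]
  intro j
  by_cases h : j = i
  · subst h; exact (hi y hy.1 hy2).trans (le_max_left _ _)
  · rw [← hj y j h]
    exact ((norm_le_pi_norm (σ y) j).trans hy2).trans (le_max_right _ _)

theorem RegularAt.of_power {n : ℕ} {f : (Fin n → ℂ) → ℂ} {w : (Fin n → ℂ) → ENNReal}
    (hf : Measurable f) (hw : Measurable w) (i : Fin n) {k : ℕ} (hk : 1 ≤ k)
    (h : RegularAt (fun y => f (Function.update y i (y i ^ k)))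
      (fun y => w (Function.update y i (y i ^ k)) * ‖y i ^ (k - 1)‖ₑ ^ 2) 0) : RegularAt f w 0 := by
  have hc : Continuous fun y : Fin n → ℂ => Function.update y i (y i ^ k) :=
    (contDiff_update_pow i k).continuous
  refine RegularAt.of_charts (ι := Unit) hf hw (σ := fun _ y => Function.update y i (y i ^ k))
    (ω := fun _ y => ‖y i ^ (k - 1)‖ₑ ^ 2) (S := fun _ => Set.univ) (K := fun _ => Set.univ)
    (b := (k : ENNReal) ^ 2) (b' := (Polynomial.nthRootsFinset k (1 : ℂ)).card)
    (fun _ => hc) (fun _ => by fun_prop) (fun _ => .univ) (fun x => ⟨(), trivial⟩)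
    (fun _ _ _ _ => trivial) (fun _ => isCompact_inter_preimage_closedBall (i := i) (R := 1) hc isClosed_univ
      (fun y _ hy => ?_) (fun y j hj => Function.update_of_ne hj _ _)) (by finiteness) (by simp)
    (fun _ Φ hΦ => lintegral_update_pow i hk hΦ) fun _ q _ hq => ?_
  · have := (norm_le_pi_norm (Function.update y i (y i ^ k)) i).trans hy
    rw [Function.update_self, norm_pow] at this
    exact (pow_le_one_iff_of_nonneg (norm_nonneg _) (by omega)).1 this
  · have hq0 : q = 0 := by
      ext j
      have := congrFun hq j
      by_cases hj : j = i
      · subst hj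
        simpa [show k ≠ 0 by omega] using this
      · simpa [hj] using this
    subst hq0; exact h

theorem RegularAt.of_blow {n : ℕ} {f : (Fin n → ℂ) → ℂ} {w : (Fin n → ℂ) → ENNReal}
    (hf : Measurable f) (hw : Measurable w) {a : Bool → Fin n} {R : Bool → ℝ}
    (ha : ∀ b, a b ≠ a (!b)) (hR : ∀ b, 0 < R b) (hRR : R true * R false = 1)
    (h : ∀ b (ζ : ℂ), ‖ζ‖ ≤ R b → RegularAt (fun y => f (Function.update y (a b) (y (a b) * y (a (!b)))))
      (fun y => w (Function.update y (a b) (y (a b) * y (a (!b)))) * ‖y (a (!b))‖ₑ ^ 2)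
      (Pi.single (a b) ζ)) : RegularAt f w 0 := by
  have hc : ∀ b, Continuous fun y : Fin n → ℂ => Function.update y (a b) (y (a b) * y (a (!b))) :=
    fun b => (contDiff_update_mul _ _ _).continuous
  refine RegularAt.of_charts (ι := Bool) hf hw
    (σ := fun b y => Function.update y (a b) (y (a b) * y (a (!b))))
    (ω := fun b y => ‖y (a (!b))‖ₑ ^ 2) (S := fun b => {x | ‖x (a b)‖ ≤ R b * ‖x (a (!b))‖})
    (K := fun b => {x | ‖x (a b)‖ ≤ R b}) (b := 1) (b' := 1)
    hc (fun _ => by fun_prop) (fun _ => measurableSet_le (by fun_prop) (by fun_prop)) (fun x => ?_)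
    (fun b y hy hy0 => ?_) (fun b => isCompact_inter_preimage_closedBall (i := a b) (R := R b) (hc b)
      (isClosed_le (by fun_prop) (by fun_prop)) (fun y hy _ => hy) (fun y j hj => Function.update_of_ne hj _ _))
    (by simp) (by simp) (fun b Φ hΦ => ?_) fun b q hqK hq => ?_
  · by_contra! hcon
    have h1 := hcon true
    have h2 := hcon false
    simp only [Set.mem_ofPred_eq, not_le, Bool.not_true, Bool.not_false] at h1 h2
    have h3 := mul_lt_mul_of_pos_left h2 (hR true)
    rw [← mul_assoc, hRR, one_mul] at h3
    exact lt_asymm h1 h3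
  · simp only [Set.mem_ofPred_eq, Function.update_self, Function.update_of_ne (ha b).symm, norm_mul] at hy ⊢
    have : 0 < ‖y (a (!b))‖ := by simpa using hy0
    exact le_of_mul_le_mul_right hy this
  · rw [lintegral_update_mul (ha b) hΦ]
    simp
  · have hq0 : q = Pi.single (a b) (q (a b)) := by
      ext j
      have := congrFun hq j
      by_cases hj : j = a b
      · subst hj; simp
      · simpa [hj] using this
    rw [hq0]
    exact h b _ hqK

theorem DvdGerm.congr {n : ℕ} {p : Fin n → ℂ} {f f' A : (Fin n → ℂ) → ℂ} (h : DvdGerm p f A)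
    (hf : ∀ᶠ y in 𝓝 p, f' y = f y) : DvdGerm p f' A := by
  obtain ⟨c, hc, h⟩ := h
  refine ⟨c, hc, ?_⟩
  filter_upwards [h, hf] with y h1 h2
  rw [h1, h2]

/-- One may assume that `f` and `J` are measurable when proving regularity. -/
theorem regularAt_of_measurable {n : ℕ} {A : (Fin n → ℂ) → ℂ} {p : Fin n → ℂ}
    (h : ∀ f J : (Fin n → ℂ) → ℂ, Measurable f → Measurable J → ContDiffAt ℂ 1 f p → ContDiffAt ℂ 1 J p →
      DvdGerm p (fun y => f y * J y) A → RegularAt f (fun y => ‖J y‖ₑ ^ 2) p)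
    {f J : (Fin n → ℂ) → ℂ} (hf : ContDiffAt ℂ 1 f p) (hJ : ContDiffAt ℂ 1 J p)
    (hd : DvdGerm p (fun y => f y * J y) A) : RegularAt f (fun y => ‖J y‖ₑ ^ 2) p := by
  obtain ⟨f', hf', hff⟩ := exists_measurable_eventuallyEq hf
  obtain ⟨J', hJ', hJJ⟩ := exists_measurable_eventuallyEq hJ
  refine (h f' J' hf' hJ' (hf.congr_of_eventuallyEq hff) (hJ.congr_of_eventuallyEq hJJ)
    (hd.congr ?_)).congr_unit (v := fun _ => 1) ?_ continuousAt_const one_ne_zero ?_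
  · filter_upwards [hff, hJJ] with y h1 h2
    rw [h1, h2]
  · filter_upwards [hff] with y h1
    exact h1.symm
  · filter_upwards [hJJ] with y h1
    rw [h1, one_mul]

theorem Resolvable.regularAt {n : ℕ} {A : (Fin n → ℂ) → ℂ} {p : Fin n → ℂ} (h : Resolvable A p) :
    ∀ f J : (Fin n → ℂ) → ℂ, ContDiffAt ℂ 1 f p → ContDiffAt ℂ 1 J p →
      DvdGerm p (fun y => f y * J y) A → RegularAt f (fun y => ‖J y‖ₑ ^ 2) p := by
  have lift : ∀ {f J : (Fin n → ℂ) → ℂ} {B : (Fin n → ℂ) → ℂ} {σ : (Fin n → ℂ) → (Fin n → ℂ)}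
      {δ : (Fin n → ℂ) → ℂ} {q r : Fin n → ℂ}, ContDiff ℂ 1 σ → ContDiff ℂ 1 δ → σ q = r →
      ContDiffAt ℂ 1 f r → ContDiffAt ℂ 1 J r → DvdGerm r (fun y => f y * J y) B →
      (∀ f J : (Fin n → ℂ) → ℂ, ContDiffAt ℂ 1 f q → ContDiffAt ℂ 1 J q →
        DvdGerm q (fun y => f y * J y) (fun y => B (σ y) * δ y) → RegularAt f (fun y => ‖J y‖ₑ ^ 2) q) →
      RegularAt (fun y => f (σ y)) (fun y => ‖J (σ y)‖ₑ ^ 2 * ‖δ y‖ₑ ^ 2) q := by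
    intro f J B σ δ q r hσ hδ hq hf hJ hd ih
    subst hq
    have := ih (fun y => f (σ y)) (fun y => J (σ y) * δ y) (hf.comp q hσ.contDiffAt)
      ((hJ.comp q hσ.contDiffAt).mul hδ.contDiffAt) (by
        have := hd.comp_mul (J := δ) hσ.contDiffAt
        simpa only [mul_assoc] using this)
    simpa only [enorm_mul, mul_pow] using this
  induction h with
  | mono A N hA =>
    intro f J hf hJ hd
    obtain ⟨c, hc, hd⟩ := hd
    have h1 : MonomialGerm N (fun y => f y * (J y * c y)) := by
      obtain ⟨e, he, he0, hAe⟩ := hA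
      refine ⟨e, he, he0, ?_⟩
      filter_upwards [hd, hAe] with y h1 h2
      rw [← h2, h1, mul_assoc]
    have h2 : MonomialGerm N (fun y => J y * (f y * c y)) := by
      convert! h1 using 2; ring
    obtain ⟨M, -, hM⟩ := MonomialGerm.of_mul hf (hJ.mul hc) h1
    obtain ⟨a, -, ha⟩ := MonomialGerm.of_mul hJ (hf.mul hc) h2
    exact RegularAt.of_monomialGerm hM ha
  | biholo A φ ψ q hφ hψ hψφ _ ih =>
    intro f J hf hJ hd
    exact RegularAt.of_biholo (w := fun y => ‖J y‖ₑ ^ 2) hφ hψ hψφ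
      (ih (fun y => f (φ y)) (fun y => J (φ y)) (hf.comp q hφ) (hJ.comp q hφ) (hd.comp hφ))
  | power A i k hk _ ih =>
    intro f J hf hJ hd
    refine regularAt_of_measurable (fun f J hfm hJm hf hJ hd => ?_) hf hJ hd
    refine RegularAt.of_power hfm (by fun_prop) i hk ?_
    exact lift (contDiff_update_pow i k) ((contDiff_coord i).pow (k - 1)) (update_pow_zero i hk) hf hJ hd ih
  | blow A i j R hij hR _ _ ih1 ih2 =>
    intro f J hf hJ hd
    refine regularAt_of_measurable (fun f J hfm hJm hf hJ hd => ?_) hf hJ hd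
    refine RegularAt.of_blow hfm (by fun_prop) (a := fun b => cond b i j) (R := fun b => cond b R R⁻¹)
      ?_ ?_ (mul_inv_cancel₀ hR.ne') ?_
    · rintro (_ | _)
      exacts [hij.symm, hij]
    · rintro (_ | _)
      exacts [inv_pos.2 hR, hR]
    · rintro (_ | _) ζ hζ
      · have := lift (contDiff_update_mul j i j) (contDiff_coord i) (update_mul_single_right hij ζ) hf hJ hd
          (ih2 ζ hζ)
        change RegularAt (fun y => f (Function.update y j (y j * y i)))
          (fun y => ‖J (Function.update y j (y j * y i))‖ₑ ^ 2 * ‖y i‖ₑ ^ 2) (Pi.single j ζ)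
        have e : ∀ y : Fin n → ℂ, y j * y i = y i * y j := fun y => mul_comm _ _
        simp only [e]
        exact this
      · exact lift (contDiff_update_mul i i j) (contDiff_coord j) (update_mul_single_left hij ζ) hf hJ hd
          (ih1 ζ hζ)

/-- Push-forwards of Lebesgue measure under holomorphic functions are regular. -/
theorem regularAt_one {n : ℕ} {f : (Fin n → ℂ) → ℂ} {p : Fin n → ℂ} (hf : ContDiffAt ℂ 1 f p)
    (h0 : ¬ ∀ᶠ y in 𝓝 p, f y = 0) : RegularAt f (fun _ => 1) p := by
  have := (allResolvable n f p hf h0).regularAt f (fun _ => 1) hf contDiffAt_const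
    ⟨fun _ => 1, contDiffAt_const, Eventually.of_forall fun y => by simp⟩
  simpa using this

theorem ENNReal.rpow_le_rpow_of_nonpos {x y : ENNReal} {z : ℝ} (hz : z ≤ 0) (h : x ≤ y) : y ^ z ≤ x ^ z := by
  rw [← neg_neg z, ENNReal.rpow_neg, ENNReal.rpow_neg x]
  exact ENNReal.inv_le_inv.2 (ENNReal.rpow_le_rpow h (by linarith))

theorem le_of_lintegral_enorm_rpow_ne_top {X : Type*} [MeasurableSpace X] {μ : Measure X} {g : X → ℂ}
    (hg : AEMeasurable g μ) {k : ENNReal} {t₀ α c : ℝ} (hk : k ≠ 0) (ht₀ : 0 < t₀)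
    (h : ∀ t, 0 < t → t ≤ t₀ → k * ENNReal.ofReal (t ^ (2 * c)) ≤ μ {y | ‖g y‖ < t}) (hα : 0 ≤ α)
    (hfin : ∫⁻ y, ‖g y‖ₑ ^ (-(2 * α)) ∂μ ≠ ⊤) : α ≤ c := by
  by_contra! hc
  set A := ∫⁻ y, ‖g y‖ₑ ^ (-(2 * α)) ∂μ
  have key : ∀ t, 0 < t → t ≤ t₀ → ENNReal.ofReal (t ^ (-(2 * (α - c)))) ≤ A / k := by
    intro t ht htt
    rw [ENNReal.le_div_iff_mul_le (Or.inl hk) (Or.inr hfin)]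
    calc ENNReal.ofReal (t ^ (-(2 * (α - c)))) * k
        = ENNReal.ofReal (t ^ (-(2 * α))) * (k * ENNReal.ofReal (t ^ (2 * c))) := by
          rw [mul_left_comm, ← ENNReal.ofReal_mul (by positivity), ← Real.rpow_add ht, mul_comm]
          congr 3; ring
      _ ≤ ENNReal.ofReal (t ^ (-(2 * α))) * μ {y | ‖g y‖ < t} := by gcongr; exact h t ht htt
      _ ≤ ENNReal.ofReal (t ^ (-(2 * α))) * μ {y | ENNReal.ofReal (t ^ (-(2 * α))) ≤ ‖g y‖ₑ ^ (-(2 * α))} := by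
          gcongr with y
          intro hy
          rw [← ENNReal.ofReal_rpow_of_pos ht]
          refine ENNReal.rpow_le_rpow_of_nonpos (by linarith) ?_
          rw [← ofReal_norm]
          exact ENNReal.ofReal_le_ofReal hy.le
      _ ≤ A := mul_meas_ge_le_lintegral₀ (hg.enorm.pow_const _) _
  have hAk : A / k ≠ ⊤ := ENNReal.div_ne_top hfin hk
  obtain ⟨u, hu1, hu2⟩ := (((tendsto_rpow_atTop (show 0 < 2 * (α - c) by linarith)).eventually_gt_atTop
    (A / k).toReal).and (eventually_ge_atTop (max 1 t₀⁻¹))).exists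
  have hu0 : 0 < u := lt_of_lt_of_le one_pos ((le_max_left _ _).trans hu2)
  have h1 := key u⁻¹ (inv_pos.2 hu0) (inv_le_of_inv_le₀ ht₀ ((le_max_right _ _).trans hu2))
  rw [Real.inv_rpow hu0.le, ← Real.rpow_neg hu0.le, neg_neg, ENNReal.ofReal_le_iff_le_toReal hAk] at h1
  linarith

/-- The function `‖f‖ ^ (-2 * α)` is locally integrable at `p`. -/
def LocInt {X : Type*} [TopologicalSpace X] [MeasureSpace X] (f : X → ℂ) (p : X) (α : ℝ) : Prop :=
  ∃ V ∈ 𝓝 p, ∫⁻ y in V, ‖f y‖ₑ ^ (-(2 * α)) ≠ ⊤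

section LocInt

variable {X : Type*} [TopologicalSpace X] [MeasureSpace X] {f : X → ℂ} {p : X} {α β : ℝ}

theorem LocInt.zero [IsLocallyFiniteMeasure (volume : Measure X)] : LocInt f p 0 := by
  obtain ⟨V, hV, hfin⟩ := Measure.finiteAt_nhds (volume : Measure X) p
  exact ⟨V, hV, by simpa using hfin.ne⟩

theorem LocInt.mono [OpensMeasurableSpace X] (h : LocInt f p α) (hβ : β ≤ α) (hfm : Measurable f) (hf : ContinuousAt f p)
    (h0 : f p = 0) : LocInt f p β := by
  obtain ⟨V, hV, hfin⟩ := h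
  have h1 : ∀ᶠ y in 𝓝 p, ‖f y‖ < 1 := hf.norm.eventually (gt_mem_nhds (by simp [h0]))
  refine ⟨V ∩ {y | ‖f y‖ < 1}, inter_mem hV h1, ne_top_of_le_ne_top hfin ?_⟩
  calc ∫⁻ y in V ∩ {y | ‖f y‖ < 1}, ‖f y‖ₑ ^ (-(2 * β))
      ≤ ∫⁻ y in V ∩ {y | ‖f y‖ < 1}, ‖f y‖ₑ ^ (-(2 * α)) := by
        refine lintegral_mono_ae (ae_restrict_of_ae_restrict_of_subset Set.inter_subset_right ?_)
        filter_upwards [ae_restrict_mem (measurableSet_lt hfm.norm measurable_const)] with y hy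
        refine ENNReal.rpow_le_rpow_of_exponent_ge ?_ (by linarith)
        rw [← ofReal_norm]
        exact ENNReal.ofReal_le_one.2 (le_of_lt hy)
    _ ≤ _ := lintegral_mono_set Set.inter_subset_left

theorem LocInt.exists_null [OpensMeasurableSpace X] (h : LocInt f p α) (hα : 0 < α) (hfm : Measurable f) :
    ∃ V ∈ 𝓝 p, ∀ᵐ y ∂volume.restrict V, f y ≠ 0 := by
  obtain ⟨V, hV, hfin⟩ := h
  refine ⟨V, hV, ?_⟩
  filter_upwards [ae_lt_top (hfm.enorm.pow_const _) hfin] with y hy h0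
  rw [h0, enorm_zero, ENNReal.zero_rpow_of_neg (by linarith)] at hy
  exact lt_irrefl _ hy

end LocInt

theorem multCond_one_iff {X : Type*} [NormedAddCommGroup X] [NormedSpace ℂ X] [MeasureSpace X]
    [OpensMeasurableSpace X] {f f' : X → ℂ} {U : Set X} {p : X} {α α₀ : ℝ} (hU : IsOpen U) (hp : p ∈ U)
    (hfm : Measurable f') (hf : ∀ y ∈ U, f' y = f y) (hα₀ : 0 < α₀) (h₀ : LocInt f' p α₀) :
    MultCond f U (fun _ => 1) p α ↔ LocInt f' p α := by
  obtain ⟨V₀, hV₀, hnull⟩ := h₀.exists_null hα₀ hfm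
  have hint : ∀ y ∈ U, f' y ≠ 0 → ‖‖(1 : ℂ)‖ ^ 2 / ‖f y‖ ^ (2 * α)‖ₑ = ‖f' y‖ₑ ^ (-(2 * α)) := by
    intro y hy hy0
    rw [enorm_rpow_eq_ofReal hy0, ← hf y hy, Real.rpow_neg (norm_nonneg _), Real.enorm_of_nonneg (by positivity)]
    simp
  constructor
  · rintro ⟨V, hVo, hpV, hVU, -, hV⟩
    refine ⟨V ∩ V₀, inter_mem (hVo.mem_nhds hpV) hV₀, ?_⟩
    have h1 := (hV.mono_set (Set.inter_subset_left (t := V₀))).2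
    rw [hasFiniteIntegral_iff_enorm] at h1
    convert! h1.ne using 1
    refine lintegral_congr_ae ?_
    filter_upwards [ae_restrict_of_ae_restrict_of_subset Set.inter_subset_right hnull,
      ae_restrict_of_ae_restrict_of_subset Set.inter_subset_left (ae_restrict_mem hVo.measurableSet)] with y h0 hy
    exact (hint y (hVU hy) h0).symm
  · rintro ⟨V, hV, hfin⟩
    have hW : V ∩ V₀ ∩ U ∈ 𝓝 p := inter_mem (inter_mem hV hV₀) (hU.mem_nhds hp)
    have hsub : interior (V ∩ V₀ ∩ U) ⊆ V ∩ V₀ ∩ U := interior_subset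
    have hae : (fun y => ‖‖(1 : ℂ)‖ ^ 2 / ‖f y‖ ^ (2 * α)‖ₑ) =ᵐ[volume.restrict (interior (V ∩ V₀ ∩ U))]
        fun y => ‖f' y‖ₑ ^ (-(2 * α)) := by
      filter_upwards [ae_restrict_of_ae_restrict_of_subset (fun y hy => (hsub hy).1.2) hnull,
        ae_restrict_mem isOpen_interior.measurableSet] with y h0 hy
      exact hint y (hsub hy).2 h0
    refine ⟨interior (V ∩ V₀ ∩ U), isOpen_interior, mem_interior_iff_mem_nhds.2 hW, fun y hy => (hsub hy).2,
      differentiableOn_const _, ?_, ?_⟩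
    · refine AEStronglyMeasurable.congr (f := fun y => ‖(1 : ℂ)‖ ^ 2 / ‖f' y‖ ^ (2 * α))
        (Measurable.aestronglyMeasurable (by fun_prop)) ?_
      filter_upwards [ae_restrict_mem isOpen_interior.measurableSet] with y hy
      rw [hf y (hsub hy).2]
    · rw [hasFiniteIntegral_iff_enorm, lintegral_congr_ae hae]
      exact (lintegral_mono_set fun y hy => (hsub hy).1.1).trans_lt hfin.lt_top

theorem lct_eq_sSup_locInt {X : Type*} [NormedAddCommGroup X] [NormedSpace ℂ X] [MeasureSpace X]
    [OpensMeasurableSpace X] {f f' : X → ℂ} {U : Set X} {p : X} {α₀ : ℝ} (hU : IsOpen U) (hp : p ∈ U)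
    (hfm : Measurable f') (hf : ∀ y ∈ U, f' y = f y) (hα₀ : 0 < α₀) (h₀ : LocInt f' p α₀) :
    Lct f U p = sSup {α | 0 ≤ α ∧ LocInt f' p α} := by
  simp only [Lct, multCond_one_iff hU hp hfm hf hα₀ h₀]

theorem bddAbove_locInt {n : ℕ} (hn : 1 ≤ n) {f : (Fin n → ℂ) → ℂ} {p : Fin n → ℂ} (hfm : Measurable f)
    (hf : ContDiffAt ℂ 1 f p) (h0 : f p = 0) : BddAbove {α | 0 ≤ α ∧ LocInt f p α} := by
  refine ⟨n, ?_⟩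
  rintro α ⟨hα, V, hV, hfin⟩
  obtain ⟨L, W, hW, hL⟩ := hf.exists_lipschitzOnWith
  obtain ⟨r, hr, hrV⟩ := Metric.mem_nhds_iff.1 (inter_mem hV hW)
  haveI : Nonempty (Fin n) := ⟨⟨0, hn⟩⟩
  set M : ℝ := L + 1
  have hM : 0 < M := by positivity
  refine le_of_lintegral_enorm_rpow_ne_top (μ := volume.restrict V) hfm.aemeasurable
    (k := ENNReal.ofReal (M⁻¹ ^ (2 * (n : ℝ))) * volume (Metric.ball (0 : Fin n → ℂ) 1)) (t₀ := M * r) ?_ (by positivity)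
    (fun t ht htr => ?_) hα hfin
  · refine mul_ne_zero ?_ (Metric.measure_ball_pos _ _ one_pos).ne'
    simpa using Real.rpow_pos_of_pos (inv_pos.2 hM) _
  · have hsub : Metric.ball p (M⁻¹ * t) ⊆ {y | ‖f y‖ < t} ∩ V := by
      have hle : M⁻¹ * t ≤ r := by rw [inv_mul_le_iff₀ hM]; exact htr
      intro y hy
      have hyVW := hrV (Metric.ball_subset_ball hle hy)
      refine ⟨?_, hyVW.1⟩
      have h1 := hL.dist_le_mul y hyVW.2 p (mem_of_mem_nhds hW)
      rw [h0, dist_zero_right] at h1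
      have h2 : dist y p < M⁻¹ * t := hy
      rw [lt_inv_mul_iff₀ hM] at h2
      have h3 : (L : ℝ) * dist y p ≤ M * dist y p := by gcongr; simp [M]
      exact (h1.trans h3).trans_lt h2
    calc _ = volume (Metric.ball p (M⁻¹ * t)) := by
          rw [Measure.addHaar_ball volume p (by positivity), mul_right_comm, ← ENNReal.ofReal_mul (by positivity),
            ← Real.mul_rpow (by positivity) ht.le, ← Real.rpow_natCast]
          congr 4
          simp [Module.finrank_pi_fintype, mul_comm]
      _ ≤ volume ({y | ‖f y‖ < t} ∩ V) := measure_mono hsub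
      _ = _ := (Measure.restrict_apply (measurableSet_lt hfm.norm measurable_const)).symm

/-- Two-sided control of the push-forward of Lebesgue measure under `f` near `p`. -/
theorem exists_pushforward_bounds {n : ℕ} (hn : 1 ≤ n) {f : (Fin n → ℂ) → ℂ} {p : Fin n → ℂ} (hfm : Measurable f)
    (hf : ContDiffAt ℂ 1 f p) (h0 : f p = 0) (hne : ¬ ∀ᶠ y in 𝓝 p, f y = 0) {V' : Set (Fin n → ℂ)}
    (hV' : V' ∈ 𝓝 p) :
    ∃ V ∈ 𝓝 p, ∃ m : Measure ℂ, ∃ c : ℝ, ∃ C : ENNReal, IsFiniteMeasure m ∧ DilationBound m ∧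
      HasExponent m c ∧ c ≤ sSup {α | 0 ≤ α ∧ LocInt f p α} ∧ C ≠ ⊤ ∧ ∀ F : ℂ → ENNReal, Measurable F →
        ∫⁻ y in V, F (f y) ≤ ∫⁻ s, F s ∂m ∧ ∫⁻ s, F s ∂m ≤ C * ∫⁻ y in V', F (f y) := by
  obtain ⟨W, hW, hWfin⟩ := Measure.finiteAt_nhds (volume : Measure (Fin n → ℂ)) p
  obtain ⟨V, hV, δ, hδ, m, ⟨hdil, hm⟩, C, hC, H⟩ := regularAt_one hf hne _ (inter_mem hV' hW)
  simp only [mul_one] at H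
  have hδV : ∀ᶠ y in 𝓝 p, ‖f y‖ < δ := hf.continuousAt.norm.eventually (gt_mem_nhds (by simpa [h0] using hδ))
  have H1 : ∀ F : ℂ → ENNReal, Measurable F → ∫⁻ y in V ∩ {y | ‖f y‖ < δ}, F (f y) ≤ ∫⁻ s, F s ∂m := by
    intro F hF
    have hS : MeasurableSet {y | ‖f y‖ < δ} := measurableSet_lt hfm.norm measurable_const
    calc ∫⁻ y in V ∩ {y | ‖f y‖ < δ}, F (f y)
        ≤ ∫⁻ y in V, (Metric.ball (0 : ℂ) δ).indicator F (f y) := by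
          rw [Set.inter_comm, ← Measure.restrict_restrict hS, ← lintegral_indicator hS]
          gcongr with y
          simp only [Set.indicator, Set.mem_ofPred_eq, mem_ball_zero_iff]
          exact le_rfl
      _ ≤ ∫⁻ s, (Metric.ball (0 : ℂ) δ).indicator F s ∂m := by
          refine (H _ (hF.indicator measurableSet_ball)).1 fun s hs => ?_
          rw [Set.indicator_of_notMem]
          simpa using hs
      _ ≤ _ := lintegral_mono (Set.indicator_le_self _ _)
  have hVm : V ∩ {y | ‖f y‖ < δ} ∈ 𝓝 p := inter_mem hV hδV
  have hm0 : m ≠ 0 := by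
    rintro rfl
    have := H1 (fun _ => 1) measurable_const
    simp only [lintegral_const, Measure.restrict_apply MeasurableSet.univ, Set.univ_inter, one_mul,
      Measure.coe_zero, Pi.zero_apply, nonpos_iff_eq_zero] at this
    exact (Measure.measure_pos_of_mem_nhds _ hVm).ne' this
  obtain ⟨c, hc⟩ := hm.resolve_left hm0
  have hbdd := bddAbove_locInt hn hfm hf h0
  refine ⟨_, hVm, m, c, C, ⟨?_⟩, hdil, hc, ?_, hC, fun F hF => ⟨H1 F hF, (H F hF).2.trans ?_⟩⟩
  · have := (H (fun _ => 1) measurable_const).2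
    simp only [lintegral_const, Measure.restrict_apply MeasurableSet.univ, Set.univ_inter, one_mul] at this
    exact this.trans_lt (ENNReal.mul_lt_top hC.lt_top ((measure_mono Set.inter_subset_right).trans_lt hWfin))
  · refine le_of_forall_lt_imp_le_of_dense fun α hα => ?_
    rcases le_total α 0 with h | h
    · exact h.trans (le_csSup hbdd ⟨le_rfl, LocInt.zero⟩)
    · exact le_csSup hbdd ⟨h, _, hVm, ne_top_of_le_ne_top (hc.2.2 α h hα)
        (H1 (fun s => ‖s‖ₑ ^ (-(2 * α))) (by fun_prop))⟩
  · gcongr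
    exact Set.inter_subset_left

theorem measure_singleton_zero {m : Measure ℂ} {c : ℝ} (h : HasExponent m c) : m {0} = 0 := by
  obtain ⟨hc, -, hfin⟩ := h
  have := ae_lt_top (by fun_prop) (hfin (c / 2) (by linarith) (by linarith))
  refine measure_mono_null (fun s hs => ?_) this
  rw [Set.mem_singleton_iff] at hs
  subst hs
  simp [ENNReal.zero_rpow_of_neg, hc]

/-- The closed annulus of radii `r` and `R`. -/
def annulus (r R : ℝ) : Set ℂ := {l | r ≤ ‖l‖ ∧ ‖l‖ ≤ R}

theorem measurableSet_annulus (r R : ℝ) : MeasurableSet (annulus r R) :=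
  (measurableSet_le measurable_const measurable_norm).inter (measurableSet_le measurable_norm measurable_const)

theorem volume_annulus_ne_top (r R : ℝ) : volume (annulus r R) ≠ ⊤ := by
  refine ne_top_of_le_ne_top (measure_closedBall_lt_top (x := (0 : ℂ)) (r := R)).ne (measure_mono ?_)
  intro l hl
  simpa using hl.2

theorem volume_annulus_ne_zero : volume (annulus 1 2) ≠ 0 := by
  refine (Measure.measure_pos_of_mem_nhds volume (x := (3 / 2 : ℂ)) ?_).ne'
  have h : ‖(3 / 2 : ℂ)‖ = 3 / 2 := by simp
  exact inter_mem (continuous_norm.continuousAt.eventually (le_mem_nhds (show _ by simp only [h]; norm_num)))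
    (continuous_norm.continuousAt.eventually (ge_mem_nhds (show _ by simp only [h]; norm_num)))

theorem DilationBound.le_average {m : Measure ℂ} [SFinite m] (h : DilationBound m) :
    ∃ K : ENNReal, K ≠ ⊤ ∧ ∀ F : ℂ → ENNReal, Measurable F →
      ∫⁻ s, F s ∂m ≤ K * ∫⁻ s, (∫⁻ l in annulus 1 2, F (l * s)) ∂m := by
  obtain ⟨K, hK, H⟩ := h
  refine ⟨(volume (annulus 1 2))⁻¹ * K, by simp [volume_annulus_ne_zero, hK, ENNReal.mul_eq_top], fun F hF => ?_⟩
  have h1 : volume (annulus 1 2) * ∫⁻ s, F s ∂m ≤ K * ∫⁻ s, (∫⁻ l in annulus 1 2, F (l * s)) ∂m := by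
    rw [lintegral_lintegral_swap (by fun_prop), ← lintegral_const_mul K (Measurable.lintegral_prod_right (by fun_prop)),
      mul_comm, ← setLIntegral_const]
    refine lintegral_mono_ae ((ae_restrict_mem (measurableSet_annulus 1 2)).mono fun l hl => ?_)
    simpa only [mul_comm l] using H l hl.1 hl.2 F hF
  calc ∫⁻ s, F s ∂m = (volume (annulus 1 2))⁻¹ * (volume (annulus 1 2) * ∫⁻ s, F s ∂m) := by
        rw [← mul_assoc, ENNReal.inv_mul_cancel volume_annulus_ne_zero (volume_annulus_ne_top 1 2), one_mul]
    _ ≤ _ := by rw [mul_assoc]; gcongr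

theorem DilationBound.average_le {m : Measure ℂ} [SFinite m] (h : DilationBound m) :
    ∃ K : ENNReal, K ≠ ⊤ ∧ ∀ F : ℂ → ENNReal, Measurable F →
      ∫⁻ s, (∫⁻ l in annulus (1 / 2) 1, F (l * s)) ∂m ≤ K * ∫⁻ s, F s ∂m := by
  obtain ⟨K, hK, H⟩ := h
  refine ⟨K * volume (annulus (1 / 2) 1), ENNReal.mul_ne_top hK (volume_annulus_ne_top _ _), fun F hF => ?_⟩
  rw [lintegral_lintegral_swap (by fun_prop), mul_right_comm, ← setLIntegral_const]
  refine lintegral_mono_ae ((ae_restrict_mem (measurableSet_annulus _ 1)).mono fun l hl => ?_)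
  have hl0 : 0 < ‖l‖ := lt_of_lt_of_le (by norm_num) hl.1
  have := H l⁻¹ (by rw [norm_inv]; exact (one_le_inv₀ hl0).2 hl.2)
    (by rw [norm_inv]; exact inv_le_of_inv_le₀ two_pos (by simpa using hl.1)) (fun s => F (l * s)) (by fun_prop)
  simpa only [mul_inv_cancel_left₀ (norm_pos_iff.1 hl0)] using this

/-- A uniform bound for averages of `‖l * a + b‖ ^ (-2 * α)` over an annulus. -/
theorem exists_annulus_bound {α₁ α₂ : ℝ} (h₁ : 0 < α₁) (h₂ : 0 < α₂) (h : α₁ + α₂ < 1) :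
    ∃ C : ENNReal, C ≠ ⊤ ∧ ∀ a b : ℂ, a ≠ 0 → b ≠ 0 →
      ∫⁻ l in annulus 1 2, ‖l * a + b‖ₑ ^ (-(2 * (α₁ + α₂))) ≤
        C * (‖a‖ₑ ^ (-(2 * α₁)) * ‖b‖ₑ ^ (-(2 * α₂))) := by
  set α := α₁ + α₂ with hα
  have hI := (lintegral_ball_enorm_rpow_ne_top_iff (r := 7) (by norm_num) (-(2 * α))).2 (by linarith)
  set I := ∫⁻ z in Metric.ball (0 : ℂ) 7, ‖z‖ₑ ^ (-(2 * α))
  set C : ENNReal := 2 ^ (2 * α₂) * volume (annulus 1 2) + 4 ^ (2 * α₂) * I with hC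
  have hCtop : C ≠ ⊤ := by
    have := volume_annulus_ne_top 1 2
    exact ENNReal.add_ne_top.2 ⟨ENNReal.mul_ne_top (by finiteness) this, ENNReal.mul_ne_top (by finiteness) hI⟩
  have key : ∀ w : ℂ, w ≠ 0 → ∫⁻ l in annulus 1 2, ‖l + w‖ₑ ^ (-(2 * α)) ≤ C * ‖w‖ₑ ^ (-(2 * α₂)) := by
    intro w hw
    have hmul : ∀ k : ENNReal, k ≠ 0 → k ≠ ⊤ → (k⁻¹ * ‖w‖ₑ) ^ (-(2 * α₂)) = k ^ (2 * α₂) * ‖w‖ₑ ^ (-(2 * α₂)) := by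
      intro k hk hk'
      rw [ENNReal.mul_rpow_of_ne_top (by simpa using hk) (by simp), ENNReal.inv_rpow, ENNReal.rpow_neg, inv_inv]
    rcases le_or_gt 4 ‖w‖ with hw4 | hw4
    · have h1 : ∀ l ∈ annulus 1 2, ‖l + w‖ₑ ^ (-(2 * α)) ≤ 2 ^ (2 * α₂) * ‖w‖ₑ ^ (-(2 * α₂)) := by
        intro l hl
        have h2 : ‖w‖ / 2 ≤ ‖l + w‖ := by
          have := norm_sub_le (l + w) l
          rw [add_sub_cancel_left] at this
          linarith [hl.2]
        have h3 : (1 : ENNReal) ≤ ‖l + w‖ₑ := by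
          rw [← ofReal_norm, ENNReal.one_le_ofReal]; linarith
        have h4 : (2 : ENNReal)⁻¹ * ‖w‖ₑ ≤ ‖l + w‖ₑ := by
          rw [← ofReal_norm, ← ofReal_norm, ← ENNReal.ofReal_ofNat 2, ← ENNReal.ofReal_inv_of_pos two_pos,
            ← ENNReal.ofReal_mul (by norm_num)]
          exact ENNReal.ofReal_le_ofReal (by linarith)
        calc ‖l + w‖ₑ ^ (-(2 * α)) ≤ ‖l + w‖ₑ ^ (-(2 * α₂)) :=
              ENNReal.rpow_le_rpow_of_exponent_le h3 (by linarith)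
          _ ≤ ((2 : ENNReal)⁻¹ * ‖w‖ₑ) ^ (-(2 * α₂)) := ENNReal.rpow_le_rpow_of_nonpos (by linarith) h4
          _ = _ := hmul 2 (by simp) (by simp)
      calc ∫⁻ l in annulus 1 2, ‖l + w‖ₑ ^ (-(2 * α))
          ≤ ∫⁻ l in annulus 1 2, 2 ^ (2 * α₂) * ‖w‖ₑ ^ (-(2 * α₂)) :=
            setLIntegral_mono' (measurableSet_annulus 1 2) h1
        _ = 2 ^ (2 * α₂) * volume (annulus 1 2) * ‖w‖ₑ ^ (-(2 * α₂)) := by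
            rw [setLIntegral_const, mul_right_comm]
        _ ≤ _ := by gcongr; exact le_self_add
    · have h1 : ∫⁻ l in annulus 1 2, ‖l + w‖ₑ ^ (-(2 * α)) ≤ I := by
        calc ∫⁻ l in annulus 1 2, ‖l + w‖ₑ ^ (-(2 * α))
            ≤ ∫⁻ l, (Metric.ball (0 : ℂ) 7).indicator (fun z => ‖z‖ₑ ^ (-(2 * α))) (l + w) := by
              rw [← lintegral_indicator (measurableSet_annulus 1 2)]
              refine lintegral_mono (Set.indicator_le fun l hl => ?_)
              rw [Set.indicator_of_mem]
              rw [mem_ball_zero_iff]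
              linarith [norm_add_le l w, hl.2]
          _ = I := by
              rw [lintegral_add_right_eq_self (fun z => (Metric.ball (0 : ℂ) 7).indicator (fun z => ‖z‖ₑ ^ (-(2 * α))) z) w,
                lintegral_indicator measurableSet_ball]
      have h2 : (1 : ENNReal) ≤ 4 ^ (2 * α₂) * ‖w‖ₑ ^ (-(2 * α₂)) := by
        rw [← hmul 4 (by simp) (by simp)]
        refine ENNReal.one_le_rpow_of_pos_of_le_one_of_neg ?_ ?_ (by linarith)
        · simpa [pos_iff_ne_zero] using hw
        · rw [mul_comm, ← div_eq_mul_inv]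
          refine ENNReal.div_le_of_le_mul ?_
          rw [one_mul, ← ofReal_norm, ← ENNReal.ofReal_ofNat 4]
          exact ENNReal.ofReal_le_ofReal hw4.le
      calc _ ≤ I * 1 := by rw [mul_one]; exact h1
        _ ≤ I * (4 ^ (2 * α₂) * ‖w‖ₑ ^ (-(2 * α₂))) := by gcongr
        _ = 4 ^ (2 * α₂) * I * ‖w‖ₑ ^ (-(2 * α₂)) := by ring
        _ ≤ _ := by gcongr; exact le_add_self
  refine ⟨C, hCtop, fun a b ha hb => ?_⟩
  have hw : b / a ≠ 0 := div_ne_zero hb ha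
  calc ∫⁻ l in annulus 1 2, ‖l * a + b‖ₑ ^ (-(2 * α))
      = ∫⁻ l in annulus 1 2, ‖a‖ₑ ^ (-(2 * α)) * ‖l + b / a‖ₑ ^ (-(2 * α)) := by
        congr 1 with l
        rw [← ENNReal.mul_rpow_of_ne_top (by simp) (by simp), ← enorm_mul,
          show a * (l + b / a) = l * a + b by field_simp]
    _ = ‖a‖ₑ ^ (-(2 * α)) * ∫⁻ l in annulus 1 2, ‖l + b / a‖ₑ ^ (-(2 * α)) :=
        lintegral_const_mul _ (by fun_prop)
    _ ≤ ‖a‖ₑ ^ (-(2 * α)) * (C * ‖b / a‖ₑ ^ (-(2 * α₂))) := by gcongr; exact key _ hw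
    _ = C * (‖a‖ₑ ^ (-(2 * α₁)) * ‖b‖ₑ ^ (-(2 * α₂))) := by
        rw [show -(2 * α) = -(2 * α₁) + -(2 * α₂) by rw [hα]; ring,
          ENNReal.rpow_add _ _ (by simpa using ha) (by simp)]
        have : ‖b‖ₑ ^ (-(2 * α₂)) = ‖b / a‖ₑ ^ (-(2 * α₂)) * ‖a‖ₑ ^ (-(2 * α₂)) := by
          rw [← ENNReal.mul_rpow_of_ne_top (by simp) (by simp), ← enorm_mul, div_mul_cancel₀ b ha]
        rw [this]
        ring

theorem HasExponent.ae_ne_zero {m : Measure ℂ} {c : ℝ} (h : HasExponent m c) : ∀ᵐ s ∂m, s ≠ 0 := by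
  have := measure_singleton_zero h
  rw [ae_iff]
  simpa using this

theorem exists_lintegral_add_bound {m : Measure ℂ} [IsFiniteMeasure m] {c α₁ α₂ : ℝ} (hm : DilationBound m)
    (hc : HasExponent m c) (h₁ : 0 < α₁) (h₂ : 0 < α₂) (h : α₁ + α₂ < 1)
    (hfin : ∫⁻ s, ‖s‖ₑ ^ (-(2 * α₁)) ∂m ≠ ⊤) :
    ∃ D : ENNReal, D ≠ ⊤ ∧ ∀ b : ℂ, b ≠ 0 →
      ∫⁻ s, ‖s + b‖ₑ ^ (-(2 * (α₁ + α₂))) ∂m ≤ D * ‖b‖ₑ ^ (-(2 * α₂)) := by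
  obtain ⟨K, hK, hKm⟩ := hm.le_average
  obtain ⟨C, hC, hCb⟩ := exists_annulus_bound h₁ h₂ h
  refine ⟨K * (C * ∫⁻ s, ‖s‖ₑ ^ (-(2 * α₁)) ∂m), by finiteness, fun b hb => ?_⟩
  calc ∫⁻ s, ‖s + b‖ₑ ^ (-(2 * (α₁ + α₂))) ∂m
      ≤ K * ∫⁻ s, (∫⁻ l in annulus 1 2, ‖l * s + b‖ₑ ^ (-(2 * (α₁ + α₂)))) ∂m :=
        hKm (fun s => ‖s + b‖ₑ ^ (-(2 * (α₁ + α₂)))) (by fun_prop)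
    _ ≤ K * ∫⁻ s, C * ‖b‖ₑ ^ (-(2 * α₂)) * ‖s‖ₑ ^ (-(2 * α₁)) ∂m := by
        refine mul_le_mul_right (lintegral_mono_ae (hc.ae_ne_zero.mono fun s hs => (hCb s b hs hb).trans_eq ?_)) K
        ring
    _ = _ := by
        rw [lintegral_const_mul _ (by fun_prop)]
        ring

/-- A small annulus around `0` has positive mass. -/
theorem exists_annulus_measure_ne_zero {m : Measure ℂ} {c : ℝ} (hm : DilationBound m) (hc : HasExponent m c) :
    ∃ r₀ > 0, ∀ r, 0 < r → r ≤ r₀ → m {s | r < ‖s‖ ∧ ‖s‖ < 2 * r} ≠ 0 := by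
  have h1 : ∃ k : ℕ, m {s | ((k : ℝ) + 1)⁻¹ < ‖s‖} ≠ 0 := by
    by_contra! h
    have h2 : m (⋃ k : ℕ, {s | ((k : ℝ) + 1)⁻¹ < ‖s‖}) = 0 := measure_iUnion_null h
    have h3 : m Set.univ = 0 := by
      refine measure_mono_null (fun s _ => ?_) (measure_union_null h2 (measure_singleton_zero hc))
      by_cases hs : s = 0
      · exact Or.inr hs
      · left
        obtain ⟨k, hk⟩ := exists_nat_one_div_lt (norm_pos_iff.2 hs)
        rw [one_div] at hk
        exact Set.mem_iUnion.2 ⟨k, hk⟩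
    obtain ⟨k, hk, hkt⟩ := hc.2.1
    have h4 := hkt 1 one_pos le_rfl
    rw [measure_mono_null (Set.subset_univ _) h3] at h4
    simp [hk] at h4
  obtain ⟨k, hk⟩ := h1
  refine ⟨((k : ℝ) + 1)⁻¹, by positivity, fun r hr hrk h0 => hk ?_⟩
  obtain ⟨K, hK, H⟩ := hm
  have hmeas : ∀ t : ℝ, MeasurableSet {s : ℂ | t < ‖s‖ ∧ ‖s‖ < 2 * t} := fun t =>
    (measurableSet_lt measurable_const measurable_norm).inter (measurableSet_lt measurable_norm measurable_const)
  have step : ∀ j : ℕ, m {s | (3 / 2 : ℝ) ^ j * r < ‖s‖ ∧ ‖s‖ < 2 * ((3 / 2 : ℝ) ^ j * r)} = 0 := by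
    intro j
    induction j with
    | zero => simpa using h0
    | succ j ih =>
      have hn : ‖(3 / 2 : ℂ)‖ = 3 / 2 := by simp
      have := H (3 / 2) (by rw [hn]; norm_num) (by rw [hn]; norm_num)
        ({s : ℂ | (3 / 2 : ℝ) ^ (j + 1) * r < ‖s‖ ∧ ‖s‖ < 2 * ((3 / 2 : ℝ) ^ (j + 1) * r)}.indicator 1)
        (measurable_one.indicator (hmeas _))
      rw [lintegral_indicator_one (hmeas _)] at this
      have h5 : ∀ s : ℂ, ({s : ℂ | (3 / 2 : ℝ) ^ (j + 1) * r < ‖s‖ ∧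
          ‖s‖ < 2 * ((3 / 2 : ℝ) ^ (j + 1) * r)}.indicator 1 (3 / 2 * s) : ENNReal) =
          {s : ℂ | (3 / 2 : ℝ) ^ j * r < ‖s‖ ∧ ‖s‖ < 2 * ((3 / 2 : ℝ) ^ j * r)}.indicator 1 s := by
        intro s
        simp only [Set.indicator, Set.mem_ofPred_eq, norm_mul, hn]
        congr 1
        rw [eq_iff_iff, pow_succ]
        constructor <;> rintro ⟨h6, h7⟩ <;> constructor <;> linarith
      simp only [h5] at this
      rw [lintegral_indicator_one (hmeas _), ih, mul_zero] at this
      exact le_antisymm this bot_le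
  refine measure_mono_null (fun s hs => ?_) (measure_iUnion_null step)
  have hx : 1 < ‖s‖ / r := by rw [one_lt_div hr]; exact hrk.trans_lt hs
  have hex : ∃ j : ℕ, ‖s‖ / r ≤ (3 / 2 : ℝ) ^ j := (pow_unbounded_of_one_lt _ (by norm_num)).imp fun _ => le_of_lt
  obtain ⟨i, hi⟩ : ∃ i, Nat.find hex = i + 1 := by
    refine Nat.exists_eq_succ_of_ne_zero fun h => ?_
    have := Nat.find_spec hex
    rw [h, pow_zero] at this
    linarith
  have hlow := Nat.find_min hex (m := i) (by omega)
  have hup := Nat.find_spec hex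
  rw [hi, div_le_iff₀ hr, pow_succ] at hup
  rw [not_le, lt_div_iff₀ hr] at hlow
  refine Set.mem_iUnion.2 ⟨i, hlow, ?_⟩
  have : 0 < (3 / 2 : ℝ) ^ i * r := by positivity
  linarith

theorem lintegral_annulus_eq_top {a b : ℂ} (h1 : ‖b‖ < ‖a‖) (h2 : ‖a‖ < 2 * ‖b‖) :
    ∫⁻ l in annulus (1 / 2) 1, ‖l * a + b‖ₑ ^ (-(2 : ℝ)) = ⊤ := by
  have ha : 0 < ‖a‖ := (norm_nonneg b).trans_lt h1
  have ha0 : a ≠ 0 := norm_pos_iff.1 ha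
  set w := -(b / a) with hw
  have hwn : ‖w‖ = ‖b‖ / ‖a‖ := by simp [w]
  have hnhds : annulus (1 / 2) 1 ∈ 𝓝 w := by
    refine inter_mem (continuous_norm.continuousAt.eventually (le_mem_nhds ?_))
      (continuous_norm.continuousAt.eventually (ge_mem_nhds ?_))
    · simp only [hwn]
      rw [lt_div_iff₀ ha]
      linarith
    · simp only [hwn]
      rwa [div_lt_one ha]
  obtain ⟨r, hr, hrA⟩ := Metric.mem_nhds_iff.1 hnhds
  have htop : ∫⁻ z in Metric.ball (0 : ℂ) r, ‖z‖ₑ ^ (-(2 : ℝ)) = ⊤ := by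
    by_contra h
    exact lt_irrefl _ ((lintegral_ball_enorm_rpow_ne_top_iff hr (-2)).1 h)
  have hsub : ∫⁻ l in Metric.ball w r, ‖l - w‖ₑ ^ (-(2 : ℝ)) = ⊤ := by
    rw [← htop, ← lintegral_indicator measurableSet_ball, ← lintegral_indicator measurableSet_ball,
      ← lintegral_sub_right_eq_self
        (fun z => (Metric.ball (0 : ℂ) r).indicator (fun z => ‖z‖ₑ ^ (-(2 : ℝ))) z) w]
    congr 1 with l
    simp [Set.indicator, dist_eq_norm]
  calc ∫⁻ l in annulus (1 / 2) 1, ‖l * a + b‖ₑ ^ (-(2 : ℝ))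
      = ∫⁻ l in annulus (1 / 2) 1, ‖a‖ₑ ^ (-(2 : ℝ)) * ‖l - w‖ₑ ^ (-(2 : ℝ)) := by
        congr 1 with l
        rw [← ENNReal.mul_rpow_of_ne_top (by simp) (by simp), ← enorm_mul,
          show a * (l - w) = l * a + b by rw [hw]; field_simp; ring]
    _ = ‖a‖ₑ ^ (-(2 : ℝ)) * ∫⁻ l in annulus (1 / 2) 1, ‖l - w‖ₑ ^ (-(2 : ℝ)) :=
        lintegral_const_mul _ (by fun_prop)
    _ = ⊤ := by
        rw [top_le_iff.1 (hsub.symm.le.trans (lintegral_mono_set hrA)), ENNReal.mul_top]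
        simp

theorem lintegral_add_eq_top {m : Measure ℂ} [IsFiniteMeasure m] (hm : DilationBound m) {b : ℂ}
    (hb : m {s | ‖b‖ < ‖s‖ ∧ ‖s‖ < 2 * ‖b‖} ≠ 0) : ∫⁻ s, ‖s + b‖ₑ ^ (-(2 : ℝ)) ∂m = ⊤ := by
  obtain ⟨K, hK, H⟩ := hm.average_le
  by_contra hfin
  have h1 := H (fun s => ‖s + b‖ₑ ^ (-(2 : ℝ))) (by fun_prop)
  have h2 := ae_lt_top (Measurable.lintegral_prod_right (by fun_prop)) (ne_top_of_le_ne_top (ENNReal.mul_ne_top hK hfin) h1)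
  refine hb (measure_mono_null (fun s hs => ?_) h2)
  have := lintegral_annulus_eq_top hs.1 hs.2
  exact fun h => h.ne this

section Sum

variable {n₁ n₂ : ℕ} {f₁ : (Fin n₁ → ℂ) → ℂ} {f₂ : (Fin n₂ → ℂ) → ℂ} {x₁ : Fin n₁ → ℂ} {x₂ : Fin n₂ → ℂ}

theorem lintegral_prod_add (hm₁ : Measurable f₁) (hm₂ : Measurable f₂) (V₁ : Set (Fin n₁ → ℂ))
    (V₂ : Set (Fin n₂ → ℂ)) (s : ℝ) :
    ∫⁻ y in V₁ ×ˢ V₂, ‖f₁ y.1 + f₂ y.2‖ₑ ^ s = ∫⁻ y₂ in V₂, ∫⁻ y₁ in V₁, ‖f₁ y₁ + f₂ y₂‖ₑ ^ s := by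
  rw [Measure.volume_eq_prod, ← Measure.prod_restrict]
  exact lintegral_prod_symm' _ (by fun_prop)

theorem LocInt.add (hn₁ : 1 ≤ n₁) (hm₁ : Measurable f₁) (hm₂ : Measurable f₂) (hf₁ : ContDiffAt ℂ 1 f₁ x₁)
    (h0 : f₁ x₁ = 0) (hne : ¬ ∀ᶠ y in 𝓝 x₁, f₁ y = 0) {α₁ α₂ : ℝ} (hα₁ : 0 < α₁) (hα₂ : 0 < α₂)
    (hα : α₁ + α₂ < 1) (h₁ : LocInt f₁ x₁ α₁) (h₂ : LocInt f₂ x₂ α₂) :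
    LocInt (fun y : (Fin n₁ → ℂ) × (Fin n₂ → ℂ) => f₁ y.1 + f₂ y.2) (x₁, x₂) (α₁ + α₂) := by
  obtain ⟨V₁', hV₁', hfin₁⟩ := h₁
  obtain ⟨V₂, hV₂, hfin₂⟩ := h₂
  obtain ⟨V₁, hV₁, m, c, C, hmfin, hdil, hc, -, hC, H⟩ := exists_pushforward_bounds hn₁ hm₁ hf₁ h0 hne hV₁'
  obtain ⟨D, hD, hDb⟩ := exists_lintegral_add_bound hdil hc hα₁ hα₂ hα
    (ne_top_of_le_ne_top (ENNReal.mul_ne_top hC hfin₁) (H (fun s => ‖s‖ₑ ^ (-(2 * α₁))) (by fun_prop)).2)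
  refine ⟨V₁ ×ˢ V₂, prod_mem_nhds hV₁ hV₂, ne_top_of_le_ne_top (ENNReal.mul_ne_top hD hfin₂) ?_⟩
  rw [lintegral_prod_add hm₁ hm₂, ← lintegral_const_mul _ (by fun_prop)]
  refine lintegral_mono_ae ?_
  filter_upwards [ae_lt_top (hm₂.enorm.pow_const _) hfin₂] with y hy
  refine ((H (fun s => ‖s + f₂ y‖ₑ ^ (-(2 * (α₁ + α₂)))) (by fun_prop)).1).trans (hDb _ fun h => ?_)
  rw [h, enorm_zero, ENNReal.zero_rpow_of_neg (by linarith)] at hy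
  exact lt_irrefl _ hy

theorem LocInt.le_add (hn₁ : 1 ≤ n₁) (hn₂ : 1 ≤ n₂) (hm₁ : Measurable f₁) (hm₂ : Measurable f₂)
    (hf₁ : ContDiffAt ℂ 1 f₁ x₁) (hf₂ : ContDiffAt ℂ 1 f₂ x₂) (h0₁ : f₁ x₁ = 0) (h0₂ : f₂ x₂ = 0)
    (hne₁ : ¬ ∀ᶠ y in 𝓝 x₁, f₁ y = 0) (hne₂ : ¬ ∀ᶠ y in 𝓝 x₂, f₂ y = 0) {α : ℝ} (hα : 0 ≤ α)
    (h : LocInt (fun y : (Fin n₁ → ℂ) × (Fin n₂ → ℂ) => f₁ y.1 + f₂ y.2) (x₁, x₂) α) :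
    α ≤ sSup {α | 0 ≤ α ∧ LocInt f₁ x₁ α} + sSup {α | 0 ≤ α ∧ LocInt f₂ x₂ α} := by
  obtain ⟨V, hV, hfin⟩ := h
  obtain ⟨V₁, hV₁, V₂, hV₂, hsub⟩ := mem_nhds_prod_iff.1 hV
  have key : ∀ {n : ℕ} {f : (Fin n → ℂ) → ℂ} {x : Fin n → ℂ} (_ : 1 ≤ n) (_ : Measurable f)
      (_ : ContDiffAt ℂ 1 f x) (_ : f x = 0) (_ : ¬ ∀ᶠ y in 𝓝 x, f y = 0) {V : Set (Fin n → ℂ)} (_ : V ∈ 𝓝 x),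
      ∃ c ≤ sSup {α | 0 ≤ α ∧ LocInt f x α}, ∃ k : ENNReal, k ≠ 0 ∧ ∀ t : ℝ, 0 < t → t ≤ 1 →
        k * ENNReal.ofReal (t ^ (2 * c)) ≤ volume.restrict V {y | ‖f y‖ < t} := by
    intro n f x hn hm hf h0 hne V hV
    obtain ⟨_, _, m, c, C, -, -, ⟨-, ⟨k, hk, hkt⟩, -⟩, hcL, hC, H⟩ := exists_pushforward_bounds hn hm hf h0 hne hV
    refine ⟨c, hcL, k / C, (ENNReal.div_pos hk hC).ne', fun t ht ht1 => ?_⟩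
    have h1 := (H ((Metric.ball (0 : ℂ) t).indicator 1) (measurable_one.indicator measurableSet_ball)).2
    rw [lintegral_indicator_one measurableSet_ball] at h1
    have h2 : ∫⁻ y in V, (Metric.ball (0 : ℂ) t).indicator 1 (f y) = volume.restrict V {y | ‖f y‖ < t} := by
      rw [← lintegral_indicator_one (measurableSet_lt hm.norm measurable_const)]
      simp [Set.indicator]
    rw [h2] at h1
    rw [← ENNReal.mul_div_right_comm]
    exact ENNReal.div_le_of_le_mul' ((hkt t ht ht1).trans h1)
  obtain ⟨c₁, hc₁, k₁, hk₁, hkt₁⟩ := key hn₁ hm₁ hf₁ h0₁ hne₁ hV₁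
  obtain ⟨c₂, hc₂, k₂, hk₂, hkt₂⟩ := key hn₂ hm₂ hf₂ h0₂ hne₂ hV₂
  refine le_trans ?_ (add_le_add hc₁ hc₂)
  refine le_of_lintegral_enorm_rpow_ne_top (μ := volume.restrict (V₁ ×ˢ V₂)) (t₀ := 1)
    (g := fun y : (Fin n₁ → ℂ) × (Fin n₂ → ℂ) => f₁ y.1 + f₂ y.2)
    (k := k₁ * k₂ * ENNReal.ofReal ((1 / 2) ^ (2 * (c₁ + c₂))))
    (by fun_prop) ?_ one_pos (fun t ht ht1 => ?_) hα (ne_top_of_le_ne_top hfin (lintegral_mono_set hsub))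
  · refine mul_ne_zero (mul_ne_zero hk₁ hk₂) ?_
    rw [ENNReal.ofReal_ne_zero_iff]
    positivity
  · have ht2 : 0 < 1 / 2 * t := by positivity
    calc k₁ * k₂ * ENNReal.ofReal ((1 / 2) ^ (2 * (c₁ + c₂))) * ENNReal.ofReal (t ^ (2 * (c₁ + c₂)))
        = (k₁ * ENNReal.ofReal ((1 / 2 * t) ^ (2 * c₁))) * (k₂ * ENNReal.ofReal ((1 / 2 * t) ^ (2 * c₂))) := by
          rw [mul_assoc (k₁ * k₂), ← ENNReal.ofReal_mul (by positivity), ← Real.mul_rpow (by norm_num) ht.le,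
            mul_mul_mul_comm, ← ENNReal.ofReal_mul (by positivity), ← Real.rpow_add ht2, mul_add]
      _ ≤ volume.restrict V₁ {y | ‖f₁ y‖ < 1 / 2 * t} * volume.restrict V₂ {y | ‖f₂ y‖ < 1 / 2 * t} := by
          gcongr
          · exact hkt₁ _ ht2 (by linarith)
          · exact hkt₂ _ ht2 (by linarith)
      _ = volume.restrict (V₁ ×ˢ V₂) ({y | ‖f₁ y‖ < 1 / 2 * t} ×ˢ {y | ‖f₂ y‖ < 1 / 2 * t}) := by
          rw [Measure.volume_eq_prod, ← Measure.prod_restrict, Measure.prod_prod]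
      _ ≤ _ := by
          refine measure_mono fun y hy => ?_
          have h1 : ‖f₁ y.1‖ < 1 / 2 * t := hy.1
          have h2 : ‖f₂ y.2‖ < 1 / 2 * t := hy.2
          exact (norm_add_le _ _).trans_lt (by linarith)

theorem not_locInt_add_one (hn₁ : 1 ≤ n₁) (hm₁ : Measurable f₁) (hm₂ : Measurable f₂)
    (hf₁ : ContDiffAt ℂ 1 f₁ x₁) (hf₂ : ContinuousAt f₂ x₂) (h0₁ : f₁ x₁ = 0) (h0₂ : f₂ x₂ = 0)
    (hne₁ : ¬ ∀ᶠ y in 𝓝 x₁, f₁ y = 0) {α₂ : ℝ} (hα₂ : 0 < α₂) (h₂ : LocInt f₂ x₂ α₂) :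
    ¬ LocInt (fun y : (Fin n₁ → ℂ) × (Fin n₂ → ℂ) => f₁ y.1 + f₂ y.2) (x₁, x₂) 1 := by
  rintro ⟨V, hV, hfin⟩
  obtain ⟨V₁, hV₁, V₂, hV₂, hsub⟩ := mem_nhds_prod_iff.1 hV
  obtain ⟨_, _, m, c, C, hmfin, hdil, hc, -, hC, H⟩ := exists_pushforward_bounds hn₁ hm₁ hf₁ h0₁ hne₁ hV₁
  obtain ⟨r₀, hr₀, hr⟩ := exists_annulus_measure_ne_zero hdil hc
  obtain ⟨W, hW, hnull⟩ := h₂.exists_null hα₂ hm₂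
  replace hfin := ne_top_of_le_ne_top hfin (lintegral_mono_set hsub)
  rw [lintegral_prod_add hm₁ hm₂, mul_one] at hfin
  have hlt := ae_lt_top (Measurable.lintegral_prod_right (by fun_prop)) hfin
  have hY : V₂ ∩ (W ∩ {y | ‖f₂ y‖ < r₀}) ∈ 𝓝 x₂ :=
    inter_mem hV₂ (inter_mem hW (hf₂.norm.eventually (gt_mem_nhds (by simpa [h0₂] using hr₀))))
  have hfalse : ∀ᵐ y ∂volume.restrict (interior (V₂ ∩ (W ∩ {y | ‖f₂ y‖ < r₀}))), False := by
    filter_upwards [ae_restrict_of_ae_restrict_of_subset (fun y hy => (interior_subset hy).1) hlt,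
      ae_restrict_of_ae_restrict_of_subset (fun y hy => (interior_subset hy).2.1) hnull,
      ae_restrict_mem isOpen_interior.measurableSet] with y h1 h2 h3
    have h4 := lintegral_add_eq_top hdil (hr _ (norm_pos_iff.2 h2) (interior_subset h3).2.2.le)
    have h5 := (H (fun s => ‖s + f₂ y‖ₑ ^ (-(2 : ℝ))) (by fun_prop)).2
    rw [h4, top_le_iff] at h5
    exact ENNReal.mul_ne_top hC h1.ne h5
  have hint : interior (V₂ ∩ (W ∩ {y | ‖f₂ y‖ < r₀})) ∈ 𝓝 x₂ := interior_mem_nhds.2 hY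
  have := Measure.measure_pos_of_mem_nhds volume hint
  rw [eventually_false_iff_eq_bot, ae_eq_bot, Measure.restrict_eq_zero] at hfalse
  exact this.ne' hfalse

theorem exists_pos_locInt (hn₁ : 1 ≤ n₁) (hm₁ : Measurable f₁) (hf₁ : ContDiffAt ℂ 1 f₁ x₁) (h0₁ : f₁ x₁ = 0)
    (hne₁ : ¬ ∀ᶠ y in 𝓝 x₁, f₁ y = 0) : ∃ α, 0 < α ∧ LocInt f₁ x₁ α := by
  obtain ⟨V, hV, m, c, C, -, -, hc, -, -, H⟩ := exists_pushforward_bounds hn₁ hm₁ hf₁ h0₁ hne₁ univ_mem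
  have := hc.1
  exact ⟨c / 2, by linarith, V, hV, ne_top_of_le_ne_top (hc.2.2 (c / 2) (by linarith) (by linarith))
    (H (fun s => ‖s‖ₑ ^ (-(2 * (c / 2)))) (by fun_prop)).1⟩

theorem LocInt.of_lt_sSup (hm₁ : Measurable f₁) (hf₁ : ContinuousAt f₁ x₁) (h0₁ : f₁ x₁ = 0) {α : ℝ}
    (h : α < sSup {α | 0 ≤ α ∧ LocInt f₁ x₁ α}) : LocInt f₁ x₁ α := by
  obtain ⟨β, hβ, hαβ⟩ := exists_lt_of_lt_csSup (s := {α | 0 ≤ α ∧ LocInt f₁ x₁ α})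
    ⟨0, le_rfl, LocInt.zero⟩ h
  exact hβ.2.mono hαβ.le hm₁ hf₁ h0₁

theorem sSup_locInt_add (hn₁ : 1 ≤ n₁) (hn₂ : 1 ≤ n₂) (hm₁ : Measurable f₁) (hm₂ : Measurable f₂)
    (hf₁ : ContDiffAt ℂ 1 f₁ x₁) (hf₂ : ContDiffAt ℂ 1 f₂ x₂) (h0₁ : f₁ x₁ = 0) (h0₂ : f₂ x₂ = 0)
    (hne₁ : ¬ ∀ᶠ y in 𝓝 x₁, f₁ y = 0) (hne₂ : ¬ ∀ᶠ y in 𝓝 x₂, f₂ y = 0) :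
    sSup {α | 0 ≤ α ∧ LocInt (fun y : (Fin n₁ → ℂ) × (Fin n₂ → ℂ) => f₁ y.1 + f₂ y.2) (x₁, x₂) α} =
      min 1 (sSup {α | 0 ≤ α ∧ LocInt f₁ x₁ α} + sSup {α | 0 ≤ α ∧ LocInt f₂ x₂ α}) := by
  obtain ⟨β₁, hβ₁, hi₁⟩ := exists_pos_locInt hn₁ hm₁ hf₁ h0₁ hne₁
  obtain ⟨β₂, hβ₂, hi₂⟩ := exists_pos_locInt hn₂ hm₂ hf₂ h0₂ hne₂
  have hL₁ := hβ₁.trans_le (le_csSup (bddAbove_locInt hn₁ hm₁ hf₁ h0₁) ⟨hβ₁.le, hi₁⟩)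
  have hL₂ := hβ₂.trans_le (le_csSup (bddAbove_locInt hn₂ hm₂ hf₂ h0₂) ⟨hβ₂.le, hi₂⟩)
  have hlt₁ : ∀ α < sSup {α | 0 ≤ α ∧ LocInt f₁ x₁ α}, LocInt f₁ x₁ α :=
    fun α => LocInt.of_lt_sSup hm₁ hf₁.continuousAt h0₁
  have hlt₂ : ∀ α < sSup {α | 0 ≤ α ∧ LocInt f₂ x₂ α}, LocInt f₂ x₂ α :=
    fun α => LocInt.of_lt_sSup hm₂ hf₂.continuousAt h0₂
  have hle {α : ℝ} := LocInt.le_add (α := α) hn₁ hn₂ hm₁ hm₂ hf₁ hf₂ h0₁ h0₂ hne₁ hne₂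
  set L₁ := sSup {α | 0 ≤ α ∧ LocInt f₁ x₁ α}
  set L₂ := sSup {α | 0 ≤ α ∧ LocInt f₂ x₂ α}
  have hub : ∀ α ∈ {α | 0 ≤ α ∧ LocInt (fun y : (Fin n₁ → ℂ) × (Fin n₂ → ℂ) => f₁ y.1 + f₂ y.2) (x₁, x₂) α},
      α ≤ min 1 (L₁ + L₂) := by
    rintro α ⟨hα, h⟩
    refine le_min ?_ (hle hα h)
    by_contra! h1
    refine not_locInt_add_one hn₁ hm₁ hm₂ hf₁ hf₂.continuousAt h0₁ h0₂ hne₁ hβ₂ hi₂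
      (h.mono h1.le (by fun_prop) ?_ (by simp [h0₁, h0₂]))
    exact (hf₁.continuousAt.comp continuousAt_fst).add (hf₂.continuousAt.comp continuousAt_snd)
  refine le_antisymm (csSup_le ⟨0, le_rfl, LocInt.zero⟩ hub) (le_of_forall_lt_imp_le_of_dense fun α hα => ?_)
  rcases le_or_gt α 0 with h | h
  · exact h.trans (le_csSup ⟨_, hub⟩ ⟨le_rfl, LocInt.zero⟩)
  · refine le_csSup ⟨_, hub⟩ ⟨h.le, ?_⟩
    obtain ⟨h1, h2⟩ := lt_min_iff.1 hα
    have hsum : 0 < L₁ + L₂ := by positivity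
    have hr : α / (L₁ + L₂) < 1 := (div_lt_one hsum).2 h2
    have hr0 : 0 < α / (L₁ + L₂) := by positivity
    have heq : α / (L₁ + L₂) * L₁ + α / (L₁ + L₂) * L₂ = α := by field_simp
    rw [← heq]
    exact LocInt.add hn₁ hm₁ hm₂ hf₁ h0₁ hne₁ (by positivity) (by positivity) (by rwa [heq])
      (hlt₁ _ (by nlinarith)) (hlt₂ _ (by nlinarith))

end Sum

/-- Addition theorem for log canonical thresholds (germ-level version of Corollary 1 (5)):
for `f = f₁ ∘ pr₁ + f₂ ∘ pr₂` one has `lct(f, x) = min {1, lct(f₁, x₁) + lct(f₂, x₂)}`. -/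
theorem lct_add
    {n₁ n₂ : ℕ} (hn₁ : 1 ≤ n₁) (hn₂ : 1 ≤ n₂)
    (U₁ : Set (Fin n₁ → ℂ)) (U₂ : Set (Fin n₂ → ℂ))
    (hU₁ : IsOpen U₁) (hU₂ : IsOpen U₂)
    (f₁ : (Fin n₁ → ℂ) → ℂ) (f₂ : (Fin n₂ → ℂ) → ℂ)
    (hf₁ : DifferentiableOn ℂ f₁ U₁) (hf₂ : DifferentiableOn ℂ f₂ U₂)
    (x₁ : Fin n₁ → ℂ) (x₂ : Fin n₂ → ℂ) (hx₁ : x₁ ∈ U₁) (hx₂ : x₂ ∈ U₂)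
    (hf₁0 : f₁ x₁ = 0) (hf₂0 : f₂ x₂ = 0)
    (hne₁ : ¬ (f₁ =ᶠ[𝓝 x₁] 0)) (hne₂ : ¬ (f₂ =ᶠ[𝓝 x₂] 0))
    (f : ((Fin n₁ → ℂ) × (Fin n₂ → ℂ)) → ℂ) (hf : f = fun p => f₁ p.1 + f₂ p.2)
    (x : (Fin n₁ → ℂ) × (Fin n₂ → ℂ)) (hx : x = (x₁, x₂)) :
    Lct f (U₁ ×ˢ U₂) x = min 1 (Lct f₁ U₁ x₁ + Lct f₂ U₂ x₂) := by
  subst hf hx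
  have reg : ∀ {n : ℕ} {U : Set (Fin n → ℂ)} {g : (Fin n → ℂ) → ℂ} {x : Fin n → ℂ}, IsOpen U →
      DifferentiableOn ℂ g U → x ∈ U → ¬ (g =ᶠ[𝓝 x] 0) →
      Measurable (U.indicator g) ∧ ContDiffAt ℂ 1 (U.indicator g) x ∧ ¬ ∀ᶠ y in 𝓝 x, U.indicator g y = 0 := by
    intro n U g x hU hg hx hne
    have he : U.indicator g =ᶠ[𝓝 x] g := by
      filter_upwards [hU.mem_nhds hx] with y hy
      exact Set.indicator_of_mem hy g
    refine ⟨?_, ?_, fun h => hne ?_⟩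
    · classical
      rw [← Set.piecewise_eq_indicator]
      exact hg.continuousOn.measurable_piecewise continuousOn_const hU.measurableSet
    · refine (contDiffAt_one_of_eventually_differentiableAt ?_).congr_of_eventuallyEq he
      filter_upwards [hU.mem_nhds hx] with y hy
      exact hg.differentiableAt (hU.mem_nhds hy)
    · exact he.symm.trans h
  obtain ⟨hm₁, hc₁, hz₁⟩ := reg hU₁ hf₁ hx₁ hne₁
  obtain ⟨hm₂, hc₂, hz₂⟩ := reg hU₂ hf₂ hx₂ hne₂
  have h0₁ : U₁.indicator f₁ x₁ = 0 := by rw [Set.indicator_of_mem hx₁, hf₁0]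
  have h0₂ : U₂.indicator f₂ x₂ = 0 := by rw [Set.indicator_of_mem hx₂, hf₂0]
  obtain ⟨β₁, hβ₁, hi₁⟩ := exists_pos_locInt hn₁ hm₁ hc₁ h0₁ hz₁
  obtain ⟨β₂, hβ₂, hi₂⟩ := exists_pos_locInt hn₂ hm₂ hc₂ h0₂ hz₂
  obtain ⟨β, hβ, hi⟩ : ∃ β, 0 < β ∧ LocInt
      (fun y : (Fin n₁ → ℂ) × (Fin n₂ → ℂ) => U₁.indicator f₁ y.1 + U₂.indicator f₂ y.2) (x₁, x₂) β := by
    refine ⟨min β₁ (1 / 4) + min β₂ (1 / 4), by positivity,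
      LocInt.add hn₁ hm₁ hm₂ hc₁ h0₁ hz₁ (by positivity) (by positivity) ?_
        (hi₁.mono (min_le_left _ _) hm₁ hc₁.continuousAt h0₁) (hi₂.mono (min_le_left _ _) hm₂ hc₂.continuousAt h0₂)⟩
    linarith [min_le_right β₁ (1 / 4), min_le_right β₂ (1 / 4)]
  rw [lct_eq_sSup_locInt hU₁ hx₁ hm₁ (fun y hy => Set.indicator_of_mem hy f₁) hβ₁ hi₁,
    lct_eq_sSup_locInt hU₂ hx₂ hm₂ (fun y hy => Set.indicator_of_mem hy f₂) hβ₂ hi₂,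
    lct_eq_sSup_locInt (hU₁.prod hU₂) ⟨hx₁, hx₂⟩ (by fun_prop) (fun y hy => ?_) hβ hi]
  · exact sSup_locInt_add hn₁ hn₂ hm₁ hm₂ hc₁ hc₂ h0₁ h0₂ hz₁ hz₂
  · rw [Set.indicator_of_mem hy.1, Set.indicator_of_mem hy.2]
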